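/- PN¬ Coherence: the functor G from PN¬ to Br is faithful; that is, for all arrow terms f, g : A ⊢ B of PN¬, if Gf = Gg in Br then f = g in PN¬. -/

import Mathlib

/-! ### The category Br of Brauerian split equivalences of finite ordinals

An arrow `m ⊢ n` of `Br` is represented as a relation on `ℕ ⊕ ℕ`, where
`Sum.inl i` (with `i < m`) is the source copy `i_s` and `Sum.inr j`
(with `j < n`) is the target copy `j_t`. -/

abbrev GRel : Type := (ℕ ⊕ ℕ) → (ℕ ⊕ ℕ) → Prop

/-- The identity arrow of `Br` on `n`: transversals `{i_s, i_t}` for `i < n`. -/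
def gId (n : ℕ) : GRel := fun u v =>
  ∃ i, i < n ∧ (u = Sum.inl i ∨ u = Sum.inr i) ∧ (v = Sum.inl i ∨ v = Sum.inr i)

/-- The Brauerian split equivalence whose transversals are `{i_s, (φ i)_t}` for `i < m`. -/
def gFun (m : ℕ) (φ : ℕ → ℕ) : GRel := fun u v =>
  ∃ i, i < m ∧ (u = Sum.inl i ∨ u = Sum.inr (φ i)) ∧ (v = Sum.inl i ∨ v = Sum.inr (φ i))

/-- The block transposition exchanging the first `a` and the last `b` elements. -/
def gSwap (a b : ℕ) : GRel :=
  gFun (a + b) (fun i => if i < a then i + b else i - a)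

/-- `G Δ̂∧_{B,A}` with `a = GA`, `b = GB`: identity transversals on the stem `A`
together with caps joining the two copies of each letter occurrence of `B` in
the crown `¬B ∨ B` of the target. -/
def gDelta (a b : ℕ) : GRel := fun u v =>
  (∃ i, i < a ∧ (u = Sum.inl i ∨ u = Sum.inr i) ∧ (v = Sum.inl i ∨ v = Sum.inr i)) ∨
  (∃ j, j < b ∧ (u = Sum.inr (a + j) ∨ u = Sum.inr (a + b + j)) ∧
                (v = Sum.inr (a + j) ∨ v = Sum.inr (a + b + j)))

/-- `G Σ̂∨_{B,A}` with `a = GA`, `b = GB`: identity transversals on the stem `A`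
together with cups joining the two copies of each letter occurrence of `B` in
the crown `B ∧ ¬B` of the source. -/
def gSigma (a b : ℕ) : GRel := fun u v =>
  (∃ i, i < a ∧ (u = Sum.inl (2*b + i) ∨ u = Sum.inr i) ∧
                (v = Sum.inl (2*b + i) ∨ v = Sum.inr i)) ∨
  (∃ j, j < b ∧ (u = Sum.inl j ∨ u = Sum.inl (b + j)) ∧
                (v = Sum.inl j ∨ v = Sum.inl (b + j)))

/-- Composition `P ∗ R` in `Br`: glue along the middle copy and take the
transitive closure, restricted to the outer copies. -/
def gComp (Pr R : GRel) : GRel := fun u v =>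
  Relation.TransGen
    (fun x y : ℕ ⊕ ℕ ⊕ ℕ =>
      (∃ x' y', Sum.map id Sum.inl x' = x ∧ Sum.map id Sum.inl y' = y ∧ R x' y') ∨
      (∃ x' y', Sum.inr x' = x ∧ Sum.inr y' = y ∧ Pr x' y'))
    (Sum.map id Sum.inr u) (Sum.map id Sum.inr v)

/-- Shift a split relation by `a` on the source side and by `d` on the target side. -/
def gShift (a d : ℕ) (R : GRel) : GRel := fun u v =>
  ∃ u' v', R u' v' ∧ u = Sum.map (· + a) (· + d) u' ∧ v = Sum.map (· + a) (· + d) v'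

/-- Disjoint union of split relations: `G(f ξ g) = Gf ∪ Gg_{+GD}^{+GA}`. -/
def gPar (a d : ℕ) (R S : GRel) : GRel := fun u v => R u v ∨ gShift a d S u v
/-! ### The language L¬,∧,∨ generated from the set `P` of letters -/

inductive Form (P : Type) : Type
  | letter : P → Form P
  | neg : Form P → Form P
  | conj : Form P → Form P → Form P
  | disj : Form P → Form P → Form P

infixr:70 " ⋏ " => Form.conj
infixr:66 " ⋎ " => Form.disj
prefix:77 "∼" => Form.neg

/-- The number of occurrences of letters in a formula (the object map of `G`). -/
def Form.size {P : Type} : Form P → ℕ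
  | .letter _ => 1
  | .neg A => A.size
  | .conj A B => A.size + B.size
  | .disj A B => A.size + B.size
/-! ### Arrow terms of the free proof-net category PN¬ -/

inductive Term (P : Type) : Form P → Form P → Type
  | id (A : Form P) : Term P A A
  | comp {A B C : Form P} : Term P B C → Term P A B → Term P A C
  | conj {A B D E : Form P} : Term P A D → Term P B E → Term P (A ⋏ B) (D ⋏ E)
  | disj {A B D E : Form P} : Term P A D → Term P B E → Term P (A ⋎ B) (D ⋎ E)
  | bConjTo (A B C : Form P) : Term P (A ⋏ (B ⋏ C)) ((A ⋏ B) ⋏ C)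
  | bConjFrom (A B C : Form P) : Term P ((A ⋏ B) ⋏ C) (A ⋏ (B ⋏ C))
  | bDisjTo (A B C : Form P) : Term P (A ⋎ (B ⋎ C)) ((A ⋎ B) ⋎ C)
  | bDisjFrom (A B C : Form P) : Term P ((A ⋎ B) ⋎ C) (A ⋎ (B ⋎ C))
  | cConj (A B : Form P) : Term P (A ⋏ B) (B ⋏ A)
  | cDisj (A B : Form P) : Term P (B ⋎ A) (A ⋎ B)
  | d (A B C : Form P) : Term P (A ⋏ (B ⋎ C)) ((A ⋏ B) ⋎ C)
  | delta (B A : Form P) : Term P A (A ⋏ (∼B ⋎ B))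
  | sigma (B A : Form P) : Term P ((B ⋏ ∼B) ⋎ A) A

infixr:80 " ⬝ " => Term.comp
infixr:70 " ⊼ " => Term.conj
infixr:66 " ⊽ " => Term.disj

/-- The arrow `d^R_{C,B,A} : (C∨B)∧A ⊢ C∨(B∧A)`. -/
def dR {P : Type} (C B A : Form P) : Term P ((C ⋎ B) ⋏ A) (C ⋎ (B ⋏ A)) :=
  Term.cDisj C (B ⋏ A) ⬝ ((Term.cConj A B ⊽ Term.id C) ⬝
    (Term.d A B C ⬝ ((Term.id A ⊼ Term.cDisj B C) ⬝ Term.cConj (C ⋎ B) A)))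

/-- `Σ̂∧_{B,A} = ĉ∧ ∘ Δ̂∧_{B,A} : A ⊢ (¬B∨B)∧A`. -/
def sigmaConj {P : Type} (B A : Form P) : Term P A ((∼B ⋎ B) ⋏ A) :=
  Term.cConj A (∼B ⋎ B) ⬝ Term.delta B A

/-- `Δ̂∨_{B,A} = Σ̂∨_{B,A} ∘ ĉ∨ : A∨(B∧¬B) ⊢ A`. -/
def deltaDisj {P : Type} (B A : Form P) : Term P (A ⋎ (B ⋏ ∼B)) A :=
  Term.sigma B A ⬝ Term.cDisj (B ⋏ ∼B) A

/-- `Δ̂∧′_{B,A} = (1_A ∧ ĉ∨) ∘ Δ̂∧_{B,A} : A ⊢ A∧(B∨¬B)`. -/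
def delta' {P : Type} (B A : Form P) : Term P A (A ⋏ (B ⋎ ∼B)) :=
  (Term.id A ⊼ Term.cDisj B (∼B)) ⬝ Term.delta B A

/-- `Σ̂∨′_{B,A} = Σ̂∨_{B,A} ∘ (ĉ∧ ∨ 1_A) : (¬B∧B)∨A ⊢ A`. -/
def sigma' {P : Type} (B A : Form P) : Term P ((∼B ⋏ B) ⋎ A) A :=
  Term.sigma B A ⬝ (Term.cConj (∼B) B ⊽ Term.id A)
/-! ### The equations of DS, imposed on arrow terms -/

inductive Eqv {P : Type} : ∀ {A B : Form P}, Term P A B → Term P A B → Prop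
  -- equivalence and congruence
  | refl {A B : Form P} (f : Term P A B) : Eqv f f
  | symm {A B : Form P} {f g : Term P A B} : Eqv f g → Eqv g f
  | trans {A B : Form P} {f g h : Term P A B} : Eqv f g → Eqv g h → Eqv f h
  | congComp {A B C : Form P} {g g' : Term P B C} {f f' : Term P A B} :
      Eqv g g' → Eqv f f' → Eqv (g ⬝ f) (g' ⬝ f')
  | congConj {A B D E : Form P} {f f' : Term P A D} {g g' : Term P B E} :
      Eqv f f' → Eqv g g' → Eqv (f ⊼ g) (f' ⊼ g')
  | congDisj {A B D E : Form P} {f f' : Term P A D} {g g' : Term P B E} :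
      Eqv f f' → Eqv g g' → Eqv (f ⊽ g) (f' ⊽ g')
  -- (cat 1), (cat 2)
  | catIdR {A B : Form P} (f : Term P A B) : Eqv (f ⬝ Term.id A) f
  | catIdL {A B : Form P} (f : Term P A B) : Eqv (Term.id B ⬝ f) f
  | catAssoc {A B C D : Form P} (f : Term P A B) (g : Term P B C) (h : Term P C D) :
      Eqv (h ⬝ (g ⬝ f)) ((h ⬝ g) ⬝ f)
  -- bifunctorial equations (ξ 1), (ξ 2)
  | conjOne (A B : Form P) : Eqv (Term.id A ⊼ Term.id B) (Term.id (A ⋏ B))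
  | disjOne (A B : Form P) : Eqv (Term.id A ⊽ Term.id B) (Term.id (A ⋎ B))
  | conjTwo {A₁ B₁ C₁ A₂ B₂ C₂ : Form P} (g₁ : Term P B₁ C₁) (f₁ : Term P A₁ B₁)
      (g₂ : Term P B₂ C₂) (f₂ : Term P A₂ B₂) :
      Eqv ((g₁ ⬝ f₁) ⊼ (g₂ ⬝ f₂)) ((g₁ ⊼ g₂) ⬝ (f₁ ⊼ f₂))
  | disjTwo {A₁ B₁ C₁ A₂ B₂ C₂ : Form P} (g₁ : Term P B₁ C₁) (f₁ : Term P A₁ B₁)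
      (g₂ : Term P B₂ C₂) (f₂ : Term P A₂ B₂) :
      Eqv ((g₁ ⬝ f₁) ⊽ (g₂ ⬝ f₂)) ((g₁ ⊽ g₂) ⬝ (f₁ ⊽ f₂))
  -- naturality equations
  | bConjNat {A B C D E F : Form P} (f : Term P A D) (g : Term P B E) (h : Term P C F) :
      Eqv (((f ⊼ g) ⊼ h) ⬝ Term.bConjTo A B C) (Term.bConjTo D E F ⬝ (f ⊼ (g ⊼ h)))
  | bDisjNat {A B C D E F : Form P} (f : Term P A D) (g : Term P B E) (h : Term P C F) :
      Eqv (((f ⊽ g) ⊽ h) ⬝ Term.bDisjTo A B C) (Term.bDisjTo D E F ⬝ (f ⊽ (g ⊽ h)))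
  | cConjNat {A B D E : Form P} (f : Term P A D) (g : Term P B E) :
      Eqv ((g ⊼ f) ⬝ Term.cConj A B) (Term.cConj D E ⬝ (f ⊼ g))
  | cDisjNat {A B D E : Form P} (f : Term P A D) (g : Term P B E) :
      Eqv ((g ⊽ f) ⬝ Term.cDisj B A) (Term.cDisj E D ⬝ (f ⊽ g))
  | dNat {A B C D E F : Form P} (f : Term P A D) (g : Term P B E) (h : Term P C F) :
      Eqv (((f ⊼ g) ⊽ h) ⬝ Term.d A B C) (Term.d D E F ⬝ (f ⊼ (g ⊽ h)))
  -- (b̂ξ b̂ξ)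
  | bConjIso₁ (A B C : Form P) :
      Eqv (Term.bConjFrom A B C ⬝ Term.bConjTo A B C) (Term.id (A ⋏ (B ⋏ C)))
  | bConjIso₂ (A B C : Form P) :
      Eqv (Term.bConjTo A B C ⬝ Term.bConjFrom A B C) (Term.id ((A ⋏ B) ⋏ C))
  | bDisjIso₁ (A B C : Form P) :
      Eqv (Term.bDisjFrom A B C ⬝ Term.bDisjTo A B C) (Term.id (A ⋎ (B ⋎ C)))
  | bDisjIso₂ (A B C : Form P) :
      Eqv (Term.bDisjTo A B C ⬝ Term.bDisjFrom A B C) (Term.id ((A ⋎ B) ⋎ C))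
  -- (b̂ξ 5)
  | bConjPent (A B C D : Form P) :
      Eqv (Term.bConjFrom A B (C ⋏ D) ⬝ Term.bConjFrom (A ⋏ B) C D)
        ((Term.id A ⊼ Term.bConjFrom B C D) ⬝
          (Term.bConjFrom A (B ⋏ C) D ⬝ (Term.bConjFrom A B C ⊼ Term.id D)))
  | bDisjPent (A B C D : Form P) :
      Eqv (Term.bDisjFrom A B (C ⋎ D) ⬝ Term.bDisjFrom (A ⋎ B) C D)
        ((Term.id A ⊽ Term.bDisjFrom B C D) ⬝
          (Term.bDisjFrom A (B ⋎ C) D ⬝ (Term.bDisjFrom A B C ⊽ Term.id D)))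
  -- (ĉ∧ ĉ∧), (ĉ∨ ĉ∨)
  | cConjIso (A B : Form P) : Eqv (Term.cConj B A ⬝ Term.cConj A B) (Term.id (A ⋏ B))
  | cDisjIso (A B : Form P) : Eqv (Term.cDisj A B ⬝ Term.cDisj B A) (Term.id (A ⋎ B))
  -- (b̂∧ ĉ∧), (b̂∨ ĉ∨)
  | bcConj (A B C : Form P) :
      Eqv ((Term.id B ⊼ Term.cConj C A) ⬝ (Term.bConjFrom B C A ⬝
            (Term.cConj A (B ⋏ C) ⬝ (Term.bConjFrom A B C ⬝ (Term.cConj B A ⊼ Term.id C)))))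
        (Term.bConjFrom B A C)
  | bcDisj (A B C : Form P) :
      Eqv ((Term.id B ⊽ Term.cDisj A C) ⬝ (Term.bDisjFrom B C A ⬝
            (Term.cDisj (B ⋎ C) A ⬝ (Term.bDisjFrom A B C ⬝ (Term.cDisj A B ⊽ Term.id C)))))
        (Term.bDisjFrom B A C)
  -- (d ∧), (d ∨)
  | dConj (A B C D : Form P) :
      Eqv ((Term.bConjFrom A B C ⊽ Term.id D) ⬝ Term.d (A ⋏ B) C D)
        (Term.d A (B ⋏ C) D ⬝ ((Term.id A ⊼ Term.d B C D) ⬝ Term.bConjFrom A B (C ⋎ D)))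
  | dDisj (D C B A : Form P) :
      Eqv (Term.d D C (B ⋎ A) ⬝ (Term.id D ⊼ Term.bDisjFrom C B A))
        (Term.bDisjFrom (D ⋏ C) B A ⬝ ((Term.d D C B ⊽ Term.id A) ⬝ Term.d D (C ⋎ B) A))
  -- (d b̂∧), (d b̂∨)
  | dBConj (A B C D : Form P) :
      Eqv (dR (A ⋏ B) C D ⬝ (Term.d A B C ⊼ Term.id D))
        (Term.d A B (C ⋏ D) ⬝ ((Term.id A ⊼ dR B C D) ⬝ Term.bConjFrom A (B ⋎ C) D))
  | dBDisj (D C B A : Form P) :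
      Eqv ((Term.id D ⊽ Term.d C B A) ⬝ dR D C (B ⋎ A))
        (Term.bDisjFrom D (C ⋏ B) A ⬝ ((dR D C B ⊽ Term.id A) ⬝ Term.d (D ⋎ C) B A))
  -- (Δ̂∧ nat)
  | deltaNat {A D : Form P} (B : Form P) (f : Term P A D) :
      Eqv ((f ⊼ Term.id (∼B ⋎ B)) ⬝ Term.delta B A) (Term.delta B D ⬝ f)
  -- (Σ̂∨ nat)
  | sigmaNat {A D : Form P} (B : Form P) (f : Term P A D) :
      Eqv (f ⬝ Term.sigma B A) (Term.sigma B D ⬝ (Term.id (B ⋏ ∼B) ⊽ f))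
  -- (b̂∧ Δ̂∧)
  | bDelta (A B C : Form P) :
      Eqv (Term.bConjFrom A B (∼C ⋎ C) ⬝ Term.delta C (A ⋏ B)) (Term.id A ⊼ Term.delta C B)
  -- (b̂∨ Σ̂∨)
  | bSigma (C B A : Form P) :
      Eqv (Term.sigma C (B ⋎ A) ⬝ Term.bDisjFrom (C ⋏ ∼C) B A) (Term.sigma C B ⊽ Term.id A)
  -- (d Σ̂∧)
  | dSigmaConj (A B C : Form P) :
      Eqv (Term.d (∼A ⋎ A) B C ⬝ sigmaConj A (B ⋎ C)) (sigmaConj A B ⊽ Term.id C)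
  -- (d Δ̂∨)
  | dDeltaDisj (A C B : Form P) :
      Eqv (deltaDisj A (C ⋏ B) ⬝ Term.d C B (A ⋏ ∼A)) (Term.id C ⊼ deltaDisj A B)
  -- (Σ̂∨ Δ̂∧)
  | sigmaDelta (A : Form P) :
      Eqv (Term.sigma A A ⬝ (Term.d A (∼A) A ⬝ Term.delta A A)) (Term.id A)
  -- (Σ̂∨′ Δ̂∧′)
  | sigmaDelta' (A : Form P) :
      Eqv (sigma' A (∼A) ⬝ (Term.d (∼A) A (∼A) ⬝ delta' A (∼A))) (Term.id (∼A))
/-- The functor `G` from DS to Br on arrow terms. -/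
def Term.G {P : Type} : ∀ {A B : Form P}, Term P A B → GRel
  | _, _, .id A => gId A.size
  | _, _, .comp g f => gComp (Term.G g) (Term.G f)
  | _, _, @Term.conj _ A _ D _ f g => gPar A.size D.size (Term.G f) (Term.G g)
  | _, _, @Term.disj _ A _ D _ f g => gPar A.size D.size (Term.G f) (Term.G g)
  | _, _, .bConjTo A B C => gId (A.size + (B.size + C.size))
  | _, _, .bConjFrom A B C => gId (A.size + B.size + C.size)
  | _, _, .bDisjTo A B C => gId (A.size + (B.size + C.size))
  | _, _, .bDisjFrom A B C => gId (A.size + B.size + C.size)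
  | _, _, .cConj A B => gSwap A.size B.size
  | _, _, .cDisj A B => gSwap B.size A.size
  | _, _, .d A B C => gId (A.size + (B.size + C.size))
  | _, _, .delta B A => gDelta A.size B.size
  | _, _, .sigma B A => gSigma A.size B.size

namespace PNC
open CategoryTheory
variable {P : Type}

/-! ## The category -/

instance termSetoid (A B : Form P) : Setoid (Term P A B) :=
  ⟨Eqv, Eqv.refl, Eqv.symm, Eqv.trans⟩

instance formCat : Category (Form P) where
  Hom A B := Quotient (termSetoid A B)
  id A := Quotient.mk _ (Term.id A)
  comp f g := Quotient.map₂ (fun f g => Term.comp g f)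
    (fun _ _ h _ _ h' => Eqv.congComp h' h) f g
  id_comp f := by
    induction f using Quotient.inductionOn
    exact Quotient.sound (Eqv.catIdR _)
  comp_id f := by
    induction f using Quotient.inductionOn
    exact Quotient.sound (Eqv.catIdL _)
  assoc f g h := by
    induction f using Quotient.inductionOn
    induction g using Quotient.inductionOn
    induction h using Quotient.inductionOn
    exact Quotient.sound (Eqv.catAssoc _ _ _)

/-- The arrow of a term. -/
def mk {A B : Form P} (f : Term P A B) : A ⟶ B := Quotient.mk (termSetoid A B) f

theorem mk_eq {A B : Form P} {f g : Term P A B} : mk f = mk g ↔ Eqv f g :=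
  ⟨fun h => Quotient.exact h, fun h => Quotient.sound h⟩

theorem mk_surj {A B : Form P} (f : A ⟶ B) : ∃ t, mk t = f := Quotient.exists_rep f

theorem mk_id (A : Form P) : mk (Term.id A) = 𝟙 A := rfl
theorem mk_comp {A B C : Form P} (g : Term P B C) (f : Term P A B) :
    mk (Term.comp g f) = mk f ≫ mk g := rfl

/-- Conjunction on arrows. -/
def tm {A B D E : Form P} (f : A ⟶ D) (g : B ⟶ E) : (A ⋏ B) ⟶ (D ⋏ E) :=
  Quotient.map₂ Term.conj (fun _ _ h _ _ h' => Eqv.congConj h h') f g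
/-- Disjunction on arrows. -/
def pm {A B D E : Form P} (f : A ⟶ D) (g : B ⟶ E) : (A ⋎ B) ⟶ (D ⋎ E) :=
  Quotient.map₂ Term.disj (fun _ _ h _ _ h' => Eqv.congDisj h h') f g

infixr:70 " ⩕ " => tm
infixr:66 " ⩖ " => pm

theorem mk_conj {A B D E : Form P} (f : Term P A D) (g : Term P B E) :
    mk (Term.conj f g) = mk f ⩕ mk g := rfl
theorem mk_disj {A B D E : Form P} (f : Term P A D) (g : Term P B E) :
    mk (Term.disj f g) = mk f ⩖ mk g := rfl

def ta (A B C : Form P) : (A ⋏ (B ⋏ C)) ⟶ ((A ⋏ B) ⋏ C) := mk (.bConjTo A B C)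
def ta' (A B C : Form P) : ((A ⋏ B) ⋏ C) ⟶ (A ⋏ (B ⋏ C)) := mk (.bConjFrom A B C)
def pa (A B C : Form P) : (A ⋎ (B ⋎ C)) ⟶ ((A ⋎ B) ⋎ C) := mk (.bDisjTo A B C)
def pa' (A B C : Form P) : ((A ⋎ B) ⋎ C) ⟶ (A ⋎ (B ⋎ C)) := mk (.bDisjFrom A B C)
def tc (A B : Form P) : (A ⋏ B) ⟶ (B ⋏ A) := mk (.cConj A B)
def pc (A B : Form P) : (A ⋎ B) ⟶ (B ⋎ A) := mk (.cDisj B A)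
def dd (A B C : Form P) : (A ⋏ (B ⋎ C)) ⟶ ((A ⋏ B) ⋎ C) := mk (.d A B C)
def de (B A : Form P) : A ⟶ A ⋏ (∼B ⋎ B) := mk (.delta B A)
def si (B A : Form P) : (B ⋏ ∼B) ⋎ A ⟶ A := mk (.sigma B A)
def dr (C B A : Form P) : (C ⋎ B) ⋏ A ⟶ C ⋎ (B ⋏ A) :=
  tc (C ⋎ B) A ≫ (𝟙 A ⩕ pc C B) ≫ dd A B C ≫ (tc A B ⩖ 𝟙 C) ≫ pc (B ⋏ A) C

theorem ra {A B C D : Form P} {f : A ⟶ B} {g : B ⟶ C} {k : A ⟶ C} (h : f ≫ g = k)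
    (z : C ⟶ D) : f ≫ g ≫ z = k ≫ z := by rw [← h, Category.assoc]
theorem ra3 {A B C C' D : Form P} {f : A ⟶ B} {g : B ⟶ C} {g' : C ⟶ C'} {k : A ⟶ C'}
    (h : f ≫ g ≫ g' = k) (z : C' ⟶ D) : f ≫ g ≫ g' ≫ z = k ≫ z := by
  rw [← h]; simp only [Category.assoc]

@[simp] theorem tm_id (A B : Form P) : 𝟙 A ⩕ 𝟙 B = 𝟙 (A ⋏ B) :=
  Quotient.sound (Eqv.conjOne A B)
@[simp] theorem pm_id (A B : Form P) : 𝟙 A ⩖ 𝟙 B = 𝟙 (A ⋎ B) :=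
  Quotient.sound (Eqv.disjOne A B)
theorem tm_comp {A₁ B₁ C₁ A₂ B₂ C₂ : Form P} (f₁ : A₁ ⟶ B₁) (g₁ : B₁ ⟶ C₁)
    (f₂ : A₂ ⟶ B₂) (g₂ : B₂ ⟶ C₂) : (f₁ ⩕ f₂) ≫ (g₁ ⩕ g₂) = (f₁ ≫ g₁) ⩕ (f₂ ≫ g₂) := by
  obtain ⟨f₁, rfl⟩ := mk_surj f₁
  obtain ⟨f₂, rfl⟩ := mk_surj f₂
  obtain ⟨g₁, rfl⟩ := mk_surj g₁
  obtain ⟨g₂, rfl⟩ := mk_surj g₂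
  exact Quotient.sound (Eqv.conjTwo _ _ _ _).symm
theorem pm_comp {A₁ B₁ C₁ A₂ B₂ C₂ : Form P} (f₁ : A₁ ⟶ B₁) (g₁ : B₁ ⟶ C₁)
    (f₂ : A₂ ⟶ B₂) (g₂ : B₂ ⟶ C₂) : (f₁ ⩖ f₂) ≫ (g₁ ⩖ g₂) = (f₁ ≫ g₁) ⩖ (f₂ ≫ g₂) := by
  obtain ⟨f₁, rfl⟩ := mk_surj f₁
  obtain ⟨f₂, rfl⟩ := mk_surj f₂
  obtain ⟨g₁, rfl⟩ := mk_surj g₁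
  obtain ⟨g₂, rfl⟩ := mk_surj g₂
  exact Quotient.sound (Eqv.disjTwo _ _ _ _).symm
theorem tm_comp_assoc {A₁ B₁ C₁ A₂ B₂ C₂ Z : Form P} (f₁ : A₁ ⟶ B₁) (g₁ : B₁ ⟶ C₁)
    (f₂ : A₂ ⟶ B₂) (g₂ : B₂ ⟶ C₂) (z : _ ⟶ Z) :
    (f₁ ⩕ f₂) ≫ (g₁ ⩕ g₂) ≫ z = ((f₁ ≫ g₁) ⩕ (f₂ ≫ g₂)) ≫ z := ra (tm_comp ..) z
theorem pm_comp_assoc {A₁ B₁ C₁ A₂ B₂ C₂ Z : Form P} (f₁ : A₁ ⟶ B₁) (g₁ : B₁ ⟶ C₁)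
    (f₂ : A₂ ⟶ B₂) (g₂ : B₂ ⟶ C₂) (z : _ ⟶ Z) :
    (f₁ ⩖ f₂) ≫ (g₁ ⩖ g₂) ≫ z = ((f₁ ≫ g₁) ⩖ (f₂ ≫ g₂)) ≫ z := ra (pm_comp ..) z

@[simp] theorem ta_ta' (A B C : Form P) : ta A B C ≫ ta' A B C = 𝟙 _ :=
  Quotient.sound (Eqv.bConjIso₁ A B C)
@[simp] theorem ta'_ta (A B C : Form P) : ta' A B C ≫ ta A B C = 𝟙 _ :=
  Quotient.sound (Eqv.bConjIso₂ A B C)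
@[simp] theorem pa_pa' (A B C : Form P) : pa A B C ≫ pa' A B C = 𝟙 _ :=
  Quotient.sound (Eqv.bDisjIso₁ A B C)
@[simp] theorem pa'_pa (A B C : Form P) : pa' A B C ≫ pa A B C = 𝟙 _ :=
  Quotient.sound (Eqv.bDisjIso₂ A B C)
@[simp] theorem tc_tc (A B : Form P) : tc A B ≫ tc B A = 𝟙 _ :=
  Quotient.sound (Eqv.cConjIso A B)
@[simp] theorem pc_pc (A B : Form P) : pc A B ≫ pc B A = 𝟙 _ :=
  Quotient.sound (Eqv.cDisjIso A B)
section
variable {Z : Form P}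
@[simp] theorem ta_ta'_a (A B C : Form P) (z : _ ⟶ Z) : ta A B C ≫ ta' A B C ≫ z = z := by
  rw [ra (ta_ta' A B C), Category.id_comp]
@[simp] theorem ta'_ta_a (A B C : Form P) (z : _ ⟶ Z) : ta' A B C ≫ ta A B C ≫ z = z := by
  rw [ra (ta'_ta A B C), Category.id_comp]
@[simp] theorem pa_pa'_a (A B C : Form P) (z : _ ⟶ Z) : pa A B C ≫ pa' A B C ≫ z = z := by
  rw [ra (pa_pa' A B C), Category.id_comp]
@[simp] theorem pa'_pa_a (A B C : Form P) (z : _ ⟶ Z) : pa' A B C ≫ pa A B C ≫ z = z := by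
  rw [ra (pa'_pa A B C), Category.id_comp]
@[simp] theorem tc_tc_a (A B : Form P) (z : _ ⟶ Z) : tc A B ≫ tc B A ≫ z = z := by
  rw [ra (tc_tc A B), Category.id_comp]
@[simp] theorem pc_pc_a (A B : Form P) (z : _ ⟶ Z) : pc A B ≫ pc B A ≫ z = z := by
  rw [ra (pc_pc A B), Category.id_comp]
end

section
variable {A B C D E F : Form P} (f : A ⟶ D) (g : B ⟶ E) (h : C ⟶ F)
theorem ta_nat : (f ⩕ (g ⩕ h)) ≫ ta D E F = ta A B C ≫ ((f ⩕ g) ⩕ h) := by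
  obtain ⟨f, rfl⟩ := mk_surj f
  obtain ⟨g, rfl⟩ := mk_surj g
  obtain ⟨h, rfl⟩ := mk_surj h
  exact Quotient.sound (Eqv.bConjNat f g h).symm
theorem pa_nat : (f ⩖ (g ⩖ h)) ≫ pa D E F = pa A B C ≫ ((f ⩖ g) ⩖ h) := by
  obtain ⟨f, rfl⟩ := mk_surj f
  obtain ⟨g, rfl⟩ := mk_surj g
  obtain ⟨h, rfl⟩ := mk_surj h
  exact Quotient.sound (Eqv.bDisjNat f g h).symm
theorem dd_nat : (f ⩕ (g ⩖ h)) ≫ dd D E F = dd A B C ≫ ((f ⩕ g) ⩖ h) := by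
  obtain ⟨f, rfl⟩ := mk_surj f
  obtain ⟨g, rfl⟩ := mk_surj g
  obtain ⟨h, rfl⟩ := mk_surj h
  exact Quotient.sound (Eqv.dNat f g h).symm
theorem tc_nat : (f ⩕ g) ≫ tc D E = tc A B ≫ (g ⩕ f) := by
  obtain ⟨f, rfl⟩ := mk_surj f
  obtain ⟨g, rfl⟩ := mk_surj g
  exact Quotient.sound (Eqv.cConjNat f g).symm
theorem pc_nat : (f ⩖ g) ≫ pc D E = pc A B ≫ (g ⩖ f) := by
  obtain ⟨f, rfl⟩ := mk_surj f
  obtain ⟨g, rfl⟩ := mk_surj g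
  exact Quotient.sound (Eqv.cDisjNat f g).symm
theorem ta'_nat : ((f ⩕ g) ⩕ h) ≫ ta' D E F = ta' A B C ≫ (f ⩕ (g ⩕ h)) := by
  have := ta_nat f g h
  calc _ = ta' A B C ≫ (ta A B C ≫ ((f ⩕ g) ⩕ h)) ≫ ta' D E F := by simp
    _ = _ := by rw [← this]; simp
theorem pa'_nat : ((f ⩖ g) ⩖ h) ≫ pa' D E F = pa' A B C ≫ (f ⩖ (g ⩖ h)) := by
  have := pa_nat f g h
  calc _ = pa' A B C ≫ (pa A B C ≫ ((f ⩖ g) ⩖ h)) ≫ pa' D E F := by simp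
    _ = _ := by rw [← this]; simp
theorem de_nat (B : Form P) : de B A ≫ (f ⩕ 𝟙 _) = f ≫ de B D := by
  obtain ⟨f, rfl⟩ := mk_surj f
  exact Quotient.sound (Eqv.deltaNat B f)
theorem si_nat (B : Form P) : si B A ≫ f = (𝟙 _ ⩖ f) ≫ si B D := by
  obtain ⟨f, rfl⟩ := mk_surj f
  exact Quotient.sound (Eqv.sigmaNat B f)
end

section
variable (A B C D : Form P)
theorem ta'_pent : ta' (A ⋏ B) C D ≫ ta' A B (C ⋏ D) =
    (ta' A B C ⩕ 𝟙 D) ≫ ta' A (B ⋏ C) D ≫ (𝟙 A ⩕ ta' B C D) := by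
  have := mk_eq.2 (Eqv.bConjPent A B C D)
  simp only [mk_comp, mk_disj, mk_conj, Category.assoc] at this
  exact this
theorem pa'_pent : pa' (A ⋎ B) C D ≫ pa' A B (C ⋎ D) =
    (pa' A B C ⩖ 𝟙 D) ≫ pa' A (B ⋎ C) D ≫ (𝟙 A ⩖ pa' B C D) := by
  have := mk_eq.2 (Eqv.bDisjPent A B C D)
  simp only [mk_comp, mk_disj, mk_conj, Category.assoc] at this
  exact this
theorem t_hex : (tc B A ⩕ 𝟙 C) ≫ ta' A B C ≫ tc A (B ⋏ C) ≫ ta' B C A ≫ (𝟙 B ⩕ tc C A) =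
    ta' B A C := by
  have := mk_eq.2 (Eqv.bcConj A B C)
  simp only [mk_comp, mk_disj, mk_conj, Category.assoc] at this
  exact this
theorem p_hex : (pc B A ⩖ 𝟙 C) ≫ pa' A B C ≫ pc A (B ⋎ C) ≫ pa' B C A ≫ (𝟙 B ⩖ pc C A) =
    pa' B A C := by
  have := mk_eq.2 (Eqv.bcDisj A B C)
  simp only [mk_comp, mk_disj, mk_conj, Category.assoc] at this
  exact this
theorem dd_t : dd (A ⋏ B) C D ≫ (ta' A B C ⩖ 𝟙 D) =
    ta' A B (C ⋎ D) ≫ (𝟙 A ⩕ dd B C D) ≫ dd A (B ⋏ C) D := by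
  have := mk_eq.2 (Eqv.dConj A B C D)
  simp only [mk_comp, mk_disj, mk_conj, Category.assoc] at this
  exact this
theorem dd_p : (𝟙 D ⩕ pa' C B A) ≫ dd D C (B ⋎ A) =
    dd D (C ⋎ B) A ≫ (dd D C B ⩖ 𝟙 A) ≫ pa' (D ⋏ C) B A := by
  have := mk_eq.2 (Eqv.dDisj D C B A)
  simp only [mk_comp, mk_disj, mk_conj, Category.assoc] at this
  exact this
theorem mk_dR : mk (dR C B A) = dr C B A := by
  unfold dR dr
  simp only [mk_comp, Category.assoc]; rfl
theorem dd_bt : (dd A B C ⩕ 𝟙 D) ≫ dr (A ⋏ B) C D =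
    ta' A (B ⋎ C) D ≫ (𝟙 A ⩕ dr B C D) ≫ dd A B (C ⋏ D) := by
  have := mk_eq.2 (Eqv.dBConj A B C D)
  simp only [mk_comp, mk_conj, mk_dR, Category.assoc] at this
  exact this
theorem dd_bp : dr D C (B ⋎ A) ≫ (𝟙 D ⩖ dd C B A) =
    dd (D ⋎ C) B A ≫ (dr D C B ⩖ 𝟙 A) ≫ pa' D (C ⋏ B) A := by
  have := mk_eq.2 (Eqv.dBDisj D C B A)
  simp only [mk_comp, mk_disj, mk_dR, Category.assoc] at this
  exact this
theorem de_t : de C (A ⋏ B) ≫ ta' A B (∼C ⋎ C) = 𝟙 A ⩕ de C B :=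
  Quotient.sound (Eqv.bDelta A B C)
theorem si_p : pa' (C ⋏ ∼C) B A ≫ si C (B ⋎ A) = si C B ⩖ 𝟙 A :=
  Quotient.sound (Eqv.bSigma C B A)
theorem de_p : de A (B ⋎ C) ≫ tc _ _ ≫ dd (∼A ⋎ A) B C = (de A B ≫ tc _ _) ⩖ 𝟙 C := by
  have := mk_eq.2 (Eqv.dSigmaConj A B C)
  simp only [sigmaConj, mk_comp, mk_disj, Category.assoc] at this
  exact this
theorem si_t : dd C B (A ⋏ ∼A) ≫ pc _ _ ≫ si A (C ⋏ B) = 𝟙 C ⩕ (pc _ _ ≫ si A B) := by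
  have := mk_eq.2 (Eqv.dDeltaDisj A C B)
  simp only [deltaDisj, mk_comp, mk_conj, Category.assoc] at this
  exact this
theorem desi : de A A ≫ dd A (∼A) A ≫ si A A = 𝟙 A := by
  have := mk_eq.2 (Eqv.sigmaDelta A)
  simp only [mk_comp, Category.assoc] at this
  exact this
theorem desi' : de A (∼A) ≫ (𝟙 _ ⩕ pc _ _) ≫ dd (∼A) A (∼A) ≫ (tc _ _ ⩖ 𝟙 _) ≫ si A (∼A) =
    𝟙 _ := by
  have := mk_eq.2 (Eqv.sigmaDelta' A)
  simp only [sigma', delta', mk_comp, mk_conj, mk_disj, Category.assoc] at this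
  exact this
end
end PNC

namespace PNC
open CategoryTheory
variable {P : Type}
set_option linter.unusedSimpArgs false

/-! ## Derived equations -/

def sw (X H G : Form P) : (X ⋎ H) ⋎ G ⟶ (X ⋎ G) ⋎ H := pa' X H G ≫ (𝟙 X ⩖ pc H G) ≫ pa X G H
def sl (B X H : Form P) : B ⋎ (X ⋎ H) ⟶ X ⋎ (B ⋎ H) := pa B X H ≫ (pc B X ⩖ 𝟙 H) ≫ pa' X B H
def dl (A H W : Form P) : (A ⋎ H) ⋏ W ⟶ (A ⋏ W) ⋎ H :=
  tc (A ⋎ H) W ≫ dd W A H ≫ (tc W A ⩖ 𝟙 H)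

theorem sw_sw (X H G : Form P) : sw X H G ≫ sw X G H = 𝟙 _ := by
  simp only [sw, Category.assoc, pa_pa'_a, pm_comp_assoc, pc_pc, Category.comp_id, pm_id,
    Category.id_comp, pa'_pa]
theorem sw_sw_a {Z : Form P} (X H G : Form P) (z : _ ⟶ Z) : sw X H G ≫ sw X G H ≫ z = z := by
  rw [ra (sw_sw ..), Category.id_comp]
theorem sw_nat {X H G X' H' G' : Form P} (f : X ⟶ X') (g : H ⟶ H') (h : G ⟶ G') :
    ((f ⩖ g) ⩖ h) ≫ sw X' H' G' = sw X H G ≫ ((f ⩖ h) ⩖ g) := by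
  simp only [sw, Category.assoc]
  rw [ra (pa'_nat f g h), ← pa_nat, Category.assoc, pm_comp_assoc, pm_comp_assoc, pc_nat]
  simp only [Category.id_comp, Category.comp_id, Category.assoc]
theorem sw_eq (X H G : Form P) : sw X H G = (pc X H ⩖ 𝟙 G) ≫ pa' H X G ≫ pc H (X ⋎ G) := by
  have h := p_hex H X G
  rw [sw, ← h]
  simp only [Category.assoc, pm_comp_assoc, pc_pc, Category.comp_id, pm_id, Category.id_comp,
    pa'_pa]
theorem sl_eq (B X H : Form P) : sl B X H = pc B (X ⋎ H) ≫ pa' X H B ≫ (𝟙 X ⩖ pc H B) := by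
  have h := p_hex B X H
  rw [sl, ← h]
  simp only [Category.assoc, pm_comp_assoc, pc_pc, Category.comp_id, pm_id, Category.id_comp,
    pa_pa'_a]

theorem p_hex1 (A B C : Form P) : pc A (B ⋎ C) =
    pa A B C ≫ (pc A B ⩖ 𝟙 C) ≫ pa' B A C ≫ (𝟙 B ⩖ pc A C) ≫ pa B C A := by
  rw [← p_hex]
  simp only [Category.assoc, pm_comp_assoc, pc_pc, Category.comp_id, pm_id, Category.id_comp,
    pa_pa'_a, pa'_pa]
theorem p_hex2 (A B C : Form P) : pc (B ⋎ C) A =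
    pa' B C A ≫ (𝟙 B ⩖ pc C A) ≫ sl B A C := by
  have h : pc A (B ⋎ C) ≫ pa' B C A ≫ (𝟙 B ⩖ pc C A) ≫ sl B A C = 𝟙 _ := by
    rw [p_hex1, sl]
    simp only [Category.assoc, pm_comp_assoc, pc_pc, Category.comp_id, pm_id, Category.id_comp,
      pa_pa'_a, pa'_pa_a, pa_pa']
  calc _ = pc _ _ ≫ pc A (B ⋎ C) ≫ pa' B C A ≫ (𝟙 B ⩖ pc C A) ≫ sl B A C := by
        rw [h, Category.comp_id]
    _ = _ := by rw [pc_pc_a]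

theorem tc_dl (A H W : Form P) : tc W (A ⋎ H) ≫ dl A H W = dd W A H ≫ (tc W A ⩖ 𝟙 H) := by
  simp only [dl, tc_tc_a]
theorem dl_tc (A H W : Form P) : dl A H W ≫ (tc A W ⩖ 𝟙 H) = tc _ _ ≫ dd W A H := by
  simp only [dl, Category.assoc, pm_comp, tc_tc, Category.comp_id, pm_id]
theorem dl_nat {A H W A' H' W' : Form P} (f : A ⟶ A') (g : H ⟶ H') (h : W ⟶ W') :
    ((f ⩖ g) ⩕ h) ≫ dl A' H' W' = dl A H W ≫ ((f ⩕ h) ⩖ g) := by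
  simp only [dl, Category.assoc]
  rw [ra (tc_nat (f ⩖ g) h), Category.assoc, ra (dd_nat h f g), Category.assoc, pm_comp, pm_comp,
    tc_nat]
  simp only [Category.id_comp, Category.comp_id, Category.assoc]
theorem pc_dr (A H W : Form P) : (pc A H ⩕ 𝟙 W) ≫ dr H A W = dl A H W ≫ pc _ _ := by
  simp only [dr, dl, Category.assoc]
  rw [ra (tc_nat (pc A H) (𝟙 W))]
  simp only [Category.assoc, tm_comp_assoc, pc_pc, Category.comp_id, tm_id, Category.id_comp]

/-- The two ways of tensoring two disjunctions agree. -/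
theorem star (A H B G : Form P) : dl A H (B ⋎ G) ≫ (dd A B G ⩖ 𝟙 H) =
    dd (A ⋎ H) B G ≫ (dl A H B ⩖ 𝟙 G) ≫ sw (A ⋏ B) H G := by
  have h := dd_bp G B A H
  have h2 : (pc A H ⩕ 𝟙 _) ≫ dr H A (B ⋎ G) ≫ (𝟙 H ⩖ dd A B G) ≫ pc _ _ =
      (pc A H ⩕ 𝟙 _) ≫ (dd (H ⋎ A) B G ≫ (dr H A B ⩖ 𝟙 G) ≫ pa' H (A ⋏ B) G) ≫ pc _ _ := by
    rw [← h]; simp only [Category.assoc]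
  rw [ra (pc_dr ..)] at h2
  have h3 : (pc A H ⩕ 𝟙 (B ⋎ G)) ≫ dd (H ⋎ A) B G = dd _ _ _ ≫ ((pc A H ⩕ 𝟙 B) ⩖ 𝟙 G) := by
    rw [← pm_id, dd_nat]
  simp only [Category.assoc] at h2
  rw [ra h3, pc_nat (𝟙 H), pc_pc_a, Category.assoc, pm_comp_assoc, pc_dr] at h2
  rw [h2, sw_eq, ← Category.comp_id (𝟙 G), ← pm_comp]
  simp only [Category.assoc, Category.comp_id]

/-! ## Elements -/

/-- A generalised element of `F`: a natural family behaving like an arrow out of a unit. -/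
@[ext] structure Elem (F : Form P) where
  arr : ∀ Z : Form P, Z ⟶ Z ⋏ F
  nat : ∀ {Z W : Form P} (f : Z ⟶ W), f ≫ arr W = arr Z ≫ (f ⩕ 𝟙 F)
  lawT : ∀ X Y, arr (X ⋏ Y) ≫ ta' X Y F = 𝟙 X ⩕ arr Y
  lawP : ∀ X Y, arr (X ⋎ Y) ≫ dl X Y F = arr X ⩖ 𝟙 Y

namespace Elem
variable {F G : Form P}

def map (e : Elem F) (g : F ⟶ G) : Elem G where
  arr Z := e.arr Z ≫ (𝟙 Z ⩕ g)
  nat f := by rw [ra (e.nat f)]; simp only [Category.assoc, tm_comp, Category.id_comp, Category.comp_id]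
  lawT X Y := by
    rw [Category.assoc, ← tm_id, ta'_nat, ra (e.lawT X Y), tm_comp, Category.comp_id]
  lawP X Y := by
    rw [Category.assoc, ← pm_id, dl_nat, ra (e.lawP X Y), pm_comp, Category.comp_id]

theorem map_arr (e : Elem F) (g : F ⟶ G) (Z : Form P) : (e.map g).arr Z = e.arr Z ≫ (𝟙 Z ⩕ g) := rfl
@[simp] theorem map_id (e : Elem F) : e.map (𝟙 F) = e := by
  ext Z; simp [map_arr]
@[simp] theorem map_map {H : Form P} (e : Elem F) (g : F ⟶ G) (h : G ⟶ H) :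
    (e.map g).map h = e.map (g ≫ h) := by
  ext Z; simp [map_arr, tm_comp]

theorem b2 (e : Elem F) (X Y : Form P) :
    (e.arr X ⩕ 𝟙 Y) ≫ ta' X F Y ≫ (𝟙 X ⩕ tc F Y) = 𝟙 X ⩕ e.arr Y := by
  rw [← e.lawT, ← t_hex Y X F]
  have h1 : e.arr X ⩕ 𝟙 Y = tc X Y ≫ (𝟙 Y ⩕ e.arr X) ≫ tc _ _ := by
    rw [tc_nat]; simp
  rw [h1, ← e.lawT]
  simp only [Category.assoc]
  rw [ra (e.nat _), Category.assoc]

def and (e : Elem F) (f : Elem G) : Elem (F ⋏ G) := e.map (f.arr F)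

theorem and_comm (e : Elem F) (f : Elem G) : (e.and f).map (tc F G) = f.and e := by
  ext Z
  have h1 : e.arr Z ≫ (𝟙 Z ⩕ f.arr F) = f.arr Z ≫ (e.arr Z ⩕ 𝟙 G) ≫ ta' _ _ _ := by
    rw [← f.lawT, ra (f.nat _), Category.assoc]
  simp only [and, map_arr]
  rw [h1]
  simp only [Category.assoc]
  rw [e.b2]
end Elem

/-- Coelements, dual to elements. -/
@[ext] structure Coelem (X : Form P) where
  arr : ∀ H : Form P, X ⋎ H ⟶ H
  nat : ∀ {H K : Form P} (f : H ⟶ K), (𝟙 X ⩖ f) ≫ arr K = arr H ≫ f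
  lawP : ∀ H K, pa' X H K ≫ arr (H ⋎ K) = arr H ⩖ 𝟙 K
  lawT : ∀ C B, dd C B X ≫ pc _ _ ≫ arr (C ⋏ B) = 𝟙 C ⩕ (pc _ _ ≫ arr B)

namespace Coelem
variable {X Y : Form P}
def comap (k : Coelem X) (g : Y ⟶ X) : Coelem Y where
  arr H := (g ⩖ 𝟙 H) ≫ k.arr H
  nat f := by
    rw [pm_comp_assoc, Category.assoc, ← k.nat, pm_comp_assoc]; simp
  lawP H K := by
    rw [← pm_id, ra (pa'_nat _ _ _).symm, Category.assoc, k.lawP, pm_comp, Category.comp_id]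
  lawT C B := by
    rw [ra (pc_nat _ _).symm, Category.assoc, ← tm_id, ra (dd_nat _ _ _).symm, Category.assoc, k.lawT,
      tm_comp, ra (pc_nat _ _), Category.assoc, Category.id_comp]
theorem comap_arr (k : Coelem X) (g : Y ⟶ X) (H : Form P) :
    (k.comap g).arr H = (g ⩖ 𝟙 H) ≫ k.arr H := rfl
@[simp] theorem comap_comap {Z : Form P} (k : Coelem X) (g : Y ⟶ X) (h : Z ⟶ Y) :
    (k.comap g).comap h = k.comap (h ≫ g) := by
  ext H; simp [comap_arr, pm_comp_assoc]
@[simp] theorem comap_id (k : Coelem X) : k.comap (𝟙 X) = k := by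
  ext H; simp [comap_arr]

theorem left (k : Coelem X) (B H : Form P) : 𝟙 B ⩖ k.arr H = sl B X H ≫ k.arr (B ⋎ H) := by
  rw [sl_eq]
  simp only [Category.assoc]
  rw [k.nat, ra (k.lawP _ _), pc_nat, pc_pc_a]

theorem strength (k : Coelem X) (W A : Form P) : dr X W A ≫ k.arr (W ⋏ A) = k.arr W ⩕ 𝟙 A := by
  simp only [dr, Category.assoc]
  rw [ra (pc_nat _ _), Category.assoc, k.nat, ra3 (k.lawT _ _), tm_comp_assoc, tc_nat]
  simp
end Coelem

/-! ## Duals -/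

structure Dual (A A' : Form P) where
  η : Elem (A' ⋎ A)
  ε : Coelem (A ⋏ A')
  z1 : η.arr A ≫ dd A A' A ≫ ε.arr A = 𝟙 A
  z2 : η.arr A' ≫ (𝟙 A' ⩕ pc _ _) ≫ dd A' A A' ≫ (tc _ _ ⩖ 𝟙 _) ≫ ε.arr A' = 𝟙 A'

/-- The basic element given by the crown. -/
def deE (B : Form P) : Elem (∼B ⋎ B) where
  arr Z := de B Z
  nat f := (de_nat f B).symm
  lawT X Y := de_t X Y B
  lawP X Y := by
    rw [dl]
    simp only [← Category.assoc]
    rw [Category.assoc (de B _), de_p, pm_comp]; simp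

def siE (B : Form P) : Coelem (B ⋏ ∼B) where
  arr Z := si B Z
  nat f := (si_nat f B).symm
  lawP H K := si_p _ _ _
  lawT C D := si_t _ _ _

def bd (B : Form P) : Dual B (∼B) where
  η := deE B
  ε := siE B
  z1 := desi B
  z2 := desi' B

namespace Dual
variable {A A' B B' : Form P}

def sym (D : Dual A A') : Dual A' A where
  η := D.η.map (pc _ _)
  ε := D.ε.comap (tc _ _)
  z1 := by
    rw [Elem.map_arr, Coelem.comap_arr, Category.assoc]; exact D.z2
  z2 := by
    rw [Elem.map_arr, Coelem.comap_arr, Category.assoc, tm_comp_assoc, pm_comp_assoc]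
    simpa using D.z1

def n (D : Dual A A') (W : Form P) : A ⋏ (A' ⋎ W) ⟶ W := dd A A' W ≫ D.ε.arr W

theorem n_nat (D : Dual A A') {W V : Form P} (f : W ⟶ V) :
    (𝟙 A ⩕ (𝟙 A' ⩖ f)) ≫ D.n V = D.n W ≫ f := by
  rw [n, ra (dd_nat _ _ _), tm_id, Category.assoc, D.ε.nat, n, Category.assoc]
theorem n_T (D : Dual A A') (W C : Form P) :
    D.n W ⩕ 𝟙 C = ta' A (A' ⋎ W) C ≫ (𝟙 A ⩕ dr A' W C) ≫ D.n (W ⋏ C) := by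
  rw [n, n, ra3 (dd_bt A A' W C).symm, Category.assoc, D.ε.strength, tm_comp, Category.comp_id]
theorem n_P (D : Dual A A') (W V : Form P) :
    dd A (A' ⋎ W) V ≫ (D.n W ⩖ 𝟙 V) = (𝟙 A ⩕ pa' A' W V) ≫ D.n (W ⋎ V) := by
  rw [n, n, ra (dd_p ..)]
  simp only [Category.assoc]
  rw [D.ε.lawP, pm_comp, Category.comp_id]

def q (A : Form P) (D : Dual B B') : A ⟶ B' ⋎ (A ⋏ B) :=
  D.η.arr A ≫ (𝟙 A ⩕ pc B' B) ≫ dd A B B' ≫ pc _ _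
def m (D : Dual A A') (B B' : Form P) : (A ⋏ B) ⋏ (A' ⋎ B') ⟶ B ⋏ B' :=
  (tc _ _ ⩕ 𝟙 _) ≫ ta' B A (A' ⋎ B') ≫ (𝟙 B ⩕ D.n B')

theorem q_n (D : Dual B B') : tc A B ≫ (𝟙 B ⩕ q A D) ≫ D.n (A ⋏ B) = 𝟙 _ := by
  have h1 : q A D = D.η.arr A ≫ tc _ _ ≫ dr B' B A ≫ (𝟙 _ ⩖ tc _ _) := by
    simp only [q, dr, Category.assoc, tc_tc_a]
    rw [← pc_nat, pm_comp_assoc]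
    simp
  have h2 : 𝟙 B ⩕ q A D = ((𝟙 B ⩕ (D.η.arr A ≫ tc _ _)) ≫ (𝟙 B ⩕ dr B' B A)) ≫
      (𝟙 B ⩕ (𝟙 _ ⩖ tc _ _)) := by
    rw [h1, tm_comp, tm_comp]; simp
  have h3 : 𝟙 B ⩕ D.η.arr A ≫ tc _ _ = (D.η.arr B ⩕ 𝟙 A) ≫ ta' _ _ _ := by
    rw [← Category.id_comp (𝟙 B), ← tm_comp, ← D.η.b2]
    simp only [Category.assoc, tm_comp, tc_tc, Category.comp_id, Category.id_comp, tm_id]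
  rw [h2, Category.assoc, n_nat, h3]
  simp only [Category.assoc]
  rw [ra3 (n_T D B A).symm, tm_comp_assoc, n, D.z1]
  simp

theorem N1 (D : Dual A A') (B B' W : Form P) : dd (A ⋏ B) (A' ⋎ B') W ≫ (D.m B B' ⩖ 𝟙 W) =
    (tc _ _ ⩕ pa' _ _ _) ≫ ta' B A (A' ⋎ (B' ⋎ W)) ≫ (𝟙 B ⩕ D.n (B' ⋎ W)) ≫ dd B B' W := by
  have h1 : D.m B B' ⩖ 𝟙 W =
      ((tc _ _ ⩕ 𝟙 _) ⩖ 𝟙 W) ≫ (ta' B A (A' ⋎ B') ⩖ 𝟙 W) ≫ ((𝟙 B ⩕ D.n B') ⩖ 𝟙 W) := by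
    rw [pm_comp, pm_comp, m]; simp
  rw [h1, ra (dd_nat _ _ _).symm, Category.assoc, ra (dd_t ..)]
  simp only [Category.assoc]
  rw [← dd_nat, tm_comp_assoc, n_P]
  have h2 : 𝟙 B ≫ 𝟙 B ⩕ (𝟙 A ⩕ pa' A' B' W) ≫ D.n (B' ⋎ W) =
      (𝟙 B ⩕ (𝟙 A ⩕ pa' A' B' W)) ≫ (𝟙 B ⩕ D.n (B' ⋎ W)) := by rw [tm_comp]
  rw [h2, Category.assoc, ra (ta'_nat _ _ _).symm, Category.assoc, tm_comp_assoc]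
  simp

theorem tc_m (D : Dual A A') (B B' : Form P) : tc _ _ ≫ D.m B B' =
    ta _ _ _ ≫ ((tc _ _ ≫ D.n B') ⩕ 𝟙 B) ≫ tc _ _ := by
  have h := t_hex B A (A' ⋎ B')
  have h2 : tc (A' ⋎ B') (A ⋏ B) ≫ (tc A B ⩕ 𝟙 _) ≫ ta' B A (A' ⋎ B') =
     ta _ _ _ ≫ (tc _ _ ⩕ 𝟙 B) ≫ tc _ _ := by
    have h4 := t_hex (A' ⋎ B') A B
    have h5 : tc (A' ⋎ B') (A ⋏ B) = ta _ _ _ ≫ (tc _ _ ⩕ 𝟙 _) ≫ ta' A (A' ⋎ B') B ≫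
        (𝟙 _ ⩕ tc _ _) ≫ ta _ _ _ := by
      rw [← h4]
      simp only [Category.assoc, tm_comp_assoc, tc_tc, Category.comp_id, tm_id, Category.id_comp,
        ta_ta'_a, ta'_ta]
    have h6 : ta' A (A' ⋎ B') B ≫ (𝟙 _ ⩕ tc _ _) ≫ ta _ _ _ ≫ (tc A B ⩕ 𝟙 _) ≫ ta' _ _ _ = tc _ _ := by
      have h7 : tc B (A ⋏ (A' ⋎ B')) ≫ ta' A (A' ⋎ B') B ≫ (𝟙 _ ⩕ tc _ _) ≫ ta _ _ _ ≫ (tc A B ⩕ 𝟙 _) ≫ ta' _ _ _ = 𝟙 _ := by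
        have : ta A B (A' ⋎ B') = ta A B (A' ⋎ B') := rfl
        have h8 : tc B (A ⋏ (A' ⋎ B')) ≫ ta' A (A' ⋎ B') B ≫ (𝟙 _ ⩕ tc _ _) =
            ta _ _ _ ≫ (tc _ _ ⩕ 𝟙 _) ≫ ta' A B (A' ⋎ B') := by
          rw [← h]; simp only [tm_comp_assoc, tc_tc, Category.comp_id, tm_id, Category.id_comp,
            ta_ta'_a]
        rw [ra3 h8]
        simp only [Category.assoc, ta'_ta_a, tm_comp_assoc, tc_tc, Category.comp_id, tm_id, Category.id_comp,
            ta_ta']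
      calc _ = tc _ _ ≫ tc B (A ⋏ (A' ⋎ B')) ≫ ta' A (A' ⋎ B') B ≫ (𝟙 _ ⩕ tc _ _) ≫ ta _ _ _ ≫
            (tc A B ⩕ 𝟙 _) ≫ ta' _ _ _ := by rw [tc_tc_a]
        _ = _ := by rw [h7, Category.comp_id]
    rw [h5]
    simp only [Category.assoc]
    rw [h6]
  rw [m, ra3 h2]
  simp only [Category.assoc]
  rw [← tc_nat, tm_comp_assoc, Category.comp_id]

theorem and_z1 (D : Dual A A') (E : Dual B B') :
    (D.η.map ((𝟙 A' ⩖ q A E) ≫ pa A' B' (A ⋏ B))).arr (A ⋏ B) ≫ dd (A ⋏ B) (A' ⋎ B') (A ⋏ B) ≫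
      (E.ε.comap (D.m B B')).arr (A ⋏ B) = 𝟙 _ := by
  rw [Elem.map_arr, Coelem.comap_arr, ra (N1 ..)]
  simp only [Category.assoc]
  rw [tm_comp_assoc]
  simp only [Category.assoc, pa_pa', Category.comp_id, Category.id_comp]
  have h1 : tc A B ⩕ (𝟙 A' ⩖ q A E) = (tc A B ⩕ 𝟙 _) ≫ ((𝟙 B ⩕ 𝟙 A) ⩕ (𝟙 A' ⩖ q A E)) := by
    rw [tm_comp]; simp
  rw [h1, Category.assoc, ra (D.η.nat _).symm, ra (ta'_nat _ _ _)]
  simp only [Category.assoc]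
  rw [ra (D.η.lawT _ _), tm_comp_assoc, tm_comp_assoc, Category.assoc (D.η.arr A), n_nat, n]
  simp only [Category.assoc]
  rw [ra3 D.z1]
  have := q_n (A := A) E
  rw [n] at this
  simpa using this

theorem and_Z (D : Dual A A') (B' : Form P) :
    (D.η.map (pc _ _)).arr (A' ⋎ B') ≫ dd (A' ⋎ B') A A' ≫ ((tc _ _ ≫ D.n B') ⩖ 𝟙 A') ≫ pc _ _ =
      𝟙 _ := by
  have h1 : tc _ _ ≫ D.n B' = dl A' B' A ≫ (tc _ _ ⩖ 𝟙 _) ≫ D.ε.arr B' := by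
    rw [n, ra (dl_tc ..), Category.assoc]
  have h2 : (tc _ _ ≫ D.n B') ⩖ 𝟙 A' = (dl A' B' A ⩖ 𝟙 _) ≫ (((tc _ _ ⩖ 𝟙 _) ≫ D.ε.arr B') ⩖ 𝟙 _) := by
    rw [pm_comp, h1]; simp
  have h3 : dd (A' ⋎ B') A A' ≫ (dl A' B' A ⩖ 𝟙 _) =
      dl A' B' (A ⋎ A') ≫ (dd A' A A' ⩖ 𝟙 B') ≫ sw _ _ _ := by
    rw [← Category.assoc, star]; simp only [Category.assoc, sw_sw, Category.comp_id]
  rw [h2, Category.assoc, ra h3]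
  simp only [Category.assoc]
  rw [ra ((D.η.map (pc _ _)).lawP _ _), pm_comp_assoc]
  have h4 : ((tc A' A ⩖ 𝟙 B') ≫ D.ε.arr B' ⩖ 𝟙 A') =
      ((tc A' A ⩖ 𝟙 B') ⩖ 𝟙 A') ≫ (D.ε.arr B' ⩖ 𝟙 A') := by
    rw [pm_comp]; simp
  rw [h4, Category.assoc, ra (sw_nat _ _ _).symm, Category.assoc, pm_comp_assoc]
  have h5 : sw (A ⋏ A') A' B' ≫ (D.ε.arr B' ⩖ 𝟙 A') ≫ pc _ _ = D.ε.arr A' ⩖ 𝟙 B' := by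
    rw [← D.ε.lawP, Category.assoc, ← D.ε.nat, sw]
    simp only [Category.assoc, pa_pa'_a, pm_comp_assoc, pc_pc, Category.comp_id, pm_id,
      Category.id_comp]
    exact D.ε.lawP _ _
  rw [h5, pm_comp]
  have := D.z2
  simp only [Elem.map_arr, Category.assoc, Category.comp_id] at this ⊢
  rw [this, pm_id]

theorem and_z2 (D : Dual A A') (E : Dual B B') :
    (D.η.map ((𝟙 A' ⩖ q A E) ≫ pa A' B' (A ⋏ B))).arr (A' ⋎ B') ≫ (𝟙 _ ⩕ pc _ _) ≫
      dd (A' ⋎ B') (A ⋏ B) (A' ⋎ B') ≫ (tc _ _ ⩖ 𝟙 _) ≫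
      (E.ε.comap (D.m B B')).arr (A' ⋎ B') = 𝟙 _ := by
  have h0 : (𝟙 A' ⩖ q A E) ≫ pa A' B' (A ⋏ B) ≫ pc _ _ =
     pc _ _ ≫ (((E.η.map (pc _ _)).arr A ≫ dd A B B') ⩖ 𝟙 A') ≫ pa' _ _ _ ≫ (𝟙 _ ⩖ pc _ _) := by
    rw [ra (pc_nat _ _).symm, Category.assoc, ← sl_eq, p_hex2, q]
    simp only [Elem.map_arr, Category.assoc, pa_pa'_a, pm_comp_assoc, pc_pc, Category.comp_id]
  have h1 : (𝟙 (A' ⋎ B') ⩕ ((E.η.map (pc _ _)).arr A ≫ dd A B B')) ≫ dd (A' ⋎ B') (A ⋏ B) B' =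
      (E.η.map (pc _ _)).arr ((A' ⋎ B') ⋏ A) ≫ dd ((A' ⋎ B') ⋏ A) B B' ≫ (ta' (A' ⋎ B') A B ⩖ 𝟙 _) := by
    rw [dd_t, ra ((E.η.map (pc _ _)).lawT _ _), tm_comp_assoc, Category.comp_id]
  have h2 : (𝟙 (A' ⋎ B') ⩕ (((E.η.map (pc _ _)).arr A ≫ dd A B B') ⩖ 𝟙 A')) ≫ (𝟙 (A' ⋎ B') ⩕ pa' _ _ _) ≫
      (𝟙 (A' ⋎ B') ⩕ (𝟙 _ ⩖ pc B' A')) ≫ dd (A' ⋎ B') (A ⋏ B) (A' ⋎ B') =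
      dd (A' ⋎ B') A A' ≫ (((E.η.map (pc _ _)).arr ((A' ⋎ B') ⋏ A) ≫ dd ((A' ⋎ B') ⋏ A) B B' ≫ (ta' (A' ⋎ B') A B ⩖ 𝟙 _)) ⩖ 𝟙 A')
        ≫ pa' _ _ _ ≫ (𝟙 _ ⩖ pc _ _) := by
    rw [dd_nat, ra (dd_p ..)]
    simp only [Category.assoc]
    rw [ra (dd_nat _ _ _)]
    simp only [Category.assoc]
    rw [pm_comp_assoc, h1, Category.comp_id, tm_id]
  have h3 : (E.η.map (pc _ _)).arr ((A' ⋎ B') ⋏ A) ≫ dd ((A' ⋎ B') ⋏ A) B B' ≫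
      (((tc _ _ ≫ D.n B') ⩕ 𝟙 B) ⩖ 𝟙 _) ≫ (tc _ _ ⩖ 𝟙 _) =
      (tc _ _ ≫ D.n B') ≫ (E.η.map (pc _ _)).arr B' ≫ dd B' B B' ≫ (tc _ _ ⩖ 𝟙 _) := by
    rw [ra (dd_nat _ _ _).symm, pm_id, Category.assoc, ra (Elem.nat _ _).symm, Category.assoc]
  have h4 : (E.η.map (pc _ _)).arr B' ≫ dd B' B B' ≫ (tc _ _ ⩖ 𝟙 _) ≫ E.ε.arr B' = 𝟙 _ := by
    have := E.z2
    simpa only [Elem.map_arr, Category.assoc] using this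
  have h5 : D.η.arr (A' ⋎ B') ≫ (𝟙 (A' ⋎ B') ⩕ ((𝟙 A' ⩖ q A E) ≫ pa A' B' (A ⋏ B) ≫ pc _ _)) =
      (D.η.map (pc _ _)).arr (A' ⋎ B') ≫ (𝟙 (A' ⋎ B') ⩕ (((E.η.map (pc _ _)).arr A ≫ dd A B B') ⩖ 𝟙 A')) ≫
      (𝟙 (A' ⋎ B') ⩕ pa' _ _ _) ≫ (𝟙 (A' ⋎ B') ⩕ (𝟙 _ ⩖ pc B' A')) := by
    rw [h0]
    simp only [Elem.map_arr, Category.assoc, tm_comp, Category.id_comp]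
  rw [Elem.map_arr, Coelem.comap_arr, Category.assoc, tm_comp_assoc, Category.assoc,
    Category.comp_id, ra h5]
  simp only [Category.assoc]
  have h6 : (tc (A' ⋎ B') (A ⋏ B) ⩖ 𝟙 (A' ⋎ B')) ≫ (D.m B B' ⩖ 𝟙 (A' ⋎ B')) ≫ E.ε.arr (A' ⋎ B') =
    (ta _ _ _ ⩖ 𝟙 (A' ⋎ B')) ≫ (((tc _ _ ≫ D.n B') ⩕ 𝟙 B) ⩖ 𝟙 (A' ⋎ B')) ≫ (tc _ _ ⩖ 𝟙 (A' ⋎ B')) ≫ E.ε.arr (A' ⋎ B') := by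
    rw [pm_comp_assoc, tc_m]
    simp only [pm_comp_assoc, Category.comp_id]
  rw [h6]
  have h7 : ∀ {Z : Form P} (z : _ ⟶ Z), (𝟙 (A' ⋎ B') ⩕ (((E.η.map (pc _ _)).arr A ≫ dd A B B') ⩖ 𝟙 A')) ≫
      (𝟙 (A' ⋎ B') ⩕ pa' _ _ _) ≫
      (𝟙 (A' ⋎ B') ⩕ (𝟙 _ ⩖ pc B' A')) ≫ dd (A' ⋎ B') (A ⋏ B) (A' ⋎ B') ≫ z = _ := fun z => by
    simpa only [Category.assoc] using congrArg (· ≫ z) h2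
  rw [h7]
  have h8 : pa' (((A' ⋎ B') ⋏ (A ⋏ B))) B' A' ≫ (𝟙 _ ⩖ pc B' A') ≫
      (ta _ _ _ ⩖ 𝟙 (A' ⋎ B')) ≫ (((tc _ _ ≫ D.n B') ⩕ 𝟙 B) ⩖ 𝟙 (A' ⋎ B')) ≫ (tc _ _ ⩖ 𝟙 (A' ⋎ B')) ≫ E.ε.arr (A' ⋎ B') =
     ((((ta _ _ _) ≫ ((tc _ _ ≫ D.n B') ⩕ 𝟙 B) ≫ tc _ _) ⩖ 𝟙 _) ⩖ 𝟙 _) ≫ (E.ε.arr B' ⩖ 𝟙 A') ≫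
        pc _ _ := by
    rw [← E.ε.lawP, Category.assoc, ← E.ε.nat, ra (pa'_nat _ _ _)]
    simp only [Category.assoc, pm_comp_assoc, Category.id_comp, Category.comp_id, pm_id]
  rw [h8]
  simp only [Category.assoc, pm_comp_assoc, pm_comp, ta'_ta_a, Category.comp_id]
  have h9 : (E.η.map (pc B' B)).arr ((A' ⋎ B') ⋏ A) ≫ dd ((A' ⋎ B') ⋏ A) B B' ≫
      ((tc (A' ⋎ B') A ≫ D.n B' ⩕ 𝟙 B) ≫ tc B' B ⩖ 𝟙 B') ≫ E.ε.arr B' = tc _ _ ≫ D.n B' := by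
    have := congrArg (· ≫ E.ε.arr B') h3
    simp only [Category.assoc] at this
    rw [h4, pm_comp_assoc] at this
    simpa only [Category.comp_id, Category.assoc] using this
  rw [h9]
  have := D.and_Z B'
  simpa only [Elem.map_arr, Category.assoc] using this

def and (D : Dual A A') (E : Dual B B') : Dual (A ⋏ B) (A' ⋎ B') where
  η := D.η.map ((𝟙 A' ⩖ q A E) ≫ pa A' B' (A ⋏ B))
  ε := E.ε.comap (D.m B B')
  z1 := and_z1 D E
  z2 := and_z2 D E
end Dual
end PNC

namespace PNC
open CategoryTheory
variable {P : Type}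
set_option linter.unusedSimpArgs false

namespace Dual
variable {A A' C C' : Form P}

theorem q_eq (D : Dual A A') (F : Form P) :
    q F D = D.η.arr F ≫ tc _ _ ≫ dr A' A F ≫ (𝟙 _ ⩖ tc _ _) := by
  simp only [q, dr, Category.assoc, tc_tc_a]
  rw [← pc_nat, pm_comp_assoc]
  simp

theorem claim (D : Dual A A') (H : Form P) :
    D.η.arr (A' ⋎ H) ≫ tc _ _ ≫ dr A' A (A' ⋎ H) ≫ (𝟙 A' ⩖ D.n H) = 𝟙 _ := by
  have h := D.and_Z H
  simp only [Elem.map_arr, Category.assoc, dr, tc_tc_a] at h ⊢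
  rw [← pc_nat, pm_comp_assoc, Category.comp_id]
  exact h

theorem left_arr {F : Form P} (e : Elem F) (A' A : Form P) :
    𝟙 A' ⩖ e.arr A = e.arr (A' ⋎ A) ≫ dr A' A F := by
  have h1 : dr A' A F = (pc _ _ ⩕ 𝟙 _) ≫ dl A A' F ≫ pc _ _ := by
    rw [← pc_dr, tm_comp_assoc]; simp
  rw [h1, ra (e.nat _).symm, Category.assoc, ra (e.lawP _ _), pc_nat, pc_pc_a]

/-- Every element of `A' ∨ H` is obtained from the unit by an arrow. -/
theorem recov (D : Dual A A') {H : Form P} (e : Elem (A' ⋎ H)) :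
    D.η.map (𝟙 A' ⩖ (e.arr A ≫ D.n H)) = e := by
  have h1 : 𝟙 A' ⩖ (e.arr A ≫ D.n H) = e.arr (A' ⋎ A) ≫ dr A' A (A' ⋎ H) ≫ (𝟙 A' ⩖ D.n H) := by
    rw [← Category.assoc, ← left_arr, pm_comp, Category.id_comp]
  have h2 : D.η.map (e.arr (A' ⋎ A)) = (e.map (D.η.arr (A' ⋎ H))).map (tc _ _) := by
    have := e.and_comm D.η
    exact this.symm
  rw [h1, ← Elem.map_map, h2, Elem.map_map, Elem.map_map, D.claim, Elem.map_id]

theorem n_map (D : Dual A A') {H : Form P} (f : A ⟶ H) :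
    (D.η.map (𝟙 A' ⩖ f)).arr A ≫ D.n H = f := by
  rw [Elem.map_arr, Category.assoc, D.n_nat, n]
  have := ra3 D.z1 f
  simpa using this

theorem η_inj (D : Dual A A') {H : Form P} {f g : A ⟶ H}
    (h : D.η.map (𝟙 A' ⩖ f) = D.η.map (𝟙 A' ⩖ g)) : f = g := by
  rw [← D.n_map f, h, D.n_map]

theorem _root_.PNC.Coelem.mid {X : Form P} (k : Coelem X) (Y H : Form P) :
    pa' Y X H ≫ (𝟙 Y ⩖ k.arr H) = (pc _ _ ≫ k.arr Y) ⩖ 𝟙 H := by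
  rw [k.left, sl]
  simp only [Category.assoc, pa'_pa_a]
  rw [k.lawP, pm_comp, Category.comp_id]

theorem eps_unique (D E : Dual A A') (h : D.η = E.η) : D.ε = E.ε := by
  ext H
  have z1 := D.z1
  have e1 : E.ε.arr H = (((D.η.arr A ≫ dd A A' A ≫ D.ε.arr A) ⩕ 𝟙 A') ⩖ 𝟙 H) ≫ E.ε.arr H := by
    rw [z1]; simp
  have e2 : (D.η.arr A ≫ dd A A' A ≫ D.ε.arr A) ⩕ 𝟙 A' =
      (D.η.arr A ⩕ 𝟙 A') ≫ ta' _ _ _ ≫ (𝟙 A ⩕ dr A' A A') ≫ dd _ _ _ ≫ D.ε.arr _ := by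
    have := D.n_T A A'
    simp only [n] at this
    rw [← this, tm_comp, Category.comp_id]
  have e3 : (D.ε.arr (A ⋏ A') ⩖ 𝟙 H) ≫ E.ε.arr H = pa' _ _ _ ≫ (𝟙 _ ⩖ E.ε.arr H) ≫ D.ε.arr H := by
    rw [← D.ε.lawP, Category.assoc, ← D.ε.nat]
  have e4 : (dd A A' (A ⋏ A') ⩖ 𝟙 H) ≫ pa' _ _ _ ≫ (𝟙 _ ⩖ E.ε.arr H) =
      (𝟙 A ⩕ (pc _ _ ≫ E.ε.arr A')) ⩖ 𝟙 H := by
    rw [Coelem.mid, pm_comp, E.ε.lawT, Category.comp_id]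
  have e5 : (D.η.arr A ⩕ 𝟙 A') ≫ ta' _ _ _ = 𝟙 A ⩕ (D.η.arr A' ≫ tc _ _) := by
    rw [← Category.id_comp (𝟙 A), ← tm_comp, ← D.η.b2]
    simp only [Category.assoc, tm_comp, tc_tc, Category.comp_id, Category.id_comp, tm_id]
  have e6 : D.η.arr A' ≫ tc _ _ ≫ dr A' A A' ≫ pc _ _ ≫ E.ε.arr A' = 𝟙 _ := by
    rw [h]
    simp only [dr, Category.assoc, tc_tc_a, pc_pc_a]
    exact E.z2
  rw [e1, e2]
  have e7 : ∀ {W X Y Z : Form P} (a : W ⟶ X) (b : X ⟶ Y) (c : Y ⟶ Z),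
      (a ≫ b ≫ c) ⩖ 𝟙 H = ((a ≫ b) ⩖ 𝟙 H) ≫ (c ⩖ 𝟙 H) := by
    intros; rw [pm_comp]; simp
  rw [ra e5]
  have e8 : ∀ {W X Y Z : Form P} (a : W ⟶ X) (b : X ⟶ Y) (c : Y ⟶ Z),
      (a ≫ b ≫ c) ⩖ 𝟙 H = (a ⩖ 𝟙 H) ≫ (b ⩖ 𝟙 H) ≫ (c ⩖ 𝟙 H) := by
    intros; rw [pm_comp, pm_comp]; simp
  rw [tm_comp_assoc, e8]
  simp only [Category.assoc]
  rw [e3, ra3 e4, pm_comp_assoc, tm_comp]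
  simp only [Category.assoc]
  rw [e6]
  simp

/-- Transport a dual along isomorphisms. -/
def transport (D : Dual A A') (i : A ≅ C) (j : A' ≅ C') : Dual C C' where
  η := D.η.map (j.hom ⩖ i.hom)
  ε := D.ε.comap (i.inv ⩕ j.inv)
  z1 := by
    rw [Elem.map_arr, Coelem.comap_arr, ra (dd_nat _ _ _).symm]
    simp only [Category.assoc, tm_comp_assoc, pm_comp]
    have h : D.η.arr C = i.inv ≫ D.η.arr A ≫ (i.hom ⩕ 𝟙 _) := by
      rw [← D.η.nat]; simp
    rw [h]
    simp only [Category.assoc, tm_comp_assoc, Category.id_comp, Category.comp_id, i.hom_inv_id,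
      j.hom_inv_id]
    rw [ra (dd_nat _ _ _), Category.assoc, tm_id, D.ε.nat, ra3 D.z1]
    simp
  z2 := by
    rw [Elem.map_arr, Coelem.comap_arr]
    have h : D.η.arr C' = j.inv ≫ D.η.arr A' ≫ (j.hom ⩕ 𝟙 _) := by
      rw [← D.η.nat]; simp
    rw [pm_comp_assoc, ← tc_nat]
    have h2 : (j.inv ⩕ i.inv) ≫ tc A' A ⩖ 𝟙 C' ≫ 𝟙 C' = ((j.inv ⩕ i.inv) ⩖ 𝟙 C') ≫ (tc A' A ⩖ 𝟙 C') := by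
      rw [pm_comp]
    rw [h2]
    simp only [Category.assoc]
    rw [ra (dd_nat _ _ _).symm, Category.assoc, tm_comp_assoc, tm_comp_assoc, pc_nat]
    rw [h]
    simp only [Category.assoc, tm_comp_assoc, Category.id_comp, Category.comp_id, i.hom_inv_id,
      j.hom_inv_id, pm_comp]
    have h3 : 𝟙 A' ⩕ pc A' A ≫ (𝟙 A ⩖ j.hom) = (𝟙 A' ⩕ pc A' A) ≫ (𝟙 A' ⩕ (𝟙 A ⩖ j.hom)) := by
      rw [tm_comp, Category.id_comp]
    rw [h3, Category.assoc, ra (dd_nat _ _ _), Category.assoc, pm_comp_assoc]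
    have h4 : (𝟙 A' ⩕ 𝟙 A) ≫ tc A' A ⩖ j.hom ≫ 𝟙 C' = (tc A' A ⩖ 𝟙 _) ≫ (𝟙 _ ⩖ j.hom) := by
      rw [pm_comp]; simp
    rw [h4, Category.assoc, D.ε.nat]
    have h5 := congrArg (· ≫ j.hom) D.z2
    simp only [Category.assoc] at h5
    rw [h5]
    simp

theorem iso_exists (D : Dual A A') (E : Dual C C') (i : A ≅ C) :
    ∃ j : A' ≅ C', D.η.map (j.hom ⩖ i.hom) = E.η ∧ E.ε.comap (i.hom ⩕ j.hom) = D.ε := by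
  have key : ∀ {A A' C C' : Form P} (D : Dual A A') (E : Dual C C') (i : A ≅ C),
      ∃ j : A' ⟶ C', D.η.map (j ⩖ i.hom) = E.η := by
    intro A A' C C' D E i
    refine ⟨(E.η.map ((𝟙 C' ⩖ i.inv) ≫ pc _ _)).arr A' ≫ D.sym.n C', ?_⟩
    have := D.sym.recov (E.η.map ((𝟙 C' ⩖ i.inv) ≫ pc _ _))
    have h2 := congrArg (fun e => Elem.map e (pc _ _ ≫ (𝟙 _ ⩖ i.hom))) this
    generalize (E.η.map ((𝟙 C' ⩖ i.inv) ≫ pc _ _)).arr A' ≫ D.sym.n C' = j at h2 ⊢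
    simp only [sym, Elem.map_map, Category.assoc, pc_pc_a, pm_comp, i.inv_hom_id,
      Category.comp_id, pm_id, Elem.map_id] at h2
    rw [ra (pc_nat _ _), Category.assoc, pc_pc_a, pm_comp] at h2
    simpa using h2
  have inj : ∀ {A A' : Form P} (D : Dual A A') (f : A' ⟶ A'), D.η.map (f ⩖ 𝟙 _) = D.η → f = 𝟙 _ := by
    intro A A' D f h
    apply D.sym.η_inj
    simp only [sym, Elem.map_map, pm_id, Category.comp_id]
    rw [← pc_nat, ← Elem.map_map, h]
  obtain ⟨j, hj⟩ := key D E i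
  obtain ⟨k, hk⟩ := key E D i.symm
  have h1 : j ≫ k = 𝟙 _ := by
    apply inj D
    rw [← hj, Elem.map_map, pm_comp] at hk
    simpa using hk
  have h2 : k ≫ j = 𝟙 _ := by
    apply inj E
    rw [← hk, Elem.map_map, pm_comp] at hj
    simpa using hj
  let J : A' ≅ C' := ⟨j, k, h1, h2⟩
  refine ⟨J, hj, ?_⟩
  have h3 := eps_unique (D.transport i J) E hj
  rw [← h3]
  simp only [transport, Coelem.comap_comap, tm_comp, Iso.hom_inv_id, tm_id]
  simp
end Dual
end PNC

namespace PNC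
open CategoryTheory
variable {P : Type}
set_option linter.unusedSimpArgs false

/-- Optional disjunctive context. -/
def px (A : Form P) : Option (Form P) → Form P
  | none => A
  | some H => A ⋎ H

def pxm {A B : Form P} (f : A ⟶ B) : (o : Option (Form P)) → (px A o ⟶ px B o)
  | none => f
  | some H => f ⩖ 𝟙 H

def dO (A B : Form P) : (o : Option (Form P)) → (A ⋏ px B o ⟶ px (A ⋏ B) o)
  | none => 𝟙 _
  | some H => dd A B H

def dlO (A : Form P) : (o : Option (Form P)) → (W : Form P) → (px A o ⋏ W ⟶ px (A ⋏ W) o)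
  | none, _ => 𝟙 _
  | some H, W => dl A H W

def swO (X : Form P) : (o1 o2 : Option (Form P)) → (px (px X o1) o2 ⟶ px (px X o2) o1)
  | none, _ => 𝟙 _
  | some H, none => 𝟙 (X ⋎ H)
  | some H, some G => sw X H G

variable {A B C D E F X Y Z W : Form P}

@[simp] theorem pxm_id (A : Form P) (o : Option (Form P)) : pxm (𝟙 A) o = 𝟙 (px A o) := by
  cases o <;> simp [pxm, px]

theorem pxm_comp (f : A ⟶ B) (g : B ⟶ C) (o : Option (Form P)) :
    pxm (f ≫ g) o = pxm f o ≫ pxm g o := by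
  cases o <;> simp [pxm, px, pm_comp]

theorem swO_nat (f : X ⟶ Y) (o1 o2 : Option (Form P)) :
    swO X o1 o2 ≫ pxm (pxm f o2) o1 = pxm (pxm f o1) o2 ≫ swO Y o1 o2 := by
  rcases o1 with _ | H <;> rcases o2 with _ | G
  · simp [swO, pxm, px]
  · simp [swO, pxm, px]
  · simp [swO, pxm, px]
  · exact (sw_nat _ _ _).symm

theorem swO_swO (X : Form P) (o1 o2 : Option (Form P)) : swO X o1 o2 ≫ swO X o2 o1 = 𝟙 _ := by
  rcases o1 with _ | H <;> rcases o2 with _ | G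
  · simp [swO]
  · exact Category.id_comp _
  · simp [swO, px]
  · exact sw_sw _ _ _

theorem dO_nat (f : A ⟶ C) (g : B ⟶ D) (o : Option (Form P)) :
    (f ⩕ pxm g o) ≫ dO C D o = dO A B o ≫ pxm (f ⩕ g) o := by
  cases o
  · simp [dO, pxm, px]
  · exact dd_nat _ _ _

theorem dlO_nat (f : A ⟶ C) (g : B ⟶ D) (o : Option (Form P)) :
    (pxm f o ⩕ g) ≫ dlO C o D = dlO A o B ≫ pxm (f ⩕ g) o := by
  cases o
  · simp [dlO, pxm, px]
  · exact dl_nat _ _ _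

theorem tc_dlO (A W : Form P) (o : Option (Form P)) :
    tc W (px A o) ≫ dlO A o W = dO W A o ≫ pxm (tc W A) o := by
  cases o
  · simp [dlO, dO, pxm, px]
  · exact tc_dl _ _ _

theorem tc_dO (A W : Form P) (o : Option (Form P)) :
    tc (px A o) W ≫ dO W A o = dlO A o W ≫ pxm (tc A W) o := by
  cases o
  · simp [dlO, dO, pxm, px]
  · exact (dl_tc _ _ _).symm

theorem starO (A B : Form P) (o1 o2 : Option (Form P)) :
    dlO A o1 (px B o2) ≫ pxm (dO A B o2) o1 =
      dO (px A o1) B o2 ≫ pxm (dlO A o1 B) o2 ≫ swO (A ⋏ B) o1 o2 := by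
  rcases o1 with _ | H <;> rcases o2 with _ | G
  · simp [dlO, dO, pxm, px, swO]
  · simp [dlO, dO, pxm, px, swO]
  · simp [dlO, dO, pxm, px, swO]
  · exact star _ _ _ _

theorem lawPO (e : Elem F) (X : Form P) (o : Option (Form P)) :
    e.arr (px X o) ≫ dlO X o F = pxm (e.arr X) o := by
  cases o
  · simp [dlO, pxm, px]
  · exact e.lawP _ _

/-- The tensor of two elements in contexts. -/
def T {o1 o2 : Option (Form P)} (e1 : Elem (px A o1)) (e2 : Elem (px B o2)) :
    Elem (px (px (A ⋏ B) o2) o1) :=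
  e1.map (pxm (e2.arr A ≫ dO A B o2) o1)

def lft {o1 : Option (Form P)} (e1 : Elem (px A o1)) (Z : Form P) : Z ⟶ px (A ⋏ Z) o1 :=
  e1.arr Z ≫ tc Z (px A o1) ≫ dlO A o1 Z

theorem T_flip {o1 o2 : Option (Form P)} (e1 : Elem (px A o1)) (e2 : Elem (px B o2)) :
    T e1 e2 = e2.map (pxm (lft e1 B) o2 ≫ swO (A ⋏ B) o1 o2) := by
  have h := e2.and_comm e1
  rw [T, pxm_comp, ← lawPO, Category.assoc, starO, ← Elem.map_map]
  change (e1.and e2).map _ = _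
  rw [← h, Elem.map_map, ra (tc_dO _ _ _), Elem.and, Elem.map_map, Category.assoc, ra (lawPO _ _ _)]
  simp only [lft, pxm_comp, Category.assoc]

theorem lft_tc {o1 : Option (Form P)} (e1 : Elem (px A o1)) (Z : Form P) :
    lft e1 Z ≫ pxm (tc A Z) o1 = e1.arr Z ≫ dO Z A o1 := by
  rw [lft, Category.assoc, Category.assoc, ← tc_dO, tc_tc_a]

theorem T_tc {o1 o2 : Option (Form P)} (e1 : Elem (px A o1)) (e2 : Elem (px B o2)) :
    (T e1 e2).map (pxm (pxm (tc A B) o2) o1) = (T e2 e1).map (swO (B ⋏ A) o1 o2) := by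
  rw [T_flip, Elem.map_map, Category.assoc, swO_nat, ← Category.assoc, ← pxm_comp, lft_tc,
    ← Elem.map_map]
  rfl

theorem T_map {o1 o2 : Option (Form P)} (e1 : Elem (px A o1)) (e2 : Elem (px B o2))
    (f : A ⟶ C) (g : B ⟶ D) :
    (T e1 e2).map (pxm (pxm (f ⩕ g) o2) o1) = T (e1.map (pxm f o1)) (e2.map (pxm g o2)) := by
  rw [T, T, Elem.map_map, Elem.map_map, ← pxm_comp, ← pxm_comp, Elem.map_arr, Category.assoc,
    Category.assoc, dO_nat]
  have h : dO A B o2 ≫ pxm (f ⩕ g) o2 = (f ⩕ 𝟙 _) ≫ dO C B o2 ≫ pxm (𝟙 C ⩕ g) o2 := by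
    rw [← dO_nat, ← dO_nat, tm_comp_assoc]; simp
  rw [h, ra (e2.nat f).symm, Category.assoc]

theorem lft_dd {o1 : Option (Form P)} (e1 : Elem (px A o1)) (B C : Form P) :
    lft e1 (B ⋎ C) ≫ pxm (dd A B C) o1 = (lft e1 B ⩖ 𝟙 C) ≫ swO (A ⋏ B) o1 (some C) := by
  have h := starO A B o1 (some C)
  have h2 := tc_dO B (px A o1) (some C)
  have h3 := lawPO e1 B (some C)
  rw [lft, Category.assoc, Category.assoc]
  change e1.arr (px B (some C)) ≫ tc (px B (some C)) _ ≫ dlO A o1 (px B (some C)) ≫ pxm (dO A B (some C)) o1 =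
    pxm (lft e1 B) (some C) ≫ _
  rw [h, ra h2, Category.assoc, ra h3, lft]
  simp only [pxm_comp, Category.assoc]

theorem t_hex1 (A B C : Form P) : tc A (B ⋏ C) =
    ta A B C ≫ (tc A B ⩕ 𝟙 C) ≫ ta' B A C ≫ (𝟙 B ⩕ tc A C) ≫ ta B C A := by
  rw [← t_hex A B C]
  simp [tm_comp, tm_comp_assoc]

theorem t_hex2 (A B C : Form P) : tc (B ⋏ C) A =
    ta' B C A ≫ (𝟙 B ⩕ tc C A) ≫ ta B A C ≫ (tc B A ⩕ 𝟙 C) ≫ ta' A B C := by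
  have h : tc A (B ⋏ C) ≫ ta' B C A ≫ (𝟙 B ⩕ tc C A) ≫ ta B A C ≫ (tc B A ⩕ 𝟙 C) ≫ ta' A B C = 𝟙 _ := by
    rw [t_hex1]
    simp [tm_comp, tm_comp_assoc]
  rw [← Category.comp_id (tc (B ⋏ C) A), ← h, tc_tc_a]

theorem t_hex3 (V B C : Form P) : tc (V ⋏ B) C ≫ (𝟙 C ⩕ tc V B) ≫ ta C B V =
    ta' V B C ≫ tc V (B ⋏ C) ≫ (tc B C ⩕ 𝟙 V) := by
  rw [ra (tc_nat _ _).symm, Category.assoc, t_hex2 C B V, t_hex1 V B C]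
  simp [tm_comp, tm_comp_assoc]

theorem t_hex4 (A B C : Form P) : ta' C B A ≫ (𝟙 C ⩕ tc B A) ≫ tc C (A ⋏ B) =
    (tc C B ⩕ 𝟙 A) ≫ tc (B ⋏ C) A ≫ ta A B C := by
  have h : (ta' C B A ≫ (𝟙 C ⩕ tc B A) ≫ tc C (A ⋏ B)) ≫ (tc (A ⋏ B) C ≫ (𝟙 C ⩕ tc A B) ≫ ta C B A) = 𝟙 _ := by
    simp [tm_comp, tm_comp_assoc]
  rw [t_hex3] at h
  have h2 : (ta' A B C ≫ tc A (B ⋏ C) ≫ (tc B C ⩕ 𝟙 A)) ≫ ((tc C B ⩕ 𝟙 A) ≫ tc (B ⋏ C) A ≫ ta A B C) = 𝟙 _ := by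
    simp [tm_comp, tm_comp_assoc]
  have h3 := congrArg (· ≫ ((tc C B ⩕ 𝟙 A) ≫ tc (B ⋏ C) A ≫ ta A B C)) h
  try simp only at h3
  rw [Category.assoc, h2] at h3
  simpa using h3

theorem dl_t (A H B C : Form P) : (dl A H B ⩕ 𝟙 C) ≫ dl (A ⋏ B) H C =
    ta' _ _ _ ≫ dl A H (B ⋏ C) ≫ (ta A B C ⩖ 𝟙 H) := by
  have h1 : (dl A H B ⩕ 𝟙 C) ≫ tc _ _ = tc _ _ ≫ (𝟙 C ⩕ tc _ _) ≫ (𝟙 C ⩕ dd B A H) ≫ (𝟙 C ⩕ (tc B A ⩖ 𝟙 H)) := by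
    rw [tc_nat, dl]; simp [tm_comp]
  have h2 : (𝟙 C ⩕ dd B A H) ≫ dd C (B ⋏ A) H = ta C B (A ⋎ H) ≫ dd (C ⋏ B) A H ≫ (ta' C B A ⩖ 𝟙 H) := by
    rw [dd_t, ta_ta'_a]
  have h3 : dd (B ⋏ C) A H = (tc B C ⩕ 𝟙 _) ≫ dd (C ⋏ B) A H ≫ ((tc C B ⩕ 𝟙 A) ⩖ 𝟙 H) := by
    rw [← dd_nat, tm_comp_assoc]; simp
  conv_lhs => rw [dl.eq_1 (A ⋏ B), ra h1]
  conv_rhs => rw [dl.eq_1 A H (B ⋏ C), h3]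
  simp only [Category.assoc]
  rw [ra (dd_nat _ _ _), Category.assoc, ra h2]
  simp only [Category.assoc]
  rw [ra3 (t_hex3 _ _ _)]
  simp only [Category.assoc, pm_comp, Category.comp_id]
  rw [t_hex4]

theorem dlO_t (A B C : Form P) (o : Option (Form P)) :
    (dlO A o B ⩕ 𝟙 C) ≫ dlO (A ⋏ B) o C =
    ta' _ _ _ ≫ dlO A o (B ⋏ C) ≫ pxm (ta A B C) o := by
  cases o
  · simp [dlO, pxm, px]
  · exact dl_t _ _ _ _

theorem lft_ta {o1 : Option (Form P)} (e1 : Elem (px A o1)) (B C : Form P) :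
    lft e1 (B ⋏ C) ≫ pxm (ta A B C) o1 = (lft e1 B ⩕ 𝟙 C) ≫ dlO (A ⋏ B) o1 C := by
  have h : (lft e1 B ⩕ 𝟙 C) = ((e1.arr B ≫ tc _ _) ⩕ 𝟙 C) ≫ (dlO A o1 B ⩕ 𝟙 C) := by
    rw [tm_comp, lft]; simp
  rw [h, Category.assoc, dlO_t]
  have h2 : ((e1.arr B ≫ tc _ _) ⩕ 𝟙 C) ≫ ta' _ _ _ = e1.arr (B ⋏ C) ≫ tc _ _ := by
    have h3 : e1.arr (B ⋏ C) = (𝟙 B ⩕ e1.arr C) ≫ ta _ _ _ := by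
      rw [← e1.lawT]; simp
    rw [h3, ← e1.b2, t_hex2]
    simp [tm_comp, tm_comp_assoc]
  rw [ra h2, lft]
  simp only [Category.assoc]

/-- Maps between optional contexts. -/
inductive OHom : Option (Form P) → Option (Form P) → Type
  | none : OHom none none
  | some {H H' : Form P} (h : H ⟶ H') : OHom (some H) (some H')

def pxr (X : Form P) : {o o' : Option (Form P)} → OHom o o' → (px X o ⟶ px X o')
  | _, _, .none => 𝟙 X
  | _, _, .some h => 𝟙 X ⩖ h

theorem pxr_nat (f : X ⟶ Y) {o o' : Option (Form P)} (h : OHom o o') :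
    pxm f o ≫ pxr Y h = pxr X h ≫ pxm f o' := by
  cases h <;> simp [pxm, pxr, px, pm_comp]

theorem pxr_dO (A B : Form P) {o o' : Option (Form P)} (h : OHom o o') :
    dO A B o ≫ pxr (A ⋏ B) h = (𝟙 A ⩕ pxr B h) ≫ dO A B o' := by
  cases h
  · simp [pxm, pxr, px, pm_comp, dO]
  · rename_i H H' h
    have := dd_nat (𝟙 A) (𝟙 B) h
    rw [tm_id] at this
    exact this.symm

theorem T_ctx1 {o1 o1' o2 : Option (Form P)} (e1 : Elem (px A o1)) (e2 : Elem (px B o2))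
    (h : OHom o1 o1') : T (e1.map (pxr A h)) e2 = (T e1 e2).map (pxr _ h) := by
  rw [T, T, Elem.map_map, Elem.map_map, pxr_nat]

theorem T_ctx2 {o1 o2 o2' : Option (Form P)} (e1 : Elem (px A o1)) (e2 : Elem (px B o2))
    (h : OHom o2 o2') : T e1 (e2.map (pxr B h)) = (T e1 e2).map (pxm (pxr _ h) o1) := by
  rw [T, T, Elem.map_map, ← pxm_comp, Elem.map_arr, Category.assoc, Category.assoc, pxr_dO]
end PNC

namespace PNC
open CategoryTheory
variable {P : Type}
set_option linter.unusedSimpArgs false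

/-- Structural arrows of the disjunction. -/
inductive S : (F G : Form P) → (F ⟶ G) → Prop
  | id (F : Form P) : S F F (𝟙 F)
  | comp {F G H : Form P} {s : F ⟶ G} {t : G ⟶ H} : S F G s → S G H t → S F H (s ≫ t)
  | pm {A B C D : Form P} {s : A ⟶ C} {t : B ⟶ D} : S A C s → S B D t → S (A ⋎ B) (C ⋎ D) (s ⩖ t)
  | pa (A B C : Form P) : S _ _ (pa A B C)
  | pa' (A B C : Form P) : S _ _ (pa' A B C)
  | pc (A B : Form P) : S _ _ (pc A B)

def NonDisj (X : Form P) : Prop := ∀ A B : Form P, X ≠ A ⋎ B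

theorem NonDisj.conj (A B : Form P) : NonDisj (A ⋏ B) := by intro C D h; cases h
theorem NonDisj.letter (p : P) : NonDisj (Form.letter p) := by intro C D h; cases h
theorem NonDisj.neg (A : Form P) : NonDisj (∼A) := by intro C D h; cases h

/-- Positions of a component. -/
inductive Pos (X : Form P) : Form P → Type
  | hole : Pos X X
  | left {F : Form P} (p : Pos X F) (H : Form P) : Pos X (F ⋎ H)
  | right (H : Form P) {F : Form P} (p : Pos X F) : Pos X (H ⋎ F)

namespace Pos
variable {X Y F G : Form P}

def repl : {F : Form P} → Pos X F → Form P → Form P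
  | _, .hole, Y => Y
  | _, .left p H, Y => p.repl Y ⋎ H
  | _, .right H p, Y => H ⋎ p.repl Y

def map (g : X ⟶ Y) : {F : Form P} → (p : Pos X F) → (F ⟶ p.repl Y)
  | _, .hole => g
  | _, .left p H => p.map g ⩖ 𝟙 H
  | _, .right H p => 𝟙 H ⩖ p.map g
end Pos

theorem pa_nat1 {A A' : Form P} (f : A ⟶ A') (B C : Form P) :
    (f ⩖ 𝟙 (B ⋎ C)) ≫ pa A' B C = pa A B C ≫ ((f ⩖ 𝟙 B) ⩖ 𝟙 C) := by rw [← pa_nat, pm_id]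
theorem pa_nat2 {B B' : Form P} (A : Form P) (f : B ⟶ B') (C : Form P) :
    (𝟙 A ⩖ (f ⩖ 𝟙 C)) ≫ pa A B' C = pa A B C ≫ ((𝟙 A ⩖ f) ⩖ 𝟙 C) := by rw [← pa_nat]
theorem pa_nat3 {C C' : Form P} (A B : Form P) (f : C ⟶ C') :
    (𝟙 A ⩖ (𝟙 B ⩖ f)) ≫ pa A B C' = pa A B C ≫ (𝟙 (A ⋎ B) ⩖ f) := by rw [pa_nat, pm_id]
theorem pa'_nat1 {A A' : Form P} (f : A ⟶ A') (B C : Form P) :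
    ((f ⩖ 𝟙 B) ⩖ 𝟙 C) ≫ pa' A' B C = pa' A B C ≫ (f ⩖ 𝟙 (B ⋎ C)) := by rw [pa'_nat, pm_id]
theorem pa'_nat2 {B B' : Form P} (A : Form P) (f : B ⟶ B') (C : Form P) :
    ((𝟙 A ⩖ f) ⩖ 𝟙 C) ≫ pa' A B' C = pa' A B C ≫ (𝟙 A ⩖ (f ⩖ 𝟙 C)) := by rw [← pa'_nat]
theorem pa'_nat3 {C C' : Form P} (A B : Form P) (f : C ⟶ C') :
    (𝟙 (A ⋎ B) ⩖ f) ≫ pa' A B C' = pa' A B C ≫ (𝟙 A ⩖ (𝟙 B ⩖ f)) := by rw [← pa'_nat, pm_id]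
theorem pm_sq1 {A B C D A' C' : Form P} {s : A ⟶ C} {t : B ⟶ D} {f : A ⟶ A'} {f' : C ⟶ C'}
    {s' : A' ⟶ C'} (h : f ≫ s' = s ≫ f') :
    (f ⩖ 𝟙 B) ≫ (s' ⩖ t) = (s ⩖ t) ≫ (f' ⩖ 𝟙 D) := by
  rw [pm_comp, pm_comp, h]; simp
theorem pm_sq2 {A B C D B' D' : Form P} {s : A ⟶ C} {t : B ⟶ D} {f : B ⟶ B'} {f' : D ⟶ D'}
    {t' : B' ⟶ D'} (h : f ≫ t' = t ≫ f') :
    (𝟙 A ⩖ f) ≫ (s ⩖ t') = (s ⩖ t) ≫ (𝟙 C ⩖ f') := by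
  rw [pm_comp, pm_comp, h]; simp
theorem _root_.PNC.Coelem.rgt {X : Form P} (κ : Coelem X) (A B : Form P) :
    𝟙 A ⩖ (pc B X ≫ κ.arr B) = pa A B X ≫ pc (A ⋎ B) X ≫ κ.arr (A ⋎ B) := by
  rw [p_hex2]
  simp only [Category.assoc, pa_pa'_a]
  rw [← κ.left, pm_comp, Category.comp_id]

theorem S_repl {X F G : Form P} {s : F ⟶ G} (h : S F G s) (hX : NonDisj X) (q : Pos X G) :
    ∃ p : Pos X F, ∀ Y, ∃ s', S (p.repl Y) (q.repl Y) s' ∧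
      ∀ g : X ⟶ Y, p.map g ≫ s' = s ≫ q.map g := by
  induction h with
  | id F => exact ⟨q, fun Y => ⟨𝟙 _, S.id _, fun g => by simp⟩⟩
  | comp h1 h2 ih1 ih2 =>
    obtain ⟨p2, k2⟩ := ih2 q
    obtain ⟨p1, k1⟩ := ih1 p2
    refine ⟨p1, fun Y => ?_⟩
    obtain ⟨s1, a1, b1⟩ := k1 Y
    obtain ⟨s2, a2, b2⟩ := k2 Y
    exact ⟨s1 ≫ s2, a1.comp a2, fun g => by rw [ra (b1 g), Category.assoc, b2, Category.assoc]⟩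
  | pm h1 h2 ih1 ih2 =>
    cases q with
    | hole => exact absurd rfl (hX _ _)
    | left q H =>
      obtain ⟨p, k⟩ := ih1 q
      refine ⟨p.left _, fun Y => ?_⟩
      obtain ⟨s1, a1, b1⟩ := k Y
      exact ⟨_, a1.pm h2, fun g => pm_sq1 (b1 g)⟩
    | right H q =>
      obtain ⟨p, k⟩ := ih2 q
      refine ⟨p.right _, fun Y => ?_⟩
      obtain ⟨s1, a1, b1⟩ := k Y
      exact ⟨_, h1.pm a1, fun g => pm_sq2 (b1 g)⟩
  | pa A B C =>
    cases q with
    | hole => exact absurd rfl (hX _ _)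
    | left q H =>
      cases q with
      | hole => exact absurd rfl (hX _ _)
      | left q H => exact ⟨q.left _, fun Y => ⟨_, S.pa _ _ _, fun g => pa_nat1 (q.map g) _ _⟩⟩
      | right H q => exact ⟨(q.left _).right _, fun Y => ⟨_, S.pa _ _ _, fun g => pa_nat2 _ (q.map g) _⟩⟩
    | right H q => exact ⟨(q.right _).right _, fun Y => ⟨_, S.pa _ _ _, fun g => pa_nat3 _ _ (q.map g)⟩⟩
  | pa' A B C =>
    cases q with
    | hole => exact absurd rfl (hX _ _)
    | right H q =>
      cases q with
      | hole => exact absurd rfl (hX _ _)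
      | left q H => exact ⟨(q.right _).left _, fun Y => ⟨_, S.pa' _ _ _, fun g => pa'_nat2 _ (q.map g) _⟩⟩
      | right H q => exact ⟨q.right _, fun Y => ⟨_, S.pa' _ _ _, fun g => pa'_nat3 _ _ (q.map g)⟩⟩
    | left q H => exact ⟨(q.left _).left _, fun Y => ⟨_, S.pa' _ _ _, fun g => pa'_nat1 (q.map g) _ _⟩⟩
  | pc A B =>
    cases q with
    | hole => exact absurd rfl (hX _ _)
    | left q H => exact ⟨q.right _, fun Y => ⟨_, S.pc _ _, fun g => pc_nat _ _⟩⟩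
    | right H q => exact ⟨q.left _, fun Y => ⟨_, S.pc _ _, fun g => pc_nat _ _⟩⟩

theorem S.to_nonDisj {F G : Form P} {s : F ⟶ G} (h : S F G s) (hG : NonDisj G) :
    ∃ e : F = G, s = eqToHom e := by
  induction h with
  | id F => exact ⟨rfl, rfl⟩
  | comp h1 h2 ih1 ih2 =>
    obtain ⟨rfl, rfl⟩ := ih2 hG
    obtain ⟨rfl, rfl⟩ := ih1 hG
    exact ⟨rfl, by simp⟩
  | pm => exact absurd rfl (hG _ _)
  | pa => exact absurd rfl (hG _ _)
  | pa' => exact absurd rfl (hG _ _)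
  | pc => exact absurd rfl (hG _ _)

/-- Killing a component. -/
inductive Kill {X : Form P} (κ : Coelem X) : (F F' : Form P) → (F ⟶ F') → Prop
  | hl (H : Form P) : Kill κ (X ⋎ H) H (κ.arr H)
  | hr (H : Form P) : Kill κ (H ⋎ X) H (pc _ _ ≫ κ.arr H)
  | left {F F' : Form P} {k : F ⟶ F'} (H : Form P) : Kill κ F F' k → Kill κ (F ⋎ H) (F' ⋎ H) (k ⩖ 𝟙 H)
  | right {F F' : Form P} {k : F ⟶ F'} (H : Form P) : Kill κ F F' k → Kill κ (H ⋎ F) (H ⋎ F') (𝟙 H ⩖ k)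

theorem S_kill {X F G G' : Form P} {s : F ⟶ G} (h : S F G s) (hX : NonDisj X) {κ : Coelem X}
    {k : G ⟶ G'} (q : Kill κ G G' k) :
    ∃ F' k' s', Kill κ F F' k' ∧ S F' G' s' ∧ k' ≫ s' = s ≫ k := by
  induction h generalizing G' with
  | id F => exact ⟨_, _, _, q, S.id _, by simp⟩
  | comp h1 h2 ih1 ih2 =>
    obtain ⟨F2, k2, s2, a2, b2, c2⟩ := ih2 q
    obtain ⟨F1, k1, s1, a1, b1, c1⟩ := ih1 a2
    exact ⟨_, _, _, a1, b1.comp b2, by rw [ra c1, Category.assoc, c2, Category.assoc]⟩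
  | @pm A B C D s t h1 h2 ih1 ih2 =>
    cases q with
    | hl => 
      obtain ⟨rfl, rfl⟩ := h1.to_nonDisj hX
      exact ⟨_, _, _, Kill.hl _, h2, by simp [κ.nat]⟩
    | hr =>
      obtain ⟨rfl, rfl⟩ := h2.to_nonDisj hX
      exact ⟨_, _, _, Kill.hr _, h1, by
        rw [eqToHom_refl, ra (pc_nat _ _), Category.assoc, Category.assoc, κ.nat]⟩
    | left H q =>
      obtain ⟨F1, k1, s1, a1, b1, c1⟩ := ih1 q
      exact ⟨_, _, _, a1.left _, b1.pm h2, pm_sq1 c1⟩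
    | right H q =>
      obtain ⟨F1, k1, s1, a1, b1, c1⟩ := ih2 q
      exact ⟨_, _, _, a1.right _, h1.pm b1, pm_sq2 c1⟩
  | pa A B C =>
    cases q with
    | hl => exact absurd rfl (hX _ _)
    | hr => exact ⟨_, _, _, (Kill.hr _).right _, S.id _, by
        rw [κ.rgt, Category.comp_id]⟩
    | left H q =>
      cases q with
      | hl => exact ⟨_, _, _, Kill.hl _, S.id _, by
          rw [← κ.lawP]; simp⟩
      | hr => exact ⟨_, _, _, (Kill.hl _).right _, S.id _, by
          rw [← κ.mid]; simp⟩
      | left H q => exact ⟨_, _, _, q.left _, S.pa _ _ _, pa_nat1 _ _ _⟩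
      | right H q => exact ⟨_, _, _, (q.left _).right _, S.pa _ _ _, pa_nat2 _ _ _⟩
    | right H q => exact ⟨_, _, _, (q.right _).right _, S.pa _ _ _, pa_nat3 _ _ _⟩
  | pa' A B C =>
    cases q with
    | hr => exact absurd rfl (hX _ _)
    | hl => exact ⟨_, _, _, (Kill.hl _).left _, S.id _, by
        rw [← κ.lawP]; simp⟩
    | right H q =>
      cases q with
      | hr => exact ⟨_, _, _, Kill.hr _, S.id _, by
          rw [κ.rgt, Category.comp_id, pa'_pa_a]⟩
      | hl => exact ⟨_, _, _, (Kill.hr _).left _, S.id _, by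
          rw [← κ.mid]; simp⟩
      | left H q => exact ⟨_, _, _, (q.right _).left _, S.pa' _ _ _, pa'_nat2 _ _ _⟩
      | right H q => exact ⟨_, _, _, q.right _, S.pa' _ _ _, pa'_nat3 _ _ _⟩
    | left H q => exact ⟨_, _, _, (q.left _).left _, S.pa' _ _ _, pa'_nat1 _ _ _⟩
  | pc A B =>
    cases q with
    | hl => exact ⟨_, _, _, Kill.hr _, S.id _, by simp⟩
    | hr => exact ⟨_, _, _, Kill.hl _, S.id _, by simp⟩
    | left H q => exact ⟨_, _, _, q.right _, S.pc _ _, pc_nat _ _⟩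
    | right H q => exact ⟨_, _, _, q.left _, S.pc _ _, pc_nat _ _⟩
end PNC

namespace PNC
open CategoryTheory
variable {P : Type}
set_option linter.unusedSimpArgs false

/-- Cut-free provable elements. -/
inductive Prov : (F : Form P) → Elem F → Prop
  | ax (p : P) : Prov (∼(Form.letter p) ⋎ Form.letter p) (deE (Form.letter p))
  | tens {A B : Form P} {o1 o2 : Option (Form P)} {e1 : Elem (px A o1)} {e2 : Elem (px B o2)} :
      Prov (px A o1) e1 → Prov (px B o2) e2 → Prov (px (px (A ⋏ B) o2) o1) (T e1 e2)
  | str {F G : Form P} {s : F ⟶ G} {e : Elem F} : S F G s → Prov F e → Prov G (e.map s)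

theorem S.pxm {X Y : Form P} {s : X ⟶ Y} (h : S X Y s) (o : Option (Form P)) :
    S (px X o) (px Y o) (pxm s o) := by
  cases o
  · exact h
  · exact h.pm (S.id _)

theorem S.sw (X H G : Form P) : S _ _ (sw X H G) :=
  (S.pa' _ _ _).comp (((S.id _).pm (S.pc _ _)).comp (S.pa _ _ _))
theorem S.sl (X H G : Form P) : S _ _ (sl X H G) :=
  (S.pa _ _ _).comp (((S.pc _ _).pm (S.id _)).comp (S.pa' _ _ _))

theorem S.swO (X : Form P) (o1 o2 : Option (Form P)) : S _ _ (swO X o1 o2) := by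
  rcases o1 with _ | H <;> rcases o2 with _ | G
  · exact S.id _
  · exact S.id _
  · exact S.id _
  · exact S.sw _ _ _

def Good {X Y : Form P} (g : X ⟶ Y) : Prop :=
  ∀ (o : Option (Form P)) (e : Elem (px X o)), Prov (px X o) e → Prov (px Y o) (e.map (pxm g o))

theorem descent {X Y : Form P} (g : X ⟶ Y) (hX : NonDisj X)
    (hax : ∀ (p : P) (q : Pos X (∼(Form.letter p) ⋎ Form.letter p)),
      Prov (q.repl Y) ((deE (Form.letter p)).map (q.map g)))
    (hpr : ∀ (A B : Form P) (o1 o2 : Option (Form P)) (e1 : Elem (px A o1)) (e2 : Elem (px B o2))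
      (h : A ⋏ B = X), Prov _ e1 → Prov _ e2 →
      Prov (px (px Y o2) o1) ((T e1 e2).map (pxm (pxm (eqToHom h ≫ g) o2) o1)))
    {F : Form P} {e : Elem F} (h : Prov F e) :
    ∀ q : Pos X F, Prov (q.repl Y) (e.map (q.map g)) := by
  induction h with
  | ax p => exact hax p
  | @str F G s e hs h ih =>
    intro q
    obtain ⟨p, k⟩ := S_repl hs hX q
    obtain ⟨s', a, b⟩ := k Y
    have := (ih p).str a
    rw [Elem.map_map, b] at this
    rwa [Elem.map_map]
  | @tens A B o1 o2 e1 e2 h1 h2 ih1 ih2 =>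
    intro q
    rcases o1 with _ | H1 <;> rcases o2 with _ | H2
    · cases q
      have := hpr A B none none e1 e2 rfl h1 h2
      exact (congrArg (fun t : A ⋏ B ⟶ Y => Prov (px (px Y none) none) ((T e1 e2).map (pxm (pxm t none) none)))
        (Category.id_comp g)).mp this
    · rcases q with _ | ⟨q, _⟩ | ⟨_, q⟩
      · exact absurd rfl (hX _ _)
      · cases q
        have := hpr A B none (some H2) e1 e2 rfl h1 h2
        exact (congrArg (fun t : A ⋏ B ⟶ Y => Prov (px (px Y (some H2)) none) ((T e1 e2).map (pxm (pxm t (some H2)) none)))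
          (Category.id_comp g)).mp this
      · have := Prov.tens h1 (o2 := some _) (ih2 (q.right _))
        exact (congrArg (Prov _) (T_ctx2 e1 e2 (OHom.some (q.map g)))).mp this
    · rcases q with _ | ⟨q, _⟩ | ⟨_, q⟩
      · exact absurd rfl (hX _ _)
      · cases q
        have := hpr A B (some H1) none e1 e2 rfl h1 h2
        exact (congrArg (fun t : A ⋏ B ⟶ Y => Prov (px (px Y none) (some H1)) ((T e1 e2).map (pxm (pxm t none) (some H1))))
          (Category.id_comp g)).mp this
      · have := Prov.tens (o1 := some _) (ih1 (q.right _)) h2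
        exact (congrArg (Prov _) (T_ctx1 e1 e2 (OHom.some (q.map g)))).mp this
    · rcases q with _ | ⟨_ | ⟨q, _⟩ | ⟨_, q⟩, _⟩ | ⟨_, q⟩
      · exact absurd rfl (hX _ _)
      · exact absurd rfl (hX _ _)
      · cases q
        have := hpr A B (some H1) (some H2) e1 e2 rfl h1 h2
        exact (congrArg (fun t : A ⋏ B ⟶ Y => Prov (px (px Y (some H2)) (some H1)) ((T e1 e2).map (pxm (pxm t (some H2)) (some H1))))
          (Category.id_comp g)).mp this
      · have := Prov.tens h1 (o2 := some _) (ih2 (q.right _))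
        exact (congrArg (Prov _) (T_ctx2 e1 e2 (OHom.some (q.map g)))).mp this
      · have := Prov.tens (o1 := some _) (ih1 (q.right _)) h2
        exact (congrArg (Prov _) (T_ctx1 e1 e2 (OHom.some (q.map g)))).mp this

theorem good_of_pos {X Y : Form P} (g : X ⟶ Y)
    (h : ∀ {F : Form P} {e : Elem F}, Prov F e → ∀ q : Pos X F, Prov (q.repl Y) (e.map (q.map g))) :
    Good g := by
  intro o e he
  cases o
  · exact h he Pos.hole
  · exact h he (Pos.hole.left _)

theorem good_conj {A B Y : Form P} (g : A ⋏ B ⟶ Y)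
    (hpr : ∀ (o1 o2 : Option (Form P)) (e1 : Elem (px A o1)) (e2 : Elem (px B o2)),
      Prov _ e1 → Prov _ e2 → Prov (px (px Y o2) o1) ((T e1 e2).map (pxm (pxm g o2) o1))) :
    Good g := by
  apply good_of_pos
  apply descent g (NonDisj.conj _ _)
  · intro p q
    rcases q with _ | ⟨q, _⟩ | ⟨_, q⟩
    · cases q
    · cases q
  · intro A' B' o1 o2 e1 e2 h h1 h2
    cases h
    simpa using hpr o1 o2 e1 e2 h1 h2

namespace Good
variable {A B C D X Y Z : Form P}

theorem id (A : Form P) : Good (𝟙 A) := by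
  intro o e h; simpa using h

theorem comp {f : X ⟶ Y} {g : Y ⟶ Z} (hf : Good f) (hg : Good g) : Good (f ≫ g) := by
  intro o e h
  rw [pxm_comp, ← Elem.map_map]
  exact hg _ _ (hf _ _ h)

theorem of_S {s : X ⟶ Y} (h : S X Y s) : Good s := fun o _ he => he.str (h.pxm o)

theorem pm_left {f : X ⟶ Y} (hf : Good f) (H : Form P) : Good (f ⩖ 𝟙 H) := by
  intro o e h
  rcases o with _ | K
  · exact hf (some H) e h
  · have := (hf (some (H ⋎ K)) _ (h.str (S.pa' _ _ _))).str (S.pa _ _ _)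
    have h2 : pa' X H K ≫ (f ⩖ 𝟙 (H ⋎ K)) ≫ pa _ _ _ = (f ⩖ 𝟙 H) ⩖ 𝟙 K := by
      rw [ra (pa'_nat1 f H K).symm, Category.assoc, pa'_pa, Category.comp_id]
    have h3 : ∀ e : Elem ((X ⋎ H) ⋎ K), ((e.map (pa' X H K)).map (f ⩖ 𝟙 (H ⋎ K))).map (pa _ _ _)
        = e.map ((f ⩖ 𝟙 H) ⩖ 𝟙 K) := by
      intro e; rw [Elem.map_map, Elem.map_map, h2]
    exact (congrArg (Prov ((Y ⋎ H) ⋎ K)) (h3 e)).mp this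

theorem pm {f : X ⟶ Y} {g : A ⟶ B} (hf : Good f) (hg : Good g) : Good (f ⩖ g) := by
  have h1 : f ⩖ g = (f ⩖ 𝟙 A) ≫ pc _ _ ≫ (g ⩖ 𝟙 Y) ≫ pc _ _ := by
    rw [pc_nat, pc_pc_a, pm_comp]; simp
  rw [h1]
  exact (hf.pm_left _).comp ((of_S (S.pc _ _)).comp ((hg.pm_left _).comp (of_S (S.pc _ _))))

theorem tm {f : X ⟶ Y} {g : A ⟶ B} (hf : Good f) (hg : Good g) : Good (f ⩕ g) := by
  apply good_conj
  intro o1 o2 e1 e2 h1 h2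
  rw [T_map]
  exact Prov.tens (hf _ _ h1) (hg _ _ h2)

theorem tc (A B : Form P) : Good (tc A B) := by
  apply good_conj
  intro o1 o2 e1 e2 h1 h2
  rw [T_tc]
  exact (Prov.tens h2 h1).str (S.swO _ _ _)

theorem lft {o1 : Option (Form P)} {e1 : Elem (px A o1)} (h1 : Prov _ e1) (Z : Form P) :
    Good (lft e1 Z) := by
  intro o e h
  have := (Prov.tens h1 h).str (S.swO _ o o1)
  rw [T_flip, Elem.map_map, Category.assoc, swO_swO, Category.comp_id] at this
  exact this

theorem pxm {f : X ⟶ Y} (hf : Good f) (o : Option (Form P)) : Good (pxm f o) := by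
  cases o
  · exact hf
  · exact hf.pm_left _

theorem of_lft (g : A ⋏ B ⟶ Y)
    (h : ∀ (o1 : Option (Form P)) (e1 : Elem (px A o1)), Prov _ e1 →
      Good (PNC.lft e1 B ≫ PNC.pxm g o1)) : Good g := by
  apply good_conj
  intro o1 o2 e1 e2 h1 h2
  have := ((h o1 e1 h1) o2 e2 h2).str (S.swO _ _ _)
  rw [Elem.map_map, pxm_comp, Category.assoc, ← swO_nat] at this
  rwa [T_flip, Elem.map_map, Category.assoc]

theorem dd (A B C : Form P) : Good (dd A B C) := by
  apply of_lft
  intro o1 e1 h1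
  rw [lft_dd]
  exact ((lft h1 _).pm_left _).comp (of_S (S.swO (A ⋏ B) o1 (some C)))

theorem dlO (A : Form P) (o : Option (Form P)) (W : Form P) : Good (dlO A o W) := by
  cases o
  · exact id _
  · exact (tc _ _).comp ((dd _ _ _).comp ((tc _ _).pm_left _))

theorem ta (A B C : Form P) : Good (ta A B C) := by
  apply of_lft
  intro o1 e1 h1
  rw [lft_ta]
  exact ((lft h1 _).tm (id _)).comp (dlO _ _ _)

theorem ta' (A B C : Form P) : Good (ta' A B C) := by
  have h : PNC.ta' A B C = PNC.tc _ _ ≫ (𝟙 C ⩕ PNC.tc A B) ≫ PNC.ta C B A ≫ (PNC.tc C B ⩕ 𝟙 A) ≫ PNC.tc _ _ := by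
    rw [ra3 (t_hex3 A B C)]
    simp [tm_comp_assoc]
  rw [h]
  exact (tc _ _).comp (((id _).tm (tc _ _)).comp ((ta _ _ _).comp (((tc _ _).tm (id _)).comp (tc _ _))))

theorem arr {e : Elem X} (h : Prov X e) (Z : Form P) : Good (e.arr Z) := by
  have := (lft (o1 := none) h Z).comp (tc _ _)
  have h2 : PNC.lft (o1 := none) e Z ≫ PNC.tc _ _ = e.arr Z := by
    simp [PNC.lft, PNC.dlO, px]
  rwa [h2] at this
end Good
end PNC

namespace PNC
open CategoryTheory
variable {P : Type}
set_option linter.unusedSimpArgs false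

open Classical in
noncomputable def bal : Form P → P → ℤ
  | .letter q, p => if q = p then 1 else 0
  | .neg A, p => - bal A p
  | .conj A B, p => bal A p + bal B p
  | .disj A B, p => bal A p + bal B p

theorem S.bal {F G : Form P} {s : F ⟶ G} (h : S F G s) (p : P) : bal F p = bal G p := by
  induction h with
  | id => rfl
  | comp _ _ h1 h2 => rw [h1, h2]
  | pm _ _ h1 h2 => simp only [PNC.bal, h1, h2]
  | pa => simp only [PNC.bal]; ring
  | pa' => simp only [PNC.bal]; ring
  | pc => simp only [PNC.bal]; ring

theorem Prov.bal {F : Form P} {e : Elem F} (h : Prov F e) (p : P) : bal F p = 0 := by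
  induction h with
  | ax q => simp only [PNC.bal]; ring
  | str hs _ ih => rw [← hs.bal, ih]
  | @tens A B o1 o2 e1 e2 h1 h2 ih1 ih2 =>
    rcases o1 with _ | H1 <;> rcases o2 with _ | H2 <;> simp only [PNC.bal, px] at * <;> linarith

theorem good_cut {p : P} {H : Form P} {e2 : Elem (∼(Form.letter p) ⋎ H)} (h : Prov _ e2) :
    Good (e2.arr (Form.letter p) ≫ (bd (Form.letter p)).n H) := by
  apply good_of_pos
  apply descent _ (NonDisj.letter _)
  · intro p' q
    rcases q with _ | ⟨q, _⟩ | ⟨_, q⟩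
    · cases q
    · cases q
      exact (congrArg (Prov _) ((bd (Form.letter p)).recov e2).symm).mp h
  · intro A B _ _ _ _ h
    cases h

theorem T_kill1 {A B X : Form P} {o2 : Option (Form P)} (κ : Coelem X) (e1 : Elem (px A (some X)))
    (e2 : Elem (px B o2)) :
    T (o1 := none) (e1.map (pc A X ≫ κ.arr A)) e2 = (T e1 e2).map (pc _ _ ≫ κ.arr (px (A ⋏ B) o2)) := by
  have h : ∀ {Y : Form P} (f : A ⟶ Y), (pc A X ≫ κ.arr A) ≫ f = (f ⩖ 𝟙 X) ≫ pc Y X ≫ κ.arr Y := by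
    intro Y f
    rw [ra (pc_nat _ _), Category.assoc, Category.assoc, κ.nat]
  have h2 : ∀ {Y : Form P} (e1 : Elem (A ⋎ X)) (f : A ⟶ Y), (e1.map (pc A X ≫ κ.arr A)).map f = 
     (e1.map (f ⩖ 𝟙 X)).map (pc Y X ≫ κ.arr Y) := by
    intro Y e1 f
    rw [Elem.map_map, Elem.map_map, h]
  exact h2 _ _

theorem T_kill2 {A B X : Form P} {o1 : Option (Form P)} (κ : Coelem X) (e1 : Elem (px A o1))
    (e2 : Elem (px B (some X))) :
    T (o2 := none) e1 (e2.map (pc B X ≫ κ.arr B)) = (T e1 e2).map (pxm (pc _ _ ≫ κ.arr (A ⋏ B)) o1) := by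
  have h : ∀ e2 : Elem (B ⋎ X), (e2.map (pc B X ≫ κ.arr B)).arr A ≫ 𝟙 (A ⋏ B) =
      (e2.arr A ≫ dd A B X) ≫ pc _ _ ≫ κ.arr (A ⋏ B) := by
    intro e2
    rw [Elem.map_arr, Category.assoc, Category.assoc, κ.lawT, Category.comp_id]
  have h2 : ∀ {U V : Form P} {a : A ⟶ V} {b : A ⟶ U} {c : U ⟶ V}, a = b ≫ c →
      e1.map (pxm a o1) = (e1.map (pxm b o1)).map (pxm c o1) := by
    rintro U V a b c rfl
    rw [Elem.map_map, pxm_comp]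
  exact h2 (h e2)

theorem kill_cl {X : Form P} {κ : Coelem X} {H1 : Form P} {B : Form P} {e1 : Elem (B ⋎ H1)}
    (h1 : ∀ F' k, Kill κ (B ⋎ H1) F' k → Prov F' (e1.map k)) {F' : Form P} {k : H1 ⟶ F'}
    (hk : Kill κ H1 F' k) :
    Prov (px B (some F')) ((show Elem (px B (some H1)) from e1).map (pxr B (OHom.some k))) :=
  h1 _ _ (hk.right _)

theorem kill_descent {p : P} {F : Form P} {e : Elem F} (h : Prov F e) :
    ∀ F' k, Kill (siE (Form.letter p)) F F' k → Prov F' (e.map k) := by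
  induction h with
  | ax q =>
    intro F' k hk
    cases hk with
    | left _ h => cases h
    | right _ h => cases h
  | str hs h ih =>
    intro G' k hk
    obtain ⟨F', k', s', a, b, c⟩ := S_kill hs (NonDisj.conj _ _) hk
    have := (ih _ _ a).str b
    rw [Elem.map_map, c] at this
    rwa [Elem.map_map]
  | @tens A B o1 o2 e1 e2 h1 h2 ih1 ih2 =>
    intro F' k hk
    have hb : ∀ e, Prov (Form.letter p) e → False := fun e h => by
      have := h.bal p; simp [bal] at this
    have hb' : ∀ e, Prov (∼(Form.letter p)) e → False := fun e h => by
      have := h.bal p; simp [bal] at this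
    have c1 : ∀ {H1 F' : Form P} {k : H1 ⟶ F'} {o2 : Option (Form P)}
        (e1 : Elem (px A (some H1))) (e2 : Elem (px B o2))
        (_ : ∀ F' k, Kill (siE (Form.letter p)) (px A (some H1)) F' k → Prov F' (e1.map k))
        (_ : Prov _ e2), Kill (siE (Form.letter p)) H1 F' k →
        Prov (px (px (A ⋏ B) o2) (some F')) ((T e1 e2).map (pxr _ (OHom.some k))) := by
      intro H1 F' k o2 e1 e2 ih h2 hk
      rw [← T_ctx1]
      exact Prov.tens (kill_cl ih hk) h2
    have c2 : ∀ {H2 F' : Form P} {k : H2 ⟶ F'} {o1 : Option (Form P)}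
        (e1 : Elem (px A o1)) (e2 : Elem (px B (some H2)))
        (_ : Prov _ e1) (_ : ∀ F' k, Kill (siE (Form.letter p)) (px B (some H2)) F' k → Prov F' (e2.map k))
        , Kill (siE (Form.letter p)) H2 F' k →
        Prov (px (px (A ⋏ B) (some F')) o1) ((T e1 e2).map (pxm (pxr _ (OHom.some k)) o1)) := by
      intro H1 F' k o2 e1 e2 ih h2 hk
      rw [← T_ctx2]
      exact Prov.tens ih (kill_cl h2 hk)
    have r1 : ∀ {o2 : Option (Form P)}
        (e1 : Elem (px A (some _))) (e2 : Elem (px B o2))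
        (_ : ∀ F' k, Kill (siE (Form.letter p)) (px A (some _)) F' k → Prov F' (e1.map k))
        (_ : Prov _ e2), Prov (px (A ⋏ B) o2) ((T e1 e2).map (pc _ _ ≫ (siE (Form.letter p)).arr _)) := by
      intro o2 e1 e2 ih h2
      rw [← T_kill1]
      exact Prov.tens (o1 := none) (ih _ _ (Kill.hr _)) h2
    have r2 : ∀ {o1 : Option (Form P)}
        (e1 : Elem (px A o1)) (e2 : Elem (px B (some _))) (_ : Prov _ e1)
        (_ : ∀ F' k, Kill (siE (Form.letter p)) (px B (some _)) F' k → Prov F' (e2.map k)),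
        Prov (px (A ⋏ B) o1) ((T e1 e2).map (pxm (pc _ _ ≫ (siE (Form.letter p)).arr _) o1)) := by
      intro o2 e1 e2 h1 ih
      rw [← T_kill2]
      exact Prov.tens (o2 := none) h1 (ih _ _ (Kill.hr _))
    rcases o1 with _ | H1 <;> rcases o2 with _ | H2
    · cases hk
    · cases hk with
      | hl => exact (hb _ h1).elim
      | hr => exact r2 e1 e2 h1 ih2
      | left _ h => cases h
      | right _ h => exact c2 e1 e2 h1 ih2 h
    · cases hk with
      | hl => exact (hb' _ h2).elim
      | hr => exact r1 e1 e2 ih1 h2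
      | left _ h => cases h
      | right _ h => exact c1 e1 e2 ih1 h2 h
    · cases hk with
      | hr => exact r1 e1 e2 ih1 h2
      | right _ h => exact c1 e1 e2 ih1 h2 h
      | left _ h =>
        cases h with
        | hr => exact r2 e1 e2 h1 ih2
        | left _ h => cases h
        | right _ h => exact c2 e1 e2 h1 ih2 h
        | hl =>
          have := good_cut (p := p) h2 (some H1) e1 h1
          have h3 : ∀ (e1 : Elem (Form.letter p ⋎ H1)) (e2 : Elem (∼(Form.letter p) ⋎ H2)),
              e1.map ((e2.arr (Form.letter p) ≫ (bd (Form.letter p)).n H2) ⩖ 𝟙 H1) =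
              (e1.map ((e2.arr (Form.letter p) ≫ dd _ _ _) ⩖ 𝟙 H1)).map ((siE (Form.letter p)).arr H2 ⩖ 𝟙 H1) := by
            intro e1 e2
            rw [Elem.map_map, pm_comp, Category.assoc, Category.comp_id]
            rfl
          exact (congrArg (Prov _) (h3 e1 e2)).mp this

theorem good_si (p : P) (A : Form P) : Good (si (Form.letter p) A) := by
  intro o e h
  cases o
  · exact kill_descent h _ _ (Kill.hl _)
  · exact kill_descent h _ _ ((Kill.hl _).left _)
end PNC

namespace PNC
open CategoryTheory
variable {P : Type}
set_option linter.unusedSimpArgs false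

def paO (F H : Form P) : (o : Option (Form P)) → (px (F ⋎ H) o ⟶ F ⋎ px H o)
  | none => 𝟙 _
  | some K => pa' F H K

theorem paO_nat1 {F F' : Form P} (f : F ⟶ F') (H : Form P) (o : Option (Form P)) :
    pxm (f ⩖ 𝟙 H) o ≫ paO F' H o = paO F H o ≫ (f ⩖ 𝟙 _) := by
  cases o
  · simp [paO, pxm, px]
  · exact pa'_nat1 _ _ _
theorem paO_nat2 {H H' : Form P} (F : Form P) (f : H ⟶ H') (o : Option (Form P)) :
    pxm (𝟙 F ⩖ f) o ≫ paO F H' o = paO F H o ≫ (𝟙 F ⩖ pxm f o) := by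
  cases o
  · simp [paO, pxm, px]
  · exact pa'_nat2 _ _ _
theorem paO_nat3 (F H : Form P) {o o' : Option (Form P)} (τ : OHom o o') :
    pxr (F ⋎ H) τ ≫ paO F H o' = paO F H o ≫ (𝟙 F ⩖ pxr H τ) := by
  cases τ
  · simp [paO, pxr, px]
  · rename_i A B h
    have : (𝟙 (F ⋎ H) ⩖ h) ≫ pa' F H B = pa' F H A ≫ (𝟙 F ⩖ (𝟙 H ⩖ h)) := (pa'_nat3 _ _ _)
    exact this

def OHom.comp : {o o' o'' : Option (Form P)} → OHom o o' → OHom o' o'' → OHom o o''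
  | _, _, _, .none, .none => .none
  | _, _, _, .some f, .some g => .some (f ≫ g)
def OHom.id : (o : Option (Form P)) → OHom o o
  | Option.none => .none
  | Option.some _ => .some (𝟙 _)

theorem glue {a b c d e f : Form P} {α : a ⟶ b} {β' : b ⟶ c} {β : a ⟶ d} {γ : d ⟶ c} {δ' : c ⟶ e} {δ : d ⟶ f}
    {ε : f ⟶ e} (h1 : α ≫ β' = β ≫ γ) (h2 : γ ≫ δ' = δ ≫ ε) : α ≫ β' ≫ δ' = (β ≫ δ) ≫ ε := by
  rw [ra h1, Category.assoc, Category.assoc, h2]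

def OS : {o o' : Option (Form P)} → OHom o o' → Prop
  | _, _, .none => True
  | _, _, .some (H := H) (H' := H') h => S H H' h

theorem OS.id (o : Option (Form P)) : OS (OHom.id o) := by
  cases o
  · trivial
  · exact S.id _
theorem OS.comp {o o' o'' : Option (Form P)} {σ : OHom o o'} {τ : OHom o' o''} (h : OS σ) (k : OS τ) :
    OS (σ.comp τ) := by
  cases σ <;> cases τ
  · trivial
  · exact S.comp h k

@[simp] theorem pxr_id (X : Form P) (o : Option (Form P)) : pxr X (OHom.id o) = 𝟙 _ := by
  cases o
  · rfl
  · exact pm_id _ _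
theorem pxr_comp (X : Form P) {o o' o'' : Option (Form P)} (σ : OHom o o') (τ : OHom o' o'') :
    pxr X (σ.comp τ) = pxr X σ ≫ pxr X τ := by
  cases σ <;> cases τ <;> simp [pxr, OHom.comp, px, pm_comp]

theorem S.pxr (X : Form P) {o o' : Option (Form P)} {σ : OHom o o'} (h : OS σ) : S _ _ (pxr X σ) := by
  cases σ
  · exact S.id _
  · exact (S.id _).pm h

theorem S.paO (F H : Form P) (o : Option (Form P)) : S _ _ (paO F H o) := by
  cases o
  · exact S.id _
  · exact S.pa' _ _ _

namespace Pos
variable {X : Form P}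
def ro : {F : Form P} → Pos X F → Option (Form P) → Option (Form P)
  | _, .hole, o => o
  | _, .left p H, o => p.ro (some (px H o))
  | _, .right H p, o => p.ro (some (px H o))

def xo : {F : Form P} → (p : Pos X F) → (o : Option (Form P)) → (px F o ⟶ px X (p.ro o))
  | _, .hole, _ => 𝟙 _
  | _, .left (F := F) p H, o => paO F H o ≫ p.xo (some (px H o))
  | _, .right H (F := F) p, o => pxm (pc H F) o ≫ paO F H o ≫ p.xo (some (px H o))

def rom {o o' : Option (Form P)} : {F : Form P} → (p : Pos X F) → OHom o o' → OHom (p.ro o) (p.ro o')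
  | _, .hole, τ => τ
  | _, .left p H, τ => p.rom (OHom.some (pxr H τ))
  | _, .right H p, τ => p.rom (OHom.some (pxr H τ))

theorem rom_S {F : Form P} (p : Pos X F) : ∀ {o o' : Option (Form P)} {τ : OHom o o'},
    OS τ → OS (p.rom τ) := by
  induction p with
  | hole => intro _ _ _ h; exact h
  | left p H ih => intro _ _ τ h; exact @ih _ _ (OHom.some _) (S.pxr H h)
  | right H p ih => intro _ _ τ h; exact @ih _ _ (OHom.some _) (S.pxr H h)

theorem xo_nat {F : Form P} (p : Pos X F) : ∀ {o o' : Option (Form P)} (τ : OHom o o'),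
    pxr F τ ≫ p.xo o' = p.xo o ≫ pxr X (p.rom τ) := by
  induction p with
  | hole => intro _ _ τ; exact (Category.comp_id _).trans (Category.id_comp _).symm
  | left p H ih =>
    intro _ _ τ
    exact glue (paO_nat3 _ _ τ) (ih (OHom.some (pxr H τ)))
  | right H p ih =>
    intro o o' τ
    exact glue (pxr_nat _ τ).symm (glue (paO_nat3 _ _ τ) (ih (OHom.some (pxr H τ))))

theorem xo_S {F : Form P} (p : Pos X F) : ∀ (o : Option (Form P)), S _ _ (p.xo o) := by
  induction p with
  | hole => intro o; exact S.id _
  | left p H ih => intro o; exact (S.paO _ _ _).comp (ih (some _))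
  | right H p ih => intro o; exact ((S.pc _ _).pxm _).comp ((S.paO _ _ _).comp (ih (some _)))
end Pos

theorem S.inv {F G : Form P} {s : F ⟶ G} (h : S F G s) : ∃ t, S G F t ∧ s ≫ t = 𝟙 _ ∧ t ≫ s = 𝟙 _ := by
  induction h with
  | id => exact ⟨_, S.id _, by simp, by simp⟩
  | comp _ _ h1 h2 =>
    obtain ⟨t1, a1, b1, c1⟩ := h1
    obtain ⟨t2, a2, b2, c2⟩ := h2
    refine ⟨_, a2.comp a1, ?_, ?_⟩
    · rw [Category.assoc, ra b2, Category.id_comp, b1]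
    · rw [Category.assoc, ra c1, Category.id_comp, c2]
  | pm _ _ h1 h2 =>
    obtain ⟨t1, a1, b1, c1⟩ := h1
    obtain ⟨t2, a2, b2, c2⟩ := h2
    exact ⟨_, a1.pm a2, by rw [pm_comp, b1, b2, pm_id], by rw [pm_comp, c1, c2, pm_id]⟩
  | pa => exact ⟨_, S.pa' _ _ _, by simp, by simp⟩
  | pa' => exact ⟨_, S.pa _ _ _, by simp, by simp⟩
  | pc => exact ⟨_, S.pc _ _, by simp, by simp⟩

theorem OS.inv {o o' : Option (Form P)} {σ : OHom o o'} (h : OS σ) : ∃ τ : OHom o' o, OS τ ∧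
    ∀ X, pxr X σ ≫ pxr X τ = 𝟙 _ := by
  cases σ with
  | none => exact ⟨.none, trivial, fun X => Category.id_comp _⟩
  | some s =>
    obtain ⟨t, a, b, c⟩ := S.inv h
    exact ⟨.some t, a, fun X => by
      have : (𝟙 X ⩖ s) ≫ (𝟙 X ⩖ t) = 𝟙 _ := by rw [pm_comp, b]; simp
      exact this⟩

theorem pa'_pent2 (A B C D : Form P) : pa' (A ⋎ B) C D ≫ pa' A B (C ⋎ D) ≫ (𝟙 A ⩖ pa B C D) =
    (pa' A B C ⩖ 𝟙 D) ≫ pa' A (B ⋎ C) D := by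
  rw [ra (pa'_pent A B C D)]
  simp [pm_comp]

theorem I1 (A B C : Form P) (o : Option (Form P)) :
    pxm (pa A B C) o ≫ paO (A ⋎ B) C o ≫ pa' A B (px C o) = paO A (B ⋎ C) o ≫ (𝟙 A ⩖ paO B C o) := by
  rcases o with _ | K
  · simp [paO, pxm, px]
  · change (pa A B C ⩖ 𝟙 K) ≫ pa' _ _ _ ≫ pa' _ _ _ = pa' _ _ _ ≫ (𝟙 A ⩖ pa' _ _ _)
    rw [pa'_pent, pm_comp_assoc]
    simp

def s2 (A C : Form P) : (o : Option (Form P)) → (C ⋎ px A o ⟶ A ⋎ px C o)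
  | none => pc C A
  | some K => sl C A K

theorem S.s2 (A C : Form P) (o : Option (Form P)) : S _ _ (s2 A C o) := by
  cases o
  · exact S.pc _ _
  · exact S.sl _ _ _

theorem I2 (A B C : Form P) (o : Option (Form P)) :
    pxm (pa A B C) o ≫ paO (A ⋎ B) C o ≫ (pc A B ⩖ 𝟙 (px C o)) ≫ pa' B A (px C o) =
    pxm (pc A (B ⋎ C)) o ≫ paO (B ⋎ C) A o ≫ pa' B C (px A o) ≫ (𝟙 B ⩖ s2 A C o) := by
  rcases o with _ | K
  · simp only [paO, pxm, px, Category.id_comp, s2]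
    exact sl_eq A B C
  · change (pa A B C ⩖ 𝟙 K) ≫ pa' (A ⋎ B) C K ≫ (pc A B ⩖ 𝟙 (C ⋎ K)) ≫ pa' B A (C ⋎ K) =
      (pc A (B ⋎ C) ⩖ 𝟙 K) ≫ pa' (B ⋎ C) A K ≫ pa' B C (A ⋎ K) ≫ (𝟙 B ⩖ sl C A K)
    rw [ra (pa'_nat1 _ _ _).symm, Category.assoc, pa'_pent, ra (pa'_pent B C A K)]
    have h := congrArg (· ⩖ 𝟙 K) (sl_eq A B C)
    rw [sl] at h
    have h2 : ∀ {U V W Z : Form P} (f : U ⟶ V) (g : V ⟶ W) (h : W ⟶ Z), (f ≫ g ≫ h) ⩖ 𝟙 K = (f ⩖ 𝟙 K) ≫ (g ⩖ 𝟙 K) ≫ (h ⩖ 𝟙 K) := by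
      intros; simp [pm_comp]
    simp only [h2] at h
    rw [ra3 h]
    simp only [Category.assoc]
    rw [ra (pa'_nat2 _ _ _)]
    simp [sl, pm_comp]

def s3 (A B : Form P) : (o : Option (Form P)) → (B ⋎ px A o ⟶ px (A ⋎ B) o)
  | none => pc B A
  | some K => pa B A K ≫ (pc B A ⩖ 𝟙 K)

theorem S.s3 (A C : Form P) (o : Option (Form P)) : S _ _ (s3 A C o) := by
  cases o
  · exact S.pc _ _
  · exact (S.pa _ _ _).comp ((S.pc _ _).pm (S.id _))

theorem I3 (A B C : Form P) (o : Option (Form P)) :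
    pxm (pa A B C) o ≫ pxm (pc (A ⋎ B) C) o ≫ paO C (A ⋎ B) o =
    pxm (pc A (B ⋎ C)) o ≫ paO (B ⋎ C) A o ≫ (pc B C ⩖ 𝟙 _) ≫ pa' C B (px A o) ≫ (𝟙 C ⩖ s3 A B o) := by
  have h0 : pa A B C ≫ pc (A ⋎ B) C = pc A (B ⋎ C) ≫ (pc B C ⩖ 𝟙 A) ≫ pa' C B A ≫ (𝟙 C ⩖ pc B A) := by
    rw [p_hex2 C A B, ra (pc_nat _ _).symm, Category.assoc, p_hex1 A C B]
    simp [sl, pm_comp, pm_comp_assoc]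
  rcases o with _ | K
  · simp only [paO, pxm, px, Category.id_comp, s3, Category.comp_id]
    exact h0
  · change (pa A B C ⩖ 𝟙 K) ≫ (pc _ _ ⩖ 𝟙 K) ≫ pa' _ _ _ =
      (pc A (B ⋎ C) ⩖ 𝟙 K) ≫ pa' (B ⋎ C) A K ≫ (pc B C ⩖ 𝟙 _) ≫ pa' C B (A ⋎ K) ≫ (𝟙 C ⩖ (pa B A K ≫ (pc B A ⩖ 𝟙 K)))
    have h2 : ∀ {U V W Z Z' : Form P} (f : U ⟶ V) (g : V ⟶ W) (h : W ⟶ Z) (i : Z ⟶ Z'),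
        (f ≫ g ≫ h ≫ i) ⩖ 𝟙 K = (f ⩖ 𝟙 K) ≫ (g ⩖ 𝟙 K) ≫ (h ⩖ 𝟙 K) ≫ (i ⩖ 𝟙 K) := by
      intros; simp [pm_comp]
    have h1 : (𝟙 C ⩖ (pa B A K ≫ (pc B A ⩖ 𝟙 K))) = (𝟙 C ⩖ pa B A K) ≫ (𝟙 C ⩖ (pc B A ⩖ 𝟙 K)) := by
      rw [pm_comp, Category.comp_id]
    rw [h1, ra (pa'_nat1 _ _ _).symm, Category.assoc, ra3 (pa'_pent2 _ _ _ _), Category.assoc, 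
      ← pa'_nat2, pm_comp_assoc, h0, Category.comp_id, h2]
    simp only [Category.assoc]
end PNC

namespace PNC
open CategoryTheory
variable {P : Type}
set_option linter.unusedSimpArgs false

/-- The relation between positions saying that a structural arrow moves one to the other. -/
def Pull {X F G : Form P} (p : Pos X F) (s : F ⟶ G) (q : Pos X G) : Prop :=
  ∀ o, ∃ σ : OHom (p.ro o) (q.ro o), OS σ ∧ p.xo o ≫ pxr X σ = pxm s o ≫ q.xo o

section
variable {a b c d e f g h i j k : Form P}
theorem g2 {s : a ⟶ b} {u : b ⟶ c} {v : a ⟶ d} {w : d ⟶ c} {x' : c ⟶ e} {x : d ⟶ f} {r : f ⟶ e}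
    (h1 : s ≫ u = v ≫ w) (h2 : w ≫ x' = x ≫ r) : (v ≫ x) ≫ r = s ≫ u ≫ x' := by
  rw [ra h1, Category.assoc, Category.assoc, h2]
theorem g3 {s : a ⟶ b} {u : b ⟶ g} {u2 : g ⟶ c} {v : a ⟶ d} {w : d ⟶ c} {x' : c ⟶ e} {x : d ⟶ f} {r : f ⟶ e}
    (h1 : s ≫ u ≫ u2 = v ≫ w) (h2 : w ≫ x' = x ≫ r) : (v ≫ x) ≫ r = s ≫ u ≫ u2 ≫ x' := by
  rw [ra3 h1, Category.assoc, Category.assoc, h2]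
theorem g4 {s : a ⟶ b} {u : b ⟶ g} {u2 : g ⟶ h} {u3 : h ⟶ c} {v : a ⟶ i} {v2 : i ⟶ j} {v3 : j ⟶ d} {w : d ⟶ c} {x' : c ⟶ e} {x : d ⟶ f} {r : f ⟶ e}
    (h1 : s ≫ u ≫ u2 ≫ u3 = v ≫ v2 ≫ v3 ≫ w) (h2 : w ≫ x' = x ≫ r) :
    (v ≫ v2 ≫ v3 ≫ x) ≫ r = s ≫ u ≫ u2 ≫ u3 ≫ x' := by
  have := congrArg (· ≫ x') h1
  simp only [Category.assoc] at this ⊢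
  rw [this, h2]
theorem g5 {s : a ⟶ b} {u : b ⟶ g} {u2 : g ⟶ c} {v : a ⟶ i} {v2 : i ⟶ j} {v3 : j ⟶ k} {v4 : k ⟶ d} {w : d ⟶ c} {x' : c ⟶ e} {x : d ⟶ f} {r : f ⟶ e}
    (h1 : s ≫ u ≫ u2 = v ≫ v2 ≫ v3 ≫ v4 ≫ w) (h2 : w ≫ x' = x ≫ r) :
    (v ≫ v2 ≫ v3 ≫ v4 ≫ x) ≫ r = s ≫ u ≫ u2 ≫ x' := by
  have := congrArg (· ≫ x') h1
  simp only [Category.assoc] at this ⊢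
  rw [this, h2]
theorem g6 {s : a ⟶ b} {u : b ⟶ c} {v : a ⟶ d} {w1 : d ⟶ e} {w2 : e ⟶ c} {y : e ⟶ f} {x : d ⟶ g} {r1 : g ⟶ f}
    {r2 : f ⟶ h} {x' : c ⟶ h}
    (h1 : s ≫ u = v ≫ w1 ≫ w2) (h2 : w1 ≫ y = x ≫ r1) (h3 : y ≫ r2 = w2 ≫ x') :
    (v ≫ x) ≫ (r1 ≫ r2) = s ≫ u ≫ x' := by
  rw [ra h1]
  simp only [Category.assoc]
  rw [← h3, ra h2, Category.assoc]
theorem g7 {s : a ⟶ b} {u : b ⟶ i} {u2 : i ⟶ c} {v : a ⟶ j} {v2 : j ⟶ d} {w1 : d ⟶ e} {w2 : e ⟶ c} {y : e ⟶ f} {x : d ⟶ g} {r1 : g ⟶ f}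
    {r2 : f ⟶ h} {x' : c ⟶ h}
    (h1 : s ≫ u ≫ u2 = v ≫ v2 ≫ w1 ≫ w2) (h2 : w1 ≫ y = x ≫ r1) (h3 : y ≫ r2 = w2 ≫ x') :
    (v ≫ v2 ≫ x) ≫ (r1 ≫ r2) = s ≫ u ≫ u2 ≫ x' := by
  rw [ra3 h1]
  simp only [Category.assoc]
  rw [← h3, ra h2, Category.assoc]
end

variable {X : Form P}
theorem Pull.pa1 {A B C : Form P} (q : Pos X A) : Pull (q.left (B ⋎ C)) (pa A B C) ((q.left B).left C) := by
  intro o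
  refine ⟨q.rom (OHom.some (paO B C o)), q.rom_S (τ := OHom.some _) (S.paO _ _ _), ?_⟩
  exact g3 (I1 A B C o) (q.xo_nat (OHom.some (paO B C o)))

theorem Pull.pa2 {A B C : Form P} (q : Pos X B) :
    Pull ((q.left C).right A) (pa A B C) ((q.right A).left C) := by
  intro o
  refine ⟨q.rom (OHom.some (s2 A C o)), q.rom_S (τ := OHom.some _) (S.s2 _ _ _), ?_⟩
  exact g4 (I2 A B C o) (q.xo_nat (OHom.some (s2 A C o)))

theorem Pull.pa3 {A B C : Form P} (q : Pos X C) :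
    Pull ((q.right B).right A) (pa A B C) (q.right (A ⋎ B)) := by
  intro o
  refine ⟨q.rom (OHom.some (s3 A B o)), q.rom_S (τ := OHom.some _) (S.s3 _ _ _), ?_⟩
  exact g5 (I3 A B C o) (q.xo_nat (OHom.some (s3 A B o)))

theorem Pull.inv {F G : Form P} {p : Pos X F} {s : F ⟶ G} {q : Pos X G} (h : Pull p s q) {t : G ⟶ F}
    (ht : t ≫ s = 𝟙 _) : Pull q t p := by
  intro o
  obtain ⟨σ, a, b⟩ := h o
  obtain ⟨τ, c, d⟩ := a.inv
  refine ⟨τ, c, ?_⟩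
  have := congrArg (fun z => pxm t o ≫ z ≫ pxr X τ) b
  simp only [Category.assoc, d] at this
  rw [← Category.assoc (pxm t o) (pxm s o), ← pxm_comp, ht] at this
  simpa using this.symm

theorem S_pull {F G : Form P} {s : F ⟶ G} (h : S F G s) (hX : NonDisj X) (q : Pos X G) :
    ∃ p : Pos X F, Pull p s q := by
  induction h with
  | id F => exact ⟨q, fun o => ⟨OHom.id _, OS.id _, by simp⟩⟩
  | comp h1 h2 ih1 ih2 =>
    obtain ⟨p2, k2⟩ := ih2 q
    obtain ⟨p1, k1⟩ := ih1 p2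
    refine ⟨p1, fun o => ?_⟩
    obtain ⟨σ, a, b⟩ := k1 o
    obtain ⟨τ, c, d⟩ := k2 o
    exact ⟨_, a.comp c, by rw [pxr_comp, ra b, Category.assoc, d, pxm_comp, Category.assoc]⟩
  | @pm A B C D s t h1 h2 ih1 ih2 =>
    cases q with
    | hole => exact absurd rfl (hX _ _)
    | left q H =>
      obtain ⟨p, k⟩ := ih1 q
      refine ⟨p.left _, fun o => ?_⟩
      obtain ⟨σ, a, b⟩ := k (some (px D o))
      refine ⟨_, (p.rom_S (τ := OHom.some (pxm t o)) (h2.pxm o)).comp a, ?_⟩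
      have e1 := p.xo_nat (OHom.some (pxm t o))
      have e2 : pxm (s ⩖ t) o ≫ paO C D o = paO A B o ≫ (𝟙 A ⩖ pxm t o) ≫ (s ⩖ 𝟙 _) := by
        have : s ⩖ t = (𝟙 A ⩖ t) ≫ (s ⩖ 𝟙 D) := by rw [pm_comp]; simp
        rw [this, pxm_comp, Category.assoc, paO_nat1, ra (paO_nat2 _ _ _), Category.assoc]
      exact (congrArg (fun z => _ ≫ z) (pxr_comp X _ σ)).trans (g6 e2 e1 b)
    | right H q =>
      obtain ⟨p, k⟩ := ih2 q
      refine ⟨p.right _, fun o => ?_⟩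
      obtain ⟨σ, a, b⟩ := k (some (px C o))
      refine ⟨_, (p.rom_S (τ := OHom.some (pxm s o)) (h1.pxm o)).comp a, ?_⟩
      have e1 := p.xo_nat (OHom.some (pxm s o))
      have e2 : pxm (s ⩖ t) o ≫ pxm (pc C D) o ≫ paO D C o =
          pxm (pc A B) o ≫ paO B A o ≫ (𝟙 B ⩖ pxm s o) ≫ (t ⩖ 𝟙 _) := by
        have : t ⩖ s = (𝟙 B ⩖ s) ≫ (t ⩖ 𝟙 C) := by rw [pm_comp]; simp
        rw [← Category.assoc, ← pxm_comp, pc_nat, this, pxm_comp, pxm_comp]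
        simp only [Category.assoc]
        rw [paO_nat1, ra (paO_nat2 _ _ _), Category.assoc]
      exact (congrArg (fun z => _ ≫ z) (pxr_comp X _ σ)).trans (g7 e2 e1 b)
  | pa A B C =>
    cases q with
    | hole => exact absurd rfl (hX _ _)
    | left q H =>
      cases q with
      | hole => exact absurd rfl (hX _ _)
      | left q H => exact ⟨_, Pull.pa1 q⟩
      | right H q => exact ⟨_, Pull.pa2 q⟩
    | right H q => exact ⟨_, Pull.pa3 q⟩
  | pa' A B C =>
    cases q with
    | hole => exact absurd rfl (hX _ _)
    | right H q =>
      cases q with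
      | hole => exact absurd rfl (hX _ _)
      | left q H => exact ⟨_, (Pull.pa2 q).inv (pa'_pa _ _ _)⟩
      | right H q => exact ⟨_, (Pull.pa3 q).inv (pa'_pa _ _ _)⟩
    | left q H => exact ⟨_, (Pull.pa1 q).inv (pa'_pa _ _ _)⟩
  | pc A B =>
    have key : ∀ {A B : Form P} (q : Pos X B), Pull (q.right A) (pc A B) (q.left A) := fun q o =>
      ⟨OHom.id _, OS.id _, (congrArg (fun z => _ ≫ z) (pxr_id X _)).trans (Category.comp_id _)⟩
    cases q with
    | hole => exact absurd rfl (hX _ _)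
    | left q H => exact ⟨_, key q⟩
    | right H q => exact ⟨_, (key q).inv (pc_pc _ _)⟩

/-! ### Components -/

def comps : Form P → List (Form P)
  | .disj A B => comps A ++ comps B
  | A => [A]

def ocomps : Option (Form P) → List (Form P)
  | none => []
  | some H => comps H

theorem comps_nd {X : Form P} (h : NonDisj X) : comps X = [X] := by
  cases X <;> first | rfl | exact absurd rfl (h _ _)

theorem comps_px (X : Form P) (o : Option (Form P)) : comps (px X o) = comps X ++ ocomps o := by
  cases o <;> simp [px, comps, ocomps]

theorem S.perm {F G : Form P} {s : F ⟶ G} (h : S F G s) : (comps F).Perm (comps G) := by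
  induction h with
  | id => exact List.Perm.refl _
  | comp _ _ h1 h2 => exact h1.trans h2
  | pm _ _ h1 h2 => exact h1.append h2
  | pa => simp [comps]
  | pa' => simp [comps]
  | pc => exact List.perm_append_comm

theorem mem_comps_nd {X F : Form P} (h : X ∈ comps F) : NonDisj X := by
  induction F with
  | disj A B ha hb =>
    rcases List.mem_append.1 h with h | h
    · exact ha h
    · exact hb h
  | letter => simp [comps] at h; subst h; exact NonDisj.letter _
  | neg => simp [comps] at h; subst h; exact NonDisj.neg _
  | conj => simp [comps] at h; subst h; exact NonDisj.conj _ _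

theorem Pos.mem {F : Form P} (hX : NonDisj X) (p : Pos X F) : X ∈ comps F := by
  induction p with
  | hole => simp [comps_nd hX]
  | left p H ih => exact List.mem_append_left _ ih
  | right H p ih => exact List.mem_append_right _ ih

theorem exists_pos {F : Form P} (h : X ∈ comps F) : Nonempty (Pos X F) := by
  induction F with
  | disj A B ha hb =>
    rcases List.mem_append.1 h with h | h
    · exact (ha h).map (fun p => p.left _)
    · exact (hb h).map (fun p => p.right _)
  | letter => simp [comps] at h; subst h; exact ⟨.hole⟩
  | neg => simp [comps] at h; subst h; exact ⟨.hole⟩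
  | conj => simp [comps] at h; subst h; exact ⟨.hole⟩

theorem Pos.eq {F : Form P} (hX : NonDisj X) (hF : (comps F).Nodup) (p q : Pos X F) : p = q := by
  induction p with
  | hole => 
    cases q with
    | hole => rfl
    | left => exact absurd rfl (hX _ _)
    | right => exact absurd rfl (hX _ _)
  | left p H ih =>
    have h := List.nodup_append'.1 hF
    cases q with
    | hole => exact absurd rfl (hX _ _)
    | left q => rw [ih h.1 q]
    | right _ q => exact (h.2.2 (p.mem hX) (q.mem hX)).elim
  | right H p ih =>
    have h := List.nodup_append'.1 hF
    cases q with
    | hole => exact absurd rfl (hX _ _)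
    | left q => exact (h.2.2 (q.mem hX) (p.mem hX)).elim
    | right _ q => rw [ih h.2.1 q]

theorem comps_ne_nil (F : Form P) : comps F ≠ [] := by
  induction F <;> simp_all [comps]

theorem Pos.perm {F : Form P} (hX : NonDisj X) (p : Pos X F) (o : Option (Form P)) :
    (X :: ocomps (p.ro o)).Perm (comps F ++ ocomps o) := by
  have := (p.xo_S o).perm
  rw [comps_px, comps_px, comps_nd hX] at this
  exact this.symm

theorem S_unique : ∀ (n : ℕ) {F G : Form P} {s t : F ⟶ G}, S F G s → S F G t → (comps F).Nodup →
    (comps F).length = n → s = t := by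
  intro n
  induction n with
  | zero => 
    intro F G s t _ _ _ h
    exact absurd (List.length_eq_zero_iff.1 h) (comps_ne_nil _)
  | succ n ih =>
    intro F G s t hs ht hF hn
    obtain ⟨X, hX⟩ := List.exists_mem_of_ne_nil _ (comps_ne_nil G)
    have nX := mem_comps_nd hX
    obtain ⟨q⟩ := exists_pos hX
    obtain ⟨p, k⟩ := S_pull hs nX q
    obtain ⟨p', k'⟩ := S_pull ht nX q
    obtain rfl := Pos.eq nX hF p p'
    obtain ⟨σ, a, b⟩ := k none
    obtain ⟨τ, c, d⟩ := k' none
    have hp := p.perm nX none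
    have hst : σ = τ := by
      clear b d k k'
      revert σ τ
      generalize q.ro none = r2
      revert hp
      generalize p.ro none = r1
      intro hp σ a τ c
      cases σ with
      | none => cases τ; rfl
      | some σ =>
        cases τ with
        | some τ =>
          simp only [ocomps, List.append_nil] at hp
          have hl := hp.length_eq
          have hd := hp.nodup_iff.2 hF
          rw [ih (s := σ) (t := τ) a c (List.nodup_cons.1 hd).2 (by simpa [hn] using hl)]
    subst hst
    rw [b] at d
    obtain ⟨v, _, h1, _⟩ := (q.xo_S none).inv
    have := congrArg (· ≫ v) d
    simp only [Category.assoc, h1, Category.comp_id] at this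
    exact this
end PNC

namespace PNC
open CategoryTheory
variable {P : Type}
set_option linter.unusedSimpArgs false

theorem S_exists : ∀ (n : ℕ) {F G : Form P}, (comps F).Perm (comps G) →
    (comps F).length = n → ∃ s, S F G s := by
  intro n
  induction n with
  | zero =>
    intro F G _ h
    exact absurd (List.length_eq_zero_iff.1 h) (comps_ne_nil _)
  | succ n ih =>
    intro F G hp hn
    obtain ⟨X, hX⟩ := List.exists_mem_of_ne_nil _ (comps_ne_nil G)
    have nX := mem_comps_nd hX
    obtain ⟨q⟩ := exists_pos hX
    obtain ⟨p⟩ := exists_pos (hp.mem_iff.2 hX)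
    have h1 := p.perm nX none
    have h2 := q.perm nX none
    simp only [ocomps, List.append_nil] at h1 h2
    have h3 := List.Perm.cons_inv (h1.trans (hp.trans h2.symm))
    have h4 := h1.length_eq
    have : ∃ σ : OHom (p.ro none) (q.ro none), OS σ := by
      revert h3 h4
      generalize p.ro none = r1
      generalize q.ro none = r2
      intro h3 h4
      rcases r1 with _ | H1 <;> rcases r2 with _ | H2
      · exact ⟨.none, trivial⟩
      · exact absurd (List.nil_perm.1 h3) (comps_ne_nil _)
      · exact absurd (List.perm_nil.1 h3) (comps_ne_nil _)
      · obtain ⟨s, hs⟩ := ih h3 (by simpa [hn] using h4)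
        exact ⟨.some s, hs⟩
    obtain ⟨σ, hσ⟩ := this
    obtain ⟨t, ht, _⟩ := (q.xo_S none).inv
    exact ⟨_, (p.xo_S none).comp ((S.pxr X hσ).comp ht)⟩

theorem S_ex {F G : Form P} (h : (comps F).Perm (comps G)) : ∃ s, S F G s := S_exists _ h rfl

theorem OS_ex {o o' : Option (Form P)} (h : (ocomps o).Perm (ocomps o')) : ∃ σ : OHom o o', OS σ := by
  rcases o with _ | H1 <;> rcases o' with _ | H2
  · exact ⟨.none, trivial⟩
  · exact absurd (List.nil_perm.1 h) (comps_ne_nil _)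
  · exact absurd (List.perm_nil.1 h) (comps_ne_nil _)
  · obtain ⟨s, hs⟩ := S_ex h
    exact ⟨.some s, hs⟩

theorem exists_o : ∀ (l : List (Form P)), (∀ X ∈ l, NonDisj X) → ∃ o, ocomps o = l := by
  intro l
  induction l with
  | nil => intro _; exact ⟨none, rfl⟩
  | cons X l ih =>
    intro h
    obtain ⟨o, ho⟩ := ih (fun Y hY => h Y (List.mem_cons_of_mem _ hY))
    refine ⟨some (px X o), ?_⟩
    change comps (px X o) = _
    rw [comps_px, comps_nd (h X List.mem_cons_self), ho]
    rfl

theorem mem_ocomps_nd {X : Form P} {o : Option (Form P)} (h : X ∈ ocomps o) : NonDisj X := by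
  cases o
  · simp [ocomps] at h
  · exact mem_comps_nd h

/-! ### Occurrences -/
open Classical in
noncomputable def occ : Form P → P → ℕ
  | .letter q, p => if q = p then 1 else 0
  | .neg A, p => occ A p
  | .conj A B, p => occ A p + occ B p
  | .disj A B, p => occ A p + occ B p

noncomputable def occL (l : List (Form P)) (p : P) : ℕ := (l.map (fun X => occ X p)).sum
noncomputable def balL (l : List (Form P)) (p : P) : ℤ := (l.map (fun X => bal X p)).sum

theorem occL_append (l l' : List (Form P)) (p : P) : occL (l ++ l') p = occL l p + occL l' p := by
  simp [occL]
theorem balL_append (l l' : List (Form P)) (p : P) : balL (l ++ l') p = balL l p + balL l' p := by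
  simp [balL]
theorem occL_perm {l l' : List (Form P)} (h : l.Perm l') (p : P) : occL l p = occL l' p :=
  (h.map _).sum_eq
theorem balL_perm {l l' : List (Form P)} (h : l.Perm l') (p : P) : balL l p = balL l' p :=
  (h.map _).sum_eq

theorem occ_comps (F : Form P) (p : P) : occ F p = occL (comps F) p := by
  induction F with
  | disj A B ha hb => simp only [occ, comps, occL_append, ha, hb]
  | _ => simp [comps, occL]
theorem bal_comps (F : Form P) (p : P) : bal F p = balL (comps F) p := by
  induction F with
  | disj A B ha hb => simp only [bal, comps, balL_append, ha, hb]
  | _ => simp [comps, balL]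

theorem occ_perm {F G : Form P} (h : (comps F).Perm (comps G)) (p : P) : occ F p = occ G p := by
  rw [occ_comps, occ_comps, occL_perm h]

theorem occ_px (X : Form P) (o : Option (Form P)) (p : P) : occ (px X o) p = occ X p + occL (ocomps o) p := by
  rw [occ_comps, comps_px, occL_append, ← occ_comps]

theorem exists_occ (F : Form P) : ∃ a, 0 < occ F a := by
  induction F with
  | letter q => exact ⟨q, by simp [occ]⟩
  | neg A h => exact h
  | conj A B h _ => obtain ⟨a, h⟩ := h; exact ⟨a, by simp only [occ]; omega⟩
  | disj A B h _ => obtain ⟨a, h⟩ := h; exact ⟨a, by simp only [occ]; omega⟩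

theorem bal_par (F : Form P) (a : P) : (bal F a).natAbs ≤ occ F a ∧ bal F a % 2 = (occ F a : ℤ) % 2 := by
  induction F with
  | letter q => by_cases h : q = a <;> simp [occ, bal, h]
  | neg A h => simp only [occ, bal]; omega
  | conj A B h h' => simp only [occ, bal]; push_cast; omega
  | disj A B h h' => simp only [occ, bal]; push_cast; omega

theorem balL_par (l : List (Form P)) (a : P) : (balL l a).natAbs ≤ occL l a := by
  induction l with
  | nil => simp [balL, occL]
  | cons X l ih =>
    have := (bal_par X a).1
    simp only [balL, occL, List.map_cons, List.sum_cons] at *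
    omega

def Balanced (F : Form P) : Prop := ∀ a, occ F a ≤ 2

theorem Prov.nodup {F : Form P} {e : Elem F} (h : Prov F e) (hb : Balanced F) : (comps F).Nodup := by
  rw [List.nodup_iff_sublist]
  intro X hX
  obtain ⟨l, hl⟩ := hX.exists_perm_append
  obtain ⟨a, ha⟩ := exists_occ X
  have h1 := hb a
  have h2 := h.bal a
  rw [occ_comps, occL_perm hl, occL_append] at h1
  rw [bal_comps, balL_perm hl, balL_append] at h2
  have h3 := bal_par X a
  have h4 := balL_par l a
  simp only [balL, occL, List.map_cons, List.sum_cons, List.map_nil, List.sum_nil] at *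
  omega

theorem Balanced.of_perm {F G : Form P} (h : Balanced F) (hp : (comps F).Perm (comps G)) : Balanced G :=
  fun a => by rw [← occ_perm hp]; exact h a

/-! ### Colourings -/
def Col (c : P → Bool) (b : Bool) (F : Form P) : Prop := ∀ a, 0 < occ F a → c a = b

variable {c : P → Bool} {b : Bool}

theorem occL_pos {l : List (Form P)} {a : P} : 0 < occL l a ↔ ∃ X ∈ l, 0 < occ X a := by
  induction l with
  | nil => simp [occL]
  | cons X l ih =>
    have : occL (X :: l) a = occ X a + occL l a := by simp [occL]
    simp only [this, List.mem_cons, exists_eq_or_imp, ← ih]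
    omega

theorem Col_comps {F : Form P} : Col c b F ↔ ∀ X ∈ comps F, Col c b X := by
  constructor
  · intro h X hX a ha
    exact h a (by rw [occ_comps, occL_pos]; exact ⟨X, hX, ha⟩)
  · intro h a ha
    rw [occ_comps, occL_pos] at ha
    obtain ⟨X, hX, ha⟩ := ha
    exact h X hX a ha

theorem Col_conj {A B : Form P} : Col c b (A ⋏ B) ↔ Col c b A ∧ Col c b B := by
  constructor
  · intro h
    exact ⟨fun a ha => h a (by simp only [occ]; omega), fun a ha => h a (by simp only [occ]; omega)⟩
  · rintro ⟨h1, h2⟩ a ha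
    simp only [occ] at ha
    rcases Nat.eq_zero_or_pos (occ A a) with h | h
    · exact h2 a (by omega)
    · exact h1 a h

theorem Col_px {A : Form P} {o : Option (Form P)} : Col c b (px A o) ↔ Col c b A ∧ ∀ X ∈ ocomps o, Col c b X := by
  rw [Col_comps, comps_px, List.forall_mem_append, ← Col_comps]

theorem Col.unique {F : Form P} {b' : Bool} (h : Col c b F) (h' : Col c b' F) : b = b' := by
  obtain ⟨a, ha⟩ := exists_occ F
  rw [← h a ha, h' a ha]

theorem Prov.conn {F : Form P} {e : Elem F} (h : Prov F e) :
    (∀ X ∈ comps F, ∃ b, Col c b X) → ∃ b, Col c b F := by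
  induction h with
  | ax p =>
    intro _
    refine ⟨c p, fun a ha => ?_⟩
    by_cases hp : p = a
    · rw [hp]
    · simp [occ, hp] at ha
  | str hs _ ih =>
    intro h
    obtain ⟨b, hb⟩ := ih (fun X hX => h X (hs.perm.mem_iff.1 hX))
    rw [Col_comps] at hb
    exact ⟨b, Col_comps.2 (fun X hX => hb X (hs.perm.mem_iff.2 hX))⟩
  | @tens A B o1 o2 e1 e2 h1 h2 ih1 ih2 =>
    intro h
    simp only [comps_px, List.forall_mem_append, comps_nd (NonDisj.conj A B), List.forall_mem_singleton] at h ih1 ih2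
    obtain ⟨⟨⟨b, hb⟩, h4⟩, h5⟩ := h
    refine ⟨b, ?_⟩
    rw [Col_conj] at hb
    obtain ⟨b1, k1⟩ := ih1 ⟨fun X hX => ⟨b, Col_comps.1 hb.1 X hX⟩, h5⟩
    obtain ⟨b2, k2⟩ := ih2 ⟨fun X hX => ⟨b, Col_comps.1 hb.2 X hX⟩, h4⟩
    rw [Col_px] at k1 k2
    obtain rfl := hb.1.unique k1.1
    obtain rfl := hb.2.unique k2.1
    rw [Col_px, Col_px, Col_conj]
    exact ⟨⟨hb, k2.2⟩, k1.2⟩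

end PNC

namespace PNC
open CategoryTheory
variable {P : Type}
set_option linter.unusedSimpArgs false

theorem sl_nat (Z K : Form P) {D Y : Form P} (k : D ⟶ Y) :
    (k ⩖ 𝟙 (Z ⋎ K)) ≫ sl Y Z K = sl D Z K ≫ (𝟙 Z ⩖ (k ⩖ 𝟙 K)) := by
  have h1 : (k ⩖ 𝟙 (Z ⋎ K)) ≫ pa Y Z K = pa D Z K ≫ ((k ⩖ 𝟙 Z) ⩖ 𝟙 K) := by
    rw [← pm_id]; exact (pa_nat _ _ _)
  have h2 : ((k ⩖ 𝟙 Z) ⩖ 𝟙 K) ≫ (pc Y Z ⩖ 𝟙 K) = (pc D Z ⩖ 𝟙 K) ≫ ((𝟙 Z ⩖ k) ⩖ 𝟙 K) := by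
    rw [pm_comp, pm_comp, pc_nat]
  have h3 : ((𝟙 Z ⩖ k) ⩖ 𝟙 K) ≫ pa' Z Y K = pa' Z D K ≫ (𝟙 Z ⩖ (k ⩖ 𝟙 K)) := pa'_nat _ _ _
  simp only [sl, Category.assoc]
  rw [ra h1, Category.assoc, ra h2, Category.assoc, h3]

def vO (D Z : Form P) : (Q : Option (Form P)) → (D ⋎ px Z Q ⟶ Z ⋎ px D Q)
  | none => pc D Z
  | some K => sl D Z K
theorem vO_nat {D Y : Form P} (k : D ⟶ Y) (Z : Form P) (Q : Option (Form P)) :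
    (k ⩖ 𝟙 (px Z Q)) ≫ vO Y Z Q = vO D Z Q ≫ (𝟙 Z ⩖ pxm k Q) := by
  cases Q
  · exact pc_nat _ _
  · exact sl_nat _ _ _
theorem S.vO (D Z : Form P) (Q : Option (Form P)) : S _ _ (vO D Z Q) := by
  cases Q
  · exact S.pc _ _
  · exact S.sl _ _ _

def wO (D Z : Form P) : (o : Option (Form P)) → (D ⋎ px Z o ⟶ px (D ⋎ Z) o)
  | none => 𝟙 _
  | some K => pa D Z K
theorem wO_nat {D Y : Form P} (k : D ⟶ Y) (Z : Form P) (o : Option (Form P)) :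
    (k ⩖ 𝟙 (px Z o)) ≫ wO Y Z o = wO D Z o ≫ pxm (k ⩖ 𝟙 Z) o := by
  cases o
  · simp [wO, pxm, px]
  · change (k ⩖ 𝟙 (Z ⋎ _)) ≫ pa Y Z _ = pa D Z _ ≫ ((k ⩖ 𝟙 Z) ⩖ 𝟙 _)
    rw [← pm_id]; exact (pa_nat _ _ _)
theorem S.wO (D Z : Form P) (o : Option (Form P)) : S _ _ (wO D Z o) := by
  cases o
  · exact S.id _
  · exact S.pa _ _ _

def Spl (A B : Form P) (o1 o2 : Option (Form P)) (e : Elem (px (px (A ⋏ B) o2) o1)) : Prop :=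
  ∃ (e1 : Elem (px A o1)) (e2 : Elem (px B o2)), Prov _ e1 ∧ Prov _ e2 ∧ e = T e1 e2

theorem Spl.ctx1 {A B : Form P} {o1 o1' o2 : Option (Form P)} {e : Elem (px (px (A ⋏ B) o2) o1)}
    (h : Spl A B o1 o2 e) (σ : OHom o1 o1')
    (hg : ∀ e1 : Elem (px A o1), Prov _ e1 → Prov _ (e1.map (pxr A σ))) :
    Spl A B o1' o2 (e.map (pxr _ σ)) := by
  obtain ⟨e1, e2, h1, h2, rfl⟩ := h
  exact ⟨_, e2, hg e1 h1, h2, (T_ctx1 e1 e2 σ).symm⟩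

theorem Spl.ctx2 {A B : Form P} {o1 o2 o2' : Option (Form P)} {e : Elem (px (px (A ⋏ B) o2) o1)}
    (h : Spl A B o1 o2 e) (σ : OHom o2 o2')
    (hg : ∀ e2 : Elem (px B o2), Prov _ e2 → Prov _ (e2.map (pxr B σ))) :
    Spl A B o1 o2' (e.map (pxm (pxr _ σ) o1)) := by
  obtain ⟨e1, e2, h1, h2, rfl⟩ := h
  exact ⟨e1, _, h1, hg e2 h2, (T_ctx2 e1 e2 σ).symm⟩

section
variable {D Y H A B : Form P} {o1 o2 Q : Option (Form P)}

theorem split_eq1 {a b d e f g : Form P} (x : Elem a) {k1 : a ⟶ b} {s1 : b ⟶ d} {s2 : d ⟶ e} {s3 : e ⟶ f}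
    {t1 : a ⟶ g} {t2 : g ⟶ e} (h : k1 ≫ s1 ≫ s2 = t1 ≫ t2) :
    (x.map k1).map (s1 ≫ s2 ≫ s3) = ((x.map t1).map t2).map s3 := by
  rw [Elem.map_map, Elem.map_map, Elem.map_map, ra3 h, Category.assoc]

theorem split_step1 {k : D ⟶ Y} (hk : Good k) {e0 : Elem (D ⋎ H)}
    (ih : ∀ {s}, S (D ⋎ H) (px (px (A ⋏ B) o2) (some (px D Q))) s →
      Spl A B (some (px D Q)) o2 (e0.map s))
    (hH : (comps H).Perm ((A ⋏ B) :: (ocomps o2 ++ ocomps Q)))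
    (h1 : (ocomps o1).Perm (comps Y ++ ocomps Q)) :
    ∃ s, S (Y ⋎ H) (px (px (A ⋏ B) o2) o1) s ∧ Spl A B o1 o2 ((e0.map (k ⩖ 𝟙 H)).map s) := by
  obtain ⟨θ, hθ⟩ := S_ex (F := H) (G := px (px (A ⋏ B) o2) Q) (by
    rw [comps_px, comps_px, comps_nd (NonDisj.conj A B)]; simpa using hH)
  obtain ⟨σ, hσ⟩ := OS_ex (o := some (px Y Q)) (o' := o1) (by
    change (comps (px Y Q)).Perm _
    rw [comps_px]; exact h1.symm)
  have i1 := ih (((S.id D).pm hθ).comp (S.vO D (px (A ⋏ B) o2) Q))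
  have i2 := i1.ctx1 (OHom.some (pxm k Q)) (fun e1 h => ((Good.id A).pm (hk.pxm Q)) none e1 h)
  have i3 := i2.ctx1 σ (fun e1 h => h.str (S.pxr _ hσ))
  refine ⟨_, ((S.id Y).pm hθ).comp ((S.vO Y (px (A ⋏ B) o2) Q).comp (S.pxr (px (A ⋏ B) o2) hσ)), ?_⟩
  have e1 : (k ⩖ 𝟙 H) ≫ (𝟙 Y ⩖ θ) ≫ vO Y (px (A ⋏ B) o2) Q = ((𝟙 D ⩖ θ) ≫ vO D (px (A ⋏ B) o2) Q) ≫ (𝟙 _ ⩖ pxm k Q) := by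
    rw [Category.assoc, ← vO_nat, pm_comp_assoc, pm_comp_assoc]; simp
  exact (congrArg (Spl A B o1 o2) (split_eq1 e0 e1)).mpr i3

theorem split_step2 {k : D ⟶ Y} (hk : Good k) {e0 : Elem (D ⋎ H)}
    (ih : ∀ {s}, S (D ⋎ H) (px (px (A ⋏ B) (some (px D Q))) o1) s →
      Spl A B o1 (some (px D Q)) (e0.map s))
    (hH : (comps H).Perm ((A ⋏ B) :: (ocomps o1 ++ ocomps Q)))
    (h1 : (ocomps o2).Perm (comps Y ++ ocomps Q)) :
    ∃ s, S (Y ⋎ H) (px (px (A ⋏ B) o2) o1) s ∧ Spl A B o1 o2 ((e0.map (k ⩖ 𝟙 H)).map s) := by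
  obtain ⟨θ, hθ⟩ := S_ex (F := H) (G := px (px (A ⋏ B) Q) o1) (by
    rw [comps_px, comps_px, comps_nd (NonDisj.conj A B)]
    exact hH.trans ((List.perm_append_comm).cons _))
  obtain ⟨σ, hσ⟩ := OS_ex (o := some (px Y Q)) (o' := o2) (by
    change (comps (px Y Q)).Perm _
    rw [comps_px]; exact h1.symm)
  have i1 := ih (((S.id D).pm hθ).comp ((S.wO D (px (A ⋏ B) Q) o1).comp ((S.vO D (A ⋏ B) Q).pxm o1)))
  have i2 := i1.ctx2 (OHom.some (pxm k Q)) (fun e1 h => ((Good.id B).pm (hk.pxm Q)) none e1 h)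
  have i3 := i2.ctx2 σ (fun e1 h => h.str (S.pxr _ hσ))
  refine ⟨_, ((S.id Y).pm hθ).comp (((S.wO Y (px (A ⋏ B) Q) o1).comp ((S.vO Y (A ⋏ B) Q).pxm o1)).comp ((S.pxr (A ⋏ B) hσ).pxm o1)), ?_⟩
  have e1 : (k ⩖ 𝟙 H) ≫ (𝟙 Y ⩖ θ) ≫ (wO Y (px (A ⋏ B) Q) o1 ≫ pxm (vO Y (A ⋏ B) Q) o1) =
      ((𝟙 D ⩖ θ) ≫ wO D (px (A ⋏ B) Q) o1 ≫ pxm (vO D (A ⋏ B) Q) o1) ≫ pxm (𝟙 _ ⩖ pxm k Q) o1 := by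
    simp only [Category.assoc]
    rw [← pxm_comp, ← vO_nat, pxm_comp, ra (wO_nat k (px (A ⋏ B) Q) o1).symm]
    simp only [Category.assoc]
    rw [pm_comp_assoc, pm_comp_assoc]; simp
  exact (congrArg (Spl A B o1 o2) (split_eq1 e0 e1)).mpr i3
end

theorem lists_split {α : Type*} (p : α → Bool) {LY LH L1 L2 : List α} {X : α}
    (h : (LY ++ LH).Perm (X :: (L2 ++ L1))) (hY : ∀ x ∈ LY, p x = true) (hX : p X = false)
    (h1 : ∀ x ∈ L1, p x = true) (h2 : ∀ x ∈ L2, p x = false) :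
    L1.Perm (LY ++ LH.filter p) ∧ LH.Perm (X :: (L2 ++ LH.filter p)) := by
  have k := h.filter p
  have f1 : LY.filter p = LY := List.filter_eq_self.2 hY
  have f2 : L1.filter p = L1 := List.filter_eq_self.2 h1
  have f3 : L2.filter p = [] := List.filter_eq_nil_iff.2 (by simpa using h2)
  rw [List.filter_append, List.filter_cons, List.filter_append, f1, f2, f3, hX] at k
  simp only [Bool.false_eq_true, if_false, List.nil_append] at k
  refine ⟨k.symm, ?_⟩
  have h3 : (LY ++ LH).Perm (LY ++ (X :: (L2 ++ LH.filter p))) := by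
    refine h.trans ?_
    refine List.Perm.trans ?_ (List.perm_middle.symm)
    refine List.Perm.cons X ?_
    refine ((List.Perm.refl L2).append k.symm).trans ?_
    rw [← List.append_assoc, ← List.append_assoc]
    exact List.perm_append_comm.append_right _
  exact (List.perm_append_left_iff _).1 h3

end PNC

namespace PNC
open CategoryTheory
variable {P : Type}
set_option linter.unusedSimpArgs false

theorem Col.absurd {c : P → Bool} {F : Form P} {Q : Prop} (h : Col c true F) (h' : Col c false F) : Q :=
  (Bool.noConfusion (h.unique h'))

open Classical in
theorem split_step {c : P → Bool} {b : Bool} {D Y H A B : Form P} {o1 o2 : Option (Form P)}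
    {k : D ⟶ Y} (hk : Good k) {e0 : Elem (D ⋎ H)}
    (ih : ∀ {A B : Form P} {o1 o2 : Option (Form P)} {s}, S (D ⋎ H) (px (px (A ⋏ B) o2) o1) s →
      Col c true (px A o1) → Col c false (px B o2) → Spl A B o1 o2 (e0.map s))
    (hY : Col c b Y) (hD : Col c b D)
    (hA : Col c true (px A o1)) (hB : Col c false (px B o2))
    (h : (comps Y ++ comps H).Perm ((A ⋏ B) :: (ocomps o2 ++ ocomps o1))) :
    ∃ s, S (Y ⋎ H) (px (px (A ⋏ B) o2) o1) s ∧ Spl A B o1 o2 ((e0.map (k ⩖ 𝟙 H)).map s) := by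
  have hA' := Col_px.1 hA
  have hB' := Col_px.1 hB
  cases b with
  | true =>
    obtain ⟨k1, k2⟩ := lists_split (fun Z => decide (Col c true Z)) h
      (by simpa using Col_comps.1 hY) (by
        simp only [decide_eq_false_iff_not, Col_conj]
        exact fun h => h.2.absurd hB'.1) (by simpa using hA'.2)
      (by simp only [decide_eq_false_iff_not]; exact fun x hx h => h.absurd (hB'.2 x hx))
    obtain ⟨Q, hQ⟩ := exists_o ((comps H).filter (fun Z => decide (Col c true Z)))
      (fun X hX => mem_comps_nd (List.mem_filter.1 hX).1)
    rw [← hQ] at k1 k2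
    refine split_step1 hk (fun hs => ih hs ?_ hB) k2 k1
    rw [Col_px]
    refine ⟨hA'.1, Col_comps.1 (Col_px.2 ⟨hD, ?_⟩)⟩
    intro X hX
    rw [hQ] at hX
    simpa using (List.mem_filter.1 hX).2
  | false =>
    have h' := h.trans (List.perm_append_comm.cons _)
    obtain ⟨k1, k2⟩ := lists_split (fun Z => decide (Col c false Z)) h'
      (by simpa using Col_comps.1 hY) (by
        simp only [decide_eq_false_iff_not, Col_conj]
        exact fun h => hA'.1.absurd h.1) (by simpa using hB'.2)
      (by simp only [decide_eq_false_iff_not]; exact fun x hx h => (hA'.2 x hx).absurd h)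
    obtain ⟨Q, hQ⟩ := exists_o ((comps H).filter (fun Z => decide (Col c false Z)))
      (fun X hX => mem_comps_nd (List.mem_filter.1 hX).1)
    rw [← hQ] at k1 k2
    refine split_step2 hk (fun hs => ih hs hA ?_) k2 k1
    rw [Col_px]
    refine ⟨hB'.1, Col_comps.1 (Col_px.2 ⟨hD, ?_⟩)⟩
    intro X hX
    rw [hQ] at hX
    simpa using (List.mem_filter.1 hX).2

theorem balanced_tens {A B : Form P} {o1 o2 : Option (Form P)} (h : Balanced (px (px (A ⋏ B) o2) o1)) :
    ∀ a, occ (px A o1) a + occ (px B o2) a ≤ 2 := by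
  intro a
  have := h a
  simp only [occ_px, occ] at *
  omega

open Classical in
theorem splitting {c : P → Bool} {F : Form P} {e : Elem F} (he : Prov F e) : Balanced F →
    ∀ {A B : Form P} {o1 o2 : Option (Form P)} {s}, S F (px (px (A ⋏ B) o2) o1) s →
      Col c true (px A o1) → Col c false (px B o2) → Spl A B o1 o2 (e.map s) := by
  induction he with
  | ax p =>
    intro _ A B o1 o2 s hs _ _
    have := hs.perm.mem_iff (a := A ⋏ B)
    simp [comps_px, comps_nd (NonDisj.conj A B), comps] at this
  | str hs _ ih =>
    intro hb A B o1 o2 t ht hA hB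
    rw [Elem.map_map]
    exact ih (hb.of_perm hs.perm.symm) (hs.comp ht) hA hB
  | @tens A' B' o1' o2' e1' e2' he1 he2 ih1 ih2 =>
    intro hb A B o1 o2 s hs hA hB
    have hA' := Col_px.1 hA
    have hB' := Col_px.1 hB
    have hn := (he1.tens he2).nodup hb
    have hbt := balanced_tens hb
    have hp : ((A' ⋏ B') :: (ocomps o2' ++ ocomps o1')).Perm ((A ⋏ B) :: (ocomps o2 ++ ocomps o1)) := by
      have hp := hs.perm
      simpa only [comps_px, comps_nd (NonDisj.conj _ _), List.cons_append, List.nil_append, List.append_assoc] using hp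
    suffices hsp : ∃ s, S (px (px (A' ⋏ B') o2') o1') (px (px (A ⋏ B) o2) o1) s ∧
        Spl A B o1 o2 ((T e1' e2').map s) by
      obtain ⟨s', h1, h2⟩ := hsp
      rwa [S_unique _ hs h1 hn rfl]
    by_cases hX : A' ⋏ B' = A ⋏ B
    · -- principal case
      cases hX
      have hp' := List.Perm.cons_inv hp
      have hm : ∀ X ∈ ocomps o2 ++ ocomps o1, ∃ b, Col c b X := by
        intro X hX
        rcases List.mem_append.1 hX with h | h
        · exact ⟨_, hB'.2 X h⟩
        · exact ⟨_, hA'.2 X h⟩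
      have hm' : ∀ X ∈ ocomps o2' ++ ocomps o1', ∃ b, Col c b X := fun X hX => hm X (hp'.mem_iff.1 hX)
      obtain ⟨b1, hb1⟩ := he1.conn (c := c) (by
        rw [comps_px, List.forall_mem_append]
        exact ⟨fun X hX => ⟨_, Col_comps.1 hA'.1 X hX⟩, fun X hX => hm' X (List.mem_append_right _ hX)⟩)
      obtain ⟨b2, hb2⟩ := he2.conn (c := c) (by
        rw [comps_px, List.forall_mem_append]
        exact ⟨fun X hX => ⟨_, Col_comps.1 hB'.1 X hX⟩, fun X hX => hm' X (List.mem_append_left _ hX)⟩)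
      rw [Col_px] at hb1 hb2
      obtain rfl := hA'.1.unique hb1.1
      obtain rfl := hB'.1.unique hb2.1
      have f1 := hp'.filter (fun Z => decide (Col c true Z))
      have f2 := hp'.filter (fun Z => decide (Col c false Z))
      have t1 : ∀ o, (∀ X ∈ ocomps o, Col c true X) → (ocomps o).filter (fun Z => decide (Col c true Z)) = ocomps o
        ∧ (ocomps o).filter (fun Z => decide (Col c false Z)) = [] := by
        intro o ho
        refine ⟨List.filter_eq_self.2 (by simpa using ho), List.filter_eq_nil_iff.2 ?_⟩
        intro X hX
        simp only [decide_eq_true_eq]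
        exact fun h => (ho X hX).absurd h
      have t2 : ∀ o, (∀ X ∈ ocomps o, Col c false X) → (ocomps o).filter (fun Z => decide (Col c false Z)) = ocomps o
        ∧ (ocomps o).filter (fun Z => decide (Col c true Z)) = [] := by
        intro o ho
        refine ⟨List.filter_eq_self.2 (by simpa using ho), List.filter_eq_nil_iff.2 ?_⟩
        intro X hX
        simp only [decide_eq_true_eq]
        exact fun h => h.absurd (ho X hX)
      simp only [List.filter_append, (t1 _ hA'.2).1, (t1 _ hA'.2).2, (t1 _ hb1.2).1, (t1 _ hb1.2).2,
        (t2 _ hB'.2).1, (t2 _ hB'.2).2, (t2 _ hb2.2).1, (t2 _ hb2.2).2, List.append_nil, List.nil_append] at f1 f2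
      obtain ⟨σ1, hσ1⟩ := OS_ex f1
      obtain ⟨σ2, hσ2⟩ := OS_ex f2
      refine ⟨_, (S.pxr _ hσ1).comp ((S.pxr _ hσ2).pxm o1), ?_⟩
      have i0 : Spl A' B' o1' o2' (T e1' e2') := ⟨e1', e2', he1, he2, rfl⟩
      have i1 := i0.ctx1 σ1 (fun e1 h => h.str (S.pxr _ hσ1))
      have i2 := i1.ctx2 σ2 (fun e1 h => h.str (S.pxr _ hσ2))
      rwa [Elem.map_map] at i2
    · -- commutation
      have hm : ∀ X ∈ ocomps o2 ++ ocomps o1, ∃ b, Col c b X := by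
        intro X hX
        rcases List.mem_append.1 hX with h | h
        · exact ⟨_, hB'.2 X h⟩
        · exact ⟨_, hA'.2 X h⟩
      have hd : A' ⋏ B' ∈ ocomps o2 ++ ocomps o1 := by
        have : A' ⋏ B' ∈ (A ⋏ B) :: (ocomps o2 ++ ocomps o1) := hp.mem_iff.1 (by simp)
        rcases List.mem_cons.1 this with h | h
        · exact absurd h hX
        · exact h
      obtain ⟨b, hdb⟩ := hm _ hd
      rw [Col_conj] at hdb
      have hX2 : A ⋏ B ∈ ocomps o2' ++ ocomps o1' := by
        have : A ⋏ B ∈ (A' ⋏ B') :: (ocomps o2' ++ ocomps o1') := hp.mem_iff.2 (by simp)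
        rcases List.mem_cons.1 this with h | h
        · exact absurd h.symm hX
        · exact h
      have hn' : (A' ⋏ B' :: (ocomps o2' ++ ocomps o1')).Nodup := by
        simpa [comps_px, comps_nd (NonDisj.conj _ _)] using hn
      have hmem : ∀ X ∈ ocomps o2' ++ ocomps o1', X ≠ A ⋏ B → ∃ b, Col c b X := by
        intro X hX hne
        have : X ∈ (A ⋏ B) :: (ocomps o2 ++ ocomps o1) := hp.mem_iff.1 (List.mem_cons_of_mem _ hX)
        rcases List.mem_cons.1 this with h | h
        · exact absurd h hne
        · exact hm X h
      have hdis := (List.nodup_append'.1 (List.nodup_cons.1 hn').2).2.2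
      rcases List.mem_append.1 hX2 with h2 | h1
      · -- in o2'
        obtain ⟨b1, hb1⟩ := he1.conn (c := c) (by
          rw [comps_px, List.forall_mem_append]
          refine ⟨fun X hX => ⟨_, Col_comps.1 hdb.1 X hX⟩, fun X hX => hmem X (List.mem_append_right _ hX) ?_⟩
          rintro rfl
          exact hdis h2 hX)
        rw [Col_px] at hb1
        obtain rfl := hdb.1.unique hb1.1
        rcases o2' with _ | H
        · simp [ocomps] at h2
        · obtain ⟨s, h3, h4⟩ := split_step (c := c) (b := b) (Y := px (A' ⋏ B') o1') (H := H) (A := A) (B := B) (o1 := o1) (o2 := o2)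
            (Good.lft he1 B') (e0 := e2') (fun hs => ih2 (fun a => by have := hbt a; omega) hs)
            (Col_px.2 ⟨Col_conj.2 hdb, hb1.2⟩) hdb.2 hA hB (by
              rw [comps_px, comps_nd (NonDisj.conj _ _)]
              refine List.Perm.trans ?_ hp
              change (A' ⋏ B' :: (ocomps o1' ++ comps H)).Perm (A' ⋏ B' :: (comps H ++ ocomps o1'))
              exact List.perm_append_comm.cons _)
          refine ⟨swO (A' ⋏ B') (some H) o1' ≫ s, (S.swO _ _ _).comp h3, ?_⟩
          have e : ∀ s : px (px (A' ⋏ B') o1') (some H) ⟶ px (px (A ⋏ B) o2) o1, (T e1' e2').map (swO (A' ⋏ B') (some H) o1' ≫ s) =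
              (e2'.map (pxm (lft e1' B') (some H))).map s := by
            intro s
            rw [T_flip, Elem.map_map, Elem.map_map, Category.assoc, ra (swO_swO _ _ _), Category.id_comp]
          exact (congrArg (Spl A B o1 o2) (e s)).mpr h4
      · -- in o1'
        obtain ⟨b2, hb2⟩ := he2.conn (c := c) (by
          rw [comps_px, List.forall_mem_append]
          refine ⟨fun X hX => ⟨_, Col_comps.1 hdb.2 X hX⟩, fun X hX => hmem X (List.mem_append_left _ hX) ?_⟩
          rintro rfl
          exact hdis hX h1)
        rw [Col_px] at hb2
        obtain rfl := hdb.2.unique hb2.1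
        rcases o1' with _ | H
        · simp [ocomps] at h1
        · have hk : Good (e2'.arr A' ≫ dO A' B' o2') := by
            refine (Good.arr he2 A').comp ?_
            cases o2'
            · exact Good.id _
            · exact Good.dd _ _ _
          exact split_step (c := c) (b := b) (Y := px (A' ⋏ B') o2') (H := H) (A := A) (B := B) (o1 := o1) (o2 := o2)
            hk (e0 := e1') (fun hs => ih1 (fun a => by have := hbt a; omega) hs)
            (Col_px.2 ⟨Col_conj.2 hdb, hb2.2⟩) hdb.1 hA hB (by
              rw [comps_px, comps_nd (NonDisj.conj _ _)]
              refine List.Perm.trans ?_ hp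
              exact List.Perm.refl _)

theorem ax_unique {p : P} {F : Form P} {e : Elem F} (h : Prov F e) :
    ∀ {s}, S F (∼(Form.letter p) ⋎ Form.letter p) s → e.map s = deE (Form.letter p) := by
  induction h with
  | ax q =>
    intro s hs
    have hp := hs.perm
    have : Form.letter q ∈ comps (∼(Form.letter p) ⋎ Form.letter p) := hp.mem_iff.1 (by simp [comps])
    simp [comps] at this
    subst this
    rw [S_unique _ hs (S.id _) (by simp [comps]) rfl, Elem.map_id]
  | str hs _ ih =>
    intro t ht
    rw [Elem.map_map]
    exact ih (hs.comp ht)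
  | @tens A B o1 o2 e1 e2 he1 he2 ih1 ih2 =>
    intro s hs
    have := hs.perm.mem_iff (a := A ⋏ B)
    simp [comps_px, comps_nd (NonDisj.conj A B), comps] at this

theorem Prov.unique {F : Form P} {e : Elem F} (h : Prov F e) :
    Balanced F → ∀ {e'}, Prov F e' → e = e' := by
  classical
  induction h with
  | ax p =>
    intro _ e' h'
    have := ax_unique h' (S.id _)
    rw [Elem.map_id] at this
    exact this.symm
  | @str F G s e hs h ih =>
    intro hb e' h'
    obtain ⟨t, ht, h1, h2⟩ := hs.inv
    rw [ih (hb.of_perm hs.perm.symm) (h'.str ht), Elem.map_map, h2, Elem.map_id]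
  | @tens A B o1 o2 e1 e2 he1 he2 ih1 ih2 =>
    intro hb e' h'
    have hbt := balanced_tens hb
    let c : P → Bool := fun a => decide (0 < occ (px A o1) a)
    have hs := splitting (c := c) h' hb (S.id _) (fun a ha => by simpa [c] using ha) (fun a ha => by
      have h1 := bal_par (px A o1) a
      have h2 := bal_par (px B o2) a
      have h3 := he1.bal a
      have h4 := he2.bal a
      have h5 := hbt a
      simp only [c, decide_eq_false_iff_not]
      omega)
    obtain ⟨f1, f2, k1, k2, hf⟩ := hs
    rw [Elem.map_id] at hf
    rw [hf, ih1 (fun a => by have := hbt a; omega) k1, ih2 (fun a => by have := hbt a; omega) k2]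
end PNC

namespace PNC
open CategoryTheory
variable {P : Type}
set_option linter.unusedSimpArgs false

/-! ## Negation normal forms -/

structure Dual.GoodD {A A' : Form P} (D : Dual A A') : Prop where
  eta : Prov _ D.η
  eps : ∀ H, Good (D.ε.arr H)

namespace Dual.GoodD
variable {A A' B B' : Form P} {D : Dual A A'} {E : Dual B B'}
theorem bd (p : P) : (bd (Form.letter p)).GoodD := ⟨Prov.ax p, fun H => good_si p H⟩
theorem sym (h : D.GoodD) : D.sym.GoodD :=
  ⟨h.eta.str (S.pc _ _), fun H => ((Good.tc _ _).pm (Good.id _)).comp (h.eps H)⟩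
theorem n (h : D.GoodD) (W : Form P) : Good (D.n W) := (Good.dd _ _ _).comp (h.eps W)
theorem q (A : Form P) (h : E.GoodD) : Good (Dual.q A E) :=
  (Good.arr h.eta A).comp (((Good.id _).tm (Good.of_S (S.pc _ _))).comp
    ((Good.dd _ _ _).comp (Good.of_S (S.pc _ _))))
theorem m (h : D.GoodD) (B B' : Form P) : Good (D.m B B') :=
  ((Good.tc _ _).tm (Good.id _)).comp ((Good.ta' _ _ _).comp ((Good.id _).tm (h.n _)))
theorem and (h : D.GoodD) (k : E.GoodD) : (D.and E).GoodD where
  eta := (((Good.id A').pm (k.q A)).comp (Good.of_S (S.pa _ _ _))) none _ h.eta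
  eps H := ((h.m _ _).pm (Good.id _)).comp (k.eps H)
end Dual.GoodD

def tmI {A B C D : Form P} (i : A ≅ B) (j : C ≅ D) : A ⋏ C ≅ B ⋏ D :=
  ⟨i.hom ⩕ j.hom, i.inv ⩕ j.inv, by simp [tm_comp], by simp [tm_comp]⟩
def pmI {A B C D : Form P} (i : A ≅ B) (j : C ≅ D) : A ⋎ C ≅ B ⋎ D :=
  ⟨i.hom ⩖ j.hom, i.inv ⩖ j.inv, by simp [pm_comp], by simp [pm_comp]⟩

structure NF (A : Form P) where
  p : Form P
  m : Form P
  ip : A ≅ p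
  im : ∼A ≅ m
  D : Dual p m
  good : D.GoodD
  op : ∀ a, occ p a = occ A a
  om : ∀ a, occ m a = occ A a
  hη : (bd A).η.map (im.hom ⩖ ip.hom) = D.η
  hε : D.ε.comap (ip.hom ⩕ im.hom) = (bd A).ε

noncomputable def NF.mk' {A p m : Form P} (ip : A ≅ p) (D : Dual p m) (good : D.GoodD)
    (op : ∀ a, occ p a = occ A a) (om : ∀ a, occ m a = occ A a) : NF A where
  p := p
  m := m
  ip := ip
  im := (Dual.iso_exists (bd A) D ip).choose
  D := D
  good := good
  op := op
  om := om
  hη := (Dual.iso_exists (bd A) D ip).choose_spec.1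
  hε := (Dual.iso_exists (bd A) D ip).choose_spec.2

noncomputable def nf : (A : Form P) → NF A
  | .letter p => NF.mk' (Iso.refl _) (bd (Form.letter p)) (.bd p) (fun _ => rfl) (fun _ => rfl)
  | .neg A => NF.mk' (nf A).im (nf A).D.sym (nf A).good.sym (nf A).om (nf A).op
  | .conj A B => NF.mk' (tmI (nf A).ip (nf B).ip) ((nf A).D.and (nf B).D)
      ((nf A).good.and (nf B).good)
      (fun a => by simp only [occ, (nf A).op, (nf B).op]) (fun a => by simp only [occ, (nf A).om, (nf B).om])
  | .disj A B => NF.mk' (pmI (nf A).ip (nf B).ip) ((nf A).D.sym.and (nf B).D.sym).sym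
      ((nf A).good.sym.and (nf B).good.sym).sym
      (fun a => by simp only [occ, (nf A).op, (nf B).op]) (fun a => by simp only [occ, (nf A).om, (nf B).om])

theorem tm_sq {A B C D A' B' C' D' : Form P} {a : A ⟶ B} {b : B ⟶ D} {c : A ⟶ C} {d : C ⟶ D}
    {a' : A' ⟶ B'} {b' : B' ⟶ D'} {c' : A' ⟶ C'} {d' : C' ⟶ D'}
    (h : a ≫ b = c ≫ d) (h' : a' ≫ b' = c' ≫ d') :
    (a ⩕ a') ≫ (b ⩕ b') = (c ⩕ c') ≫ (d ⩕ d') := by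
  rw [tm_comp, tm_comp, h, h']

theorem pm_sq {A B C D A' B' C' D' : Form P} {a : A ⟶ B} {b : B ⟶ D} {c : A ⟶ C} {d : C ⟶ D}
    {a' : A' ⟶ B'} {b' : B' ⟶ D'} {c' : A' ⟶ C'} {d' : C' ⟶ D'}
    (h : a ≫ b = c ≫ d) (h' : a' ≫ b' = c' ≫ d') :
    (a ⩖ a') ≫ (b ⩖ b') = (c ⩖ c') ≫ (d ⩖ d') := by
  rw [pm_comp, pm_comp, h, h']

def Nice {A B : Form P} (f : A ⟶ B) : Prop :=
  ∃ g : (nf A).p ⟶ (nf B).p, Good g ∧ f ≫ (nf B).ip.hom = (nf A).ip.hom ≫ g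

theorem nice (A B : Form P) (f : Term P A B) : Nice (mk f) := by
  induction f with
  | id A => exact ⟨𝟙 _, Good.id _, by rw [mk_id]; simp⟩
  | comp g f hg hf =>
    obtain ⟨g', h1, h2⟩ := hg
    obtain ⟨f', h3, h4⟩ := hf
    exact ⟨f' ≫ g', h3.comp h1, by rw [mk_comp, Category.assoc, h2, ra h4, Category.assoc]⟩
  | conj f g hf hg =>
    obtain ⟨g', h1, h2⟩ := hg
    obtain ⟨f', h3, h4⟩ := hf
    exact ⟨f' ⩕ g', h3.tm h1, tm_sq h4 h2⟩
  | disj f g hf hg =>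
    obtain ⟨g', h1, h2⟩ := hg
    obtain ⟨f', h3, h4⟩ := hf
    exact ⟨f' ⩖ g', h3.pm h1, pm_sq h4 h2⟩
  | bConjTo A B C => exact ⟨ta _ _ _, Good.ta _ _ _, (ta_nat _ _ _).symm⟩
  | bConjFrom A B C => exact ⟨ta' _ _ _, Good.ta' _ _ _, (ta'_nat _ _ _).symm⟩
  | bDisjTo A B C => exact ⟨pa _ _ _, Good.of_S (S.pa _ _ _), (pa_nat _ _ _).symm⟩
  | bDisjFrom A B C => exact ⟨pa' _ _ _, Good.of_S (S.pa' _ _ _), (pa'_nat _ _ _).symm⟩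
  | cConj A B => exact ⟨tc _ _, Good.tc _ _, (tc_nat _ _).symm⟩
  | cDisj A B => exact ⟨pc _ _, Good.of_S (S.pc _ _), (pc_nat _ _).symm⟩
  | d A B C => exact ⟨dd _ _ _, Good.dd _ _ _, (dd_nat _ _ _).symm⟩
  | delta B A =>
    refine ⟨(nf B).D.η.arr _, Good.arr (nf B).good.eta _, ?_⟩
    have : ∀ {X Y : Form P} (f : X ⟶ Y), de B X ≫ (f ⩕ ((nf B).im.hom ⩖ (nf B).ip.hom)) =
        f ≫ (nf B).D.η.arr Y := by
      intro X Y f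
      have h1 : (bd B).η.arr X = de B X := rfl
      rw [← h1, Elem.nat, ← (nf B).hη, Elem.map_arr, Category.assoc, tm_comp]
      simp
    exact this _
  | sigma B A =>
    refine ⟨(nf B).D.ε.arr _, (nf B).good.eps _, ?_⟩
    have : ∀ {X Y : Form P} (f : X ⟶ Y), si B X ≫ f =
      (((nf B).ip.hom ⩕ (nf B).im.hom) ⩖ f) ≫ (nf B).D.ε.arr Y := by
      intro X Y f
      have h1 : (bd B).ε.arr X = si B X := rfl
      rw [← h1, ← Coelem.nat, ← (nf B).hε, Coelem.comap_arr, pm_comp_assoc]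
      simp
    exact this _

theorem balanced_eq {A B : Form P} (f g : A ⟶ B) (h : ∀ a, occ A a + occ B a ≤ 2) : f = g := by
  obtain ⟨f, rfl⟩ := mk_surj f
  obtain ⟨g, rfl⟩ := mk_surj g
  obtain ⟨f', h1, h2⟩ := nice _ _ f
  obtain ⟨g', h3, h4⟩ := nice _ _ g
  have h5 : f' = g' := by
    apply (nf A).D.η_inj
    have k := (nf A).good.eta
    exact ((Good.id _).pm h1 none _ k).unique
      (fun a => by simp only [px, occ, (nf A).om, (nf B).op]; exact h a) ((Good.id _).pm h3 none _ k)
  rw [← Iso.eq_comp_inv] at h2 h4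
  rw [h2, h4, h5]
end PNC

namespace PNC
open CategoryTheory
variable {P Q K : Type}
set_option linter.unusedSimpArgs false

/-! ## Renaming letters -/

def fmap (φ : Q → P) : Form Q → Form P
  | .letter q => .letter (φ q)
  | .neg A => ∼(fmap φ A)
  | .conj A B => fmap φ A ⋏ fmap φ B
  | .disj A B => fmap φ A ⋎ fmap φ B

def tmap (φ : Q → P) : ∀ {A B : Form Q}, Term Q A B → Term P (fmap φ A) (fmap φ B)
  | _, _, .id A => .id _
  | _, _, .comp g f => .comp (tmap φ g) (tmap φ f)
  | _, _, .conj g f => .conj (tmap φ g) (tmap φ f)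
  | _, _, .disj g f => .disj (tmap φ g) (tmap φ f)
  | _, _, .bConjTo A B C => .bConjTo _ _ _
  | _, _, .bConjFrom A B C => .bConjFrom _ _ _
  | _, _, .bDisjTo A B C => .bDisjTo _ _ _
  | _, _, .bDisjFrom A B C => .bDisjFrom _ _ _
  | _, _, .cConj A B => .cConj _ _
  | _, _, .cDisj A B => .cDisj _ _
  | _, _, .d A B C => .d _ _ _
  | _, _, .delta B A => .delta _ _
  | _, _, .sigma B A => .sigma _ _

theorem Eqv_tmap (φ : Q → P) {A B : Form Q} {f g : Term Q A B} (h : Eqv f g) :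
    Eqv (tmap φ f) (tmap φ g) := by
  induction h with
  | symm _ h => exact h.symm
  | trans _ _ h h' => exact h.trans h'
  | congComp _ _ h h' => exact .congComp h h'
  | congConj _ _ h h' => exact .congConj h h'
  | congDisj _ _ h h' => exact .congDisj h h'
  | refl => exact .refl _
  | catIdR => exact .catIdR _
  | catIdL => exact .catIdL _
  | catAssoc => exact .catAssoc _ _ _
  | conjOne => exact .conjOne _ _
  | disjOne => exact .disjOne _ _
  | conjTwo => exact .conjTwo _ _ _ _
  | disjTwo => exact .disjTwo _ _ _ _
  | bConjNat => exact .bConjNat _ _ _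
  | bDisjNat => exact .bDisjNat _ _ _
  | cConjNat => exact .cConjNat _ _
  | cDisjNat => exact .cDisjNat _ _
  | dNat => exact .dNat _ _ _
  | bConjIso₁ => exact .bConjIso₁ _ _ _
  | bConjIso₂ => exact .bConjIso₂ _ _ _
  | bDisjIso₁ => exact .bDisjIso₁ _ _ _
  | bDisjIso₂ => exact .bDisjIso₂ _ _ _
  | bConjPent => exact .bConjPent _ _ _ _
  | bDisjPent => exact .bDisjPent _ _ _ _
  | cConjIso => exact .cConjIso _ _
  | cDisjIso => exact .cDisjIso _ _
  | bcConj => exact .bcConj _ _ _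
  | bcDisj => exact .bcDisj _ _ _
  | dConj => exact .dConj _ _ _ _
  | dDisj => exact .dDisj _ _ _ _
  | dBConj => exact .dBConj _ _ _ _
  | dBDisj => exact .dBDisj _ _ _ _
  | deltaNat => exact .deltaNat _ _
  | sigmaNat => exact .sigmaNat _ _
  | bDelta => exact .bDelta _ _ _
  | bSigma => exact .bSigma _ _ _
  | dSigmaConj => exact .dSigmaConj _ _ _
  | dDeltaDisj => exact .dDeltaDisj _ _ _
  | sigmaDelta => exact .sigmaDelta _
  | sigmaDelta' => exact .sigmaDelta' _

/-- `f'` is sent to `f` by the renaming. -/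
def Lifts (φ : Q → P) {A' B' : Form Q} {A B : Form P} (f' : Term Q A' B') (f : Term P A B) : Prop :=
  fmap φ A' = A ∧ fmap φ B' = B ∧ HEq (tmap φ f') f

theorem Lifts.eqv {φ : Q → P} {A' B' : Form Q} {A B : Form P} {f' g' : Term Q A' B'}
    {f g : Term P A B} (hf : Lifts φ f' f) (hg : Lifts φ g' g) (h : Eqv f' g') : Eqv f g := by
  obtain ⟨rfl, rfl, hf⟩ := hf
  obtain ⟨_, _, hg⟩ := hg
  rw [← eq_of_heq hf, ← eq_of_heq hg]
  exact Eqv_tmap φ h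

theorem Lifts.comp {φ : Q → P} {A' B' C' : Form Q} {A B C : Form P} {f' : Term Q A' B'}
    {g' : Term Q B' C'} {f : Term P A B} {g : Term P B C} (hf : Lifts φ f' f) (hg : Lifts φ g' g) :
    Lifts φ (g' ⬝ f') (g ⬝ f) := by
  obtain ⟨rfl, rfl, hf⟩ := hf
  obtain ⟨_, rfl, hg⟩ := hg
  rw [← eq_of_heq hf, ← eq_of_heq hg]
  exact ⟨rfl, rfl, HEq.rfl⟩
theorem Lifts.conj {φ : Q → P} {A' B' C' D' : Form Q} {A B C D : Form P} {f' : Term Q A' B'}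
    {g' : Term Q C' D'} {f : Term P A B} {g : Term P C D} (hf : Lifts φ f' f) (hg : Lifts φ g' g) :
    Lifts φ (f' ⊼ g') (f ⊼ g) := by
  obtain ⟨rfl, rfl, hf⟩ := hf
  obtain ⟨rfl, rfl, hg⟩ := hg
  rw [← eq_of_heq hf, ← eq_of_heq hg]
  exact ⟨rfl, rfl, HEq.rfl⟩
theorem Lifts.disj {φ : Q → P} {A' B' C' D' : Form Q} {A B C D : Form P} {f' : Term Q A' B'}
    {g' : Term Q C' D'} {f : Term P A B} {g : Term P C D} (hf : Lifts φ f' f) (hg : Lifts φ g' g) :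
    Lifts φ (f' ⊽ g') (f ⊽ g) := by
  obtain ⟨rfl, rfl, hf⟩ := hf
  obtain ⟨rfl, rfl, hg⟩ := hg
  rw [← eq_of_heq hf, ← eq_of_heq hg]
  exact ⟨rfl, rfl, HEq.rfl⟩

/-! ## Labelling letter occurrences -/

def lab (l : ℕ → K) : Form P → Form (P × K)
  | .letter p => .letter (p, l 0)
  | .neg A => ∼(lab l A)
  | .conj A B => lab l A ⋏ lab (fun i => l (A.size + i)) B
  | .disj A B => lab l A ⋎ lab (fun i => l (A.size + i)) B

theorem fmap_lab (l : ℕ → K) (A : Form P) : fmap Prod.fst (lab l A) = A := by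
  induction A generalizing l <;> simp_all [fmap, lab]

theorem lab_congr {l k : ℕ → K} (A : Form P) (h : ∀ i < A.size, l i = k i) : lab l A = lab k A := by
  induction A generalizing l k with
  | letter p => simp [lab, h 0 (by simp [Form.size])]
  | neg A ih => simp [lab, ih h]
  | conj A B iA iB =>
    simp only [Form.size] at h
    simp only [lab]
    rw [iA fun i hi => h i (by omega), iB fun i hi => h _ (by omega)]
  | disj A B iA iB =>
    simp only [Form.size] at h
    simp only [lab]
    rw [iA fun i hi => h i (by omega), iB fun i hi => h _ (by omega)]

def SymR {α : Type} (R : α → α → Prop) : Prop := ∀ ⦃x y⦄, R x y → R y x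

theorem SymR.transGen {α : Type} {R : α → α → Prop} (h : SymR R) : SymR (Relation.TransGen R) := by
  intro x y hxy
  induction hxy with
  | single hh => exact .single (h hh)
  | tail _ hh ih => exact ih.head (h hh)

def Compat (R : GRel) (l k : ℕ → K) : Prop := ∀ x y, R x y → Sum.elim l k x = Sum.elim l k y

theorem Compat.idn {n : ℕ} {l k : ℕ → K} (h : Compat (gId n) l k) : ∀ i < n, k i = l i :=
  fun i hi => h (Sum.inr i) (Sum.inl i) ⟨i, hi, .inr rfl, .inl rfl⟩

theorem Compat.swap {a b : ℕ} {l k : ℕ → K} (h : Compat (gSwap a b) l k) :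
    (∀ i < a, k (b + i) = l i) ∧ (∀ i < b, k i = l (a + i)) := by
  constructor
  · intro i hi
    exact h (Sum.inr (b + i)) (Sum.inl i) ⟨i, by omega, .inr (by simp [hi, Nat.add_comm]), .inl rfl⟩
  · intro i hi
    exact h (Sum.inr i) (Sum.inl (a + i)) ⟨a + i, by omega, .inr (by simp), .inl rfl⟩

theorem Compat.par {a d : ℕ} {R S : GRel} {l k : ℕ → K} (h : Compat (gPar a d R S) l k) :
    Compat R l k ∧ Compat S (fun i => l (a + i)) (fun i => k (d + i)) := by
  refine ⟨fun x y hr => h x y (.inl hr), fun x y hr => ?_⟩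
  have := h _ _ (.inr ⟨x, y, hr, rfl, rfl⟩)
  rcases x with x | x <;> rcases y with y | y <;> simpa [Nat.add_comm] using this

theorem Compat.comp [Nonempty K] {R S : GRel} (hR : SymR R) (hS : SymR S) {l k : ℕ → K}
    (h : Compat (gComp S R) l k) : ∃ m, Compat R l m ∧ Compat S m k := by
  classical
  obtain ⟨k0⟩ := ‹Nonempty K›
  let E : ℕ ⊕ ℕ ⊕ ℕ → ℕ ⊕ ℕ ⊕ ℕ → Prop := fun x y =>
      (∃ x' y', Sum.map id Sum.inl x' = x ∧ Sum.map id Sum.inl y' = y ∧ R x' y') ∨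
      (∃ x' y', Sum.inr x' = x ∧ Sum.inr y' = y ∧ S x' y')
  have hE : SymR E := by
    rintro x y (⟨x', y', h1, h2, h3⟩ | ⟨x', y', h1, h2, h3⟩)
    · exact .inl ⟨y', x', h2, h1, hR h3⟩
    · exact .inr ⟨y', x', h2, h1, hS h3⟩
  have hT : SymR (Relation.TransGen E) := SymR.transGen hE
  let out : ℕ ⊕ ℕ → ℕ ⊕ ℕ ⊕ ℕ := Sum.map id Sum.inr
  let m : ℕ ⊕ ℕ ⊕ ℕ → K := fun v =>
    if hv : ∃ x, Relation.TransGen E (out x) v then Sum.elim l k hv.choose else k0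
  have h0 : ∀ x y, Relation.TransGen E (out x) (out y) → Sum.elim l k x = Sum.elim l k y := h
  let M : ℕ ⊕ ℕ ⊕ ℕ → K := Sum.elim l (Sum.elim (fun i => m (Sum.inr (Sum.inl i))) k)
  have hMo : ∀ x, M (out x) = Sum.elim l k x := by rintro (x | x) <;> rfl
  have hmm : ∀ x v, Relation.TransGen E (out x) v → m v = Sum.elim l k x := by
    intro x v hx
    have hv : ∃ x, Relation.TransGen E (out x) v := ⟨x, hx⟩
    simp only [m, dif_pos hv]
    exact h0 _ _ (hv.choose_spec.trans (hT hx))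
  have hMm : ∀ x v, Relation.TransGen E (out x) v → M v = Sum.elim l k x := by
    intro x v hx
    rcases v with v | v | v
    · exact (h0 x (Sum.inl v) hx).symm
    · exact hmm x _ hx
    · exact (h0 x (Sum.inr v) hx).symm
  have key : ∀ u v, E u v → M u = M v := by
    intro u v huv
    by_cases hu : ∃ x, Relation.TransGen E (out x) u
    · obtain ⟨x, hx⟩ := hu
      rw [hMm x u hx, hMm x v (hx.tail huv)]
    · have hv : ¬ ∃ x, Relation.TransGen E (out x) v := by
        rintro ⟨x, hx⟩
        exact hu ⟨x, hx.tail (hE huv)⟩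
      have ho : ∀ x, u ≠ out x := by
        rintro x rfl
        exact hv ⟨x, .single huv⟩
      have ho' : ∀ x, v ≠ out x := by
        rintro x rfl
        exact hu ⟨x, .single (hE huv)⟩
      rcases u with u | u | u
      · exact (ho (Sum.inl u) rfl).elim
      · rcases v with v | v | v
        · exact (ho' (Sum.inl v) rfl).elim
        · simp only [M, Sum.elim_inr, Sum.elim_inl, m, dif_neg hu, dif_neg hv]
        · exact (ho' (Sum.inr v) rfl).elim
      · exact (ho (Sum.inr u) rfl).elim
  refine ⟨fun i => m (Sum.inr (Sum.inl i)), ?_, ?_⟩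
  · intro x y hxy
    have := key _ _ (.inl ⟨x, y, rfl, rfl, hxy⟩)
    rcases x with x | x <;> rcases y with y | y <;> exact this
  · intro x y hxy
    have := key _ _ (.inr ⟨x, y, rfl, rfl, hxy⟩)
    rcases x with x | x <;> rcases y with y | y <;> exact this

theorem G_symm {A B : Form P} (f : Term P A B) : SymR (Term.G f) := by
  induction f with
  | comp g f hg hf =>
    intro u v
    apply SymR.transGen
    rintro x y (⟨x', y', h1, h2, h3⟩ | ⟨x', y', h1, h2, h3⟩)
    · exact .inl ⟨y', x', h2, h1, hf h3⟩
    · exact .inr ⟨y', x', h2, h1, hg h3⟩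
  | conj f g hf hg =>
    rintro x y (h | ⟨u, v, h1, h2, h3⟩)
    · exact .inl (hf h)
    · exact .inr ⟨v, u, hg h1, h3, h2⟩
  | disj f g hf hg =>
    rintro x y (h | ⟨u, v, h1, h2, h3⟩)
    · exact .inl (hf h)
    · exact .inr ⟨v, u, hg h1, h3, h2⟩
  | delta B A =>
    rintro x y (⟨i, h1, h2, h3⟩ | ⟨i, h1, h2, h3⟩)
    · exact .inl ⟨i, h1, h3, h2⟩
    · exact .inr ⟨i, h1, h3, h2⟩
  | sigma B A =>
    rintro x y (⟨i, h1, h2, h3⟩ | ⟨i, h1, h2, h3⟩)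
    · exact .inl ⟨i, h1, h3, h2⟩
    · exact .inr ⟨i, h1, h3, h2⟩
  | _ =>
    rintro x y ⟨i, h1, h2, h3⟩
    exact ⟨i, h1, h3, h2⟩

theorem lift_exists [Nonempty K] {A B : Form P} (f : Term P A B) (l k : ℕ → K)
    (h : Compat (Term.G f) l k) : ∃ f' : Term (P × K) (lab l A) (lab k B), Lifts Prod.fst f' f := by
  induction f generalizing l k with
  | id A =>
    rw [lab_congr A h.idn]
    exact ⟨.id _, fmap_lab _ _, fmap_lab _ _, by rw [tmap, fmap_lab]⟩
  | comp g f hg hf =>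
    obtain ⟨m, h1, h2⟩ := Compat.comp (G_symm f) (G_symm g) h
    obtain ⟨f', h3⟩ := hf _ _ h1
    obtain ⟨g', h4⟩ := hg _ _ h2
    exact ⟨_, h3.comp h4⟩
  | conj f g hf hg =>
    obtain ⟨h1, h2⟩ := Compat.par h
    obtain ⟨f', h3⟩ := hf _ _ h1
    obtain ⟨g', h4⟩ := hg _ _ h2
    exact ⟨_, h3.conj h4⟩
  | disj f g hf hg =>
    obtain ⟨h1, h2⟩ := Compat.par h
    obtain ⟨f', h3⟩ := hf _ _ h1
    obtain ⟨g', h4⟩ := hg _ _ h2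
    exact ⟨_, h3.disj h4⟩
  | bConjTo A B C =>
    rw [lab_congr _ fun i hi => h.idn i (by simp only [Form.size] at hi; omega)]
    have h0 : lab (fun i => l (A.size + B.size + i)) C = lab (fun i => l (A.size + (B.size + i))) C := by
      simp only [Nat.add_assoc]
    simp only [lab, Form.size]
    rw [h0]
    have key : ∀ (A' B' C' : Form (P × K)), fmap Prod.fst A' = A → fmap Prod.fst B' = B → fmap Prod.fst C' = C →
        Lifts Prod.fst (Term.bConjTo A' B' C') (Term.bConjTo A B C) := by
      rintro _ _ _ rfl rfl rfl
      exact ⟨rfl, rfl, HEq.rfl⟩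
    exact ⟨_, key _ _ _ (fmap_lab _ _) (fmap_lab _ _) (fmap_lab _ _)⟩
  | bConjFrom A B C =>
    rw [lab_congr _ fun i hi => h.idn i (by simp only [Form.size] at hi; omega)]
    have h0 : lab (fun i => l (A.size + B.size + i)) C = lab (fun i => l (A.size + (B.size + i))) C := by
      simp only [Nat.add_assoc]
    simp only [lab, Form.size]
    rw [h0]
    have key : ∀ (A' B' C' : Form (P × K)), fmap Prod.fst A' = A → fmap Prod.fst B' = B → fmap Prod.fst C' = C →
        Lifts Prod.fst (Term.bConjFrom A' B' C') (Term.bConjFrom A B C) := by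
      rintro _ _ _ rfl rfl rfl
      exact ⟨rfl, rfl, HEq.rfl⟩
    exact ⟨_, key _ _ _ (fmap_lab _ _) (fmap_lab _ _) (fmap_lab _ _)⟩
  | bDisjTo A B C =>
    rw [lab_congr _ fun i hi => h.idn i (by simp only [Form.size] at hi; omega)]
    have h0 : lab (fun i => l (A.size + B.size + i)) C = lab (fun i => l (A.size + (B.size + i))) C := by
      simp only [Nat.add_assoc]
    simp only [lab, Form.size]
    rw [h0]
    have key : ∀ (A' B' C' : Form (P × K)), fmap Prod.fst A' = A → fmap Prod.fst B' = B → fmap Prod.fst C' = C →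
        Lifts Prod.fst (Term.bDisjTo A' B' C') (Term.bDisjTo A B C) := by
      rintro _ _ _ rfl rfl rfl
      exact ⟨rfl, rfl, HEq.rfl⟩
    exact ⟨_, key _ _ _ (fmap_lab _ _) (fmap_lab _ _) (fmap_lab _ _)⟩
  | bDisjFrom A B C =>
    rw [lab_congr _ fun i hi => h.idn i (by simp only [Form.size] at hi; omega)]
    have h0 : lab (fun i => l (A.size + B.size + i)) C = lab (fun i => l (A.size + (B.size + i))) C := by
      simp only [Nat.add_assoc]
    simp only [lab, Form.size]
    rw [h0]
    have key : ∀ (A' B' C' : Form (P × K)), fmap Prod.fst A' = A → fmap Prod.fst B' = B → fmap Prod.fst C' = C →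
        Lifts Prod.fst (Term.bDisjFrom A' B' C') (Term.bDisjFrom A B C) := by
      rintro _ _ _ rfl rfl rfl
      exact ⟨rfl, rfl, HEq.rfl⟩
    exact ⟨_, key _ _ _ (fmap_lab _ _) (fmap_lab _ _) (fmap_lab _ _)⟩
  | d A B C =>
    rw [lab_congr _ fun i hi => h.idn i (by simp only [Form.size] at hi; omega)]
    have h0 : lab (fun i => l (A.size + B.size + i)) C = lab (fun i => l (A.size + (B.size + i))) C := by
      simp only [Nat.add_assoc]
    simp only [lab, Form.size]
    rw [h0]
    have key : ∀ (A' B' C' : Form (P × K)), fmap Prod.fst A' = A → fmap Prod.fst B' = B → fmap Prod.fst C' = C →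
        Lifts Prod.fst (Term.d A' B' C') (Term.d A B C) := by
      rintro _ _ _ rfl rfl rfl
      exact ⟨rfl, rfl, HEq.rfl⟩
    exact ⟨_, key _ _ _ (fmap_lab _ _) (fmap_lab _ _) (fmap_lab _ _)⟩
  | cConj A B =>
    obtain ⟨h1, h2⟩ := Compat.swap h
    simp only [lab]
    rw [lab_congr A h1, lab_congr B h2]
    have key : ∀ (A' B' : Form (P × K)), fmap Prod.fst A' = A → fmap Prod.fst B' = B →
        Lifts Prod.fst (Term.cConj A' B') (Term.cConj A B) := by
      rintro _ _ rfl rfl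
      exact ⟨rfl, rfl, HEq.rfl⟩
    exact ⟨_, key _ _ (fmap_lab _ _) (fmap_lab _ _)⟩
  | cDisj A B =>
    obtain ⟨h1, h2⟩ := Compat.swap h
    simp only [lab]
    rw [lab_congr B h1, lab_congr A h2]
    have key : ∀ (A' B' : Form (P × K)), fmap Prod.fst A' = A → fmap Prod.fst B' = B →
        Lifts Prod.fst (Term.cDisj A' B') (Term.cDisj A B) := by
      rintro _ _ rfl rfl
      exact ⟨rfl, rfl, HEq.rfl⟩
    exact ⟨_, key _ _ (fmap_lab _ _) (fmap_lab _ _)⟩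
  | delta B A =>
    have h1 : ∀ i < A.size, k i = l i := fun i hi =>
      h (Sum.inr i) (Sum.inl i) (.inl ⟨i, hi, .inr rfl, .inl rfl⟩)
    have h2 : ∀ j < B.size, k (A.size + (B.size + j)) = k (A.size + j) := fun j hj =>
      h (Sum.inr _) (Sum.inr _) (.inr ⟨j, hj, .inr (by rw [Nat.add_assoc]), .inl rfl⟩)
    simp only [lab, Form.size]
    rw [lab_congr A h1, lab_congr B h2]
    have key : ∀ (A' B' : Form (P × K)), fmap Prod.fst A' = B → fmap Prod.fst B' = A →
        Lifts Prod.fst (Term.delta A' B') (Term.delta B A) := by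
      rintro _ _ rfl rfl
      exact ⟨rfl, rfl, HEq.rfl⟩
    exact ⟨_, key _ _ (fmap_lab _ _) (fmap_lab _ _)⟩
  | sigma B A =>
    have h1 : ∀ i < A.size, k i = l (B.size + B.size + i) := fun i hi =>
      h (Sum.inr i) (Sum.inl _) (.inl ⟨i, hi, .inr rfl, .inl (by rw [Nat.two_mul])⟩)
    have h2 : ∀ j < B.size, l (B.size + j) = l j := fun j hj =>
      h (Sum.inl _) (Sum.inl _) (.inr ⟨j, hj, .inr rfl, .inl rfl⟩)
    simp only [lab, Form.size]
    rw [lab_congr A h1, lab_congr B h2]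
    have key : ∀ (A' B' : Form (P × K)), fmap Prod.fst A' = B → fmap Prod.fst B' = A →
        Lifts Prod.fst (Term.sigma A' B') (Term.sigma B A) := by
      rintro _ _ rfl rfl
      exact ⟨rfl, rfl, HEq.rfl⟩
    exact ⟨_, key _ _ (fmap_lab _ _) (fmap_lab _ _)⟩
end PNC

namespace PNC
open CategoryTheory
variable {P K : Type}
set_option linter.unusedSimpArgs false

/-! ## Classes of `G f` have at most two elements -/

theorem int_three {d a b : ℤ} (ha : d ∣ 2 * a ∨ d ∣ 2 * a - 1) (hb : d ∣ 2 * b ∨ d ∣ 2 * b - 1) :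
    d ∣ a ∨ d ∣ b ∨ d ∣ a - b := by
  have cop : ∀ {c : ℤ}, d ∣ 2 * c - 1 → IsCoprime d 2 := by
    rintro c ⟨u, hu⟩
    exact ⟨-u, c, by linarith⟩
  rcases ha with ha | ha <;> rcases hb with hb | hb
  · obtain ⟨u, hu⟩ := ha
    obtain ⟨v, hv⟩ := hb
    rcases Int.even_or_odd' u with ⟨u', rfl | rfl⟩
    · exact .inl ⟨u', by linarith⟩
    · rcases Int.even_or_odd' v with ⟨v', rfl | rfl⟩
      · exact .inr (.inl ⟨v', by linarith⟩)
      · exact .inr (.inr ⟨u' - v', by linarith⟩)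
  · exact .inl ((cop hb).dvd_of_dvd_mul_left ha)
  · exact .inr (.inl ((cop ha).dvd_of_dvd_mul_left hb))
  · refine .inr (.inr ((cop ha).dvd_of_dvd_mul_left ?_))
    have := dvd_sub ha hb
    rwa [show 2 * a - 1 - (2 * b - 1) = 2 * (a - b) by ring] at this

section
variable {N : Type}

theorem t_zpow (s t : Equiv.Perm N) (hs : s * s = 1) (ht : t * t = 1)
    (n : ℤ) (x : N) (hx : t x = x) : t (((s * t) ^ n) x) = ((s * t) ^ (-n)) x := by
  have h : SemiconjBy t (s * t) (s * t)⁻¹ := by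
    have h1 : s⁻¹ = s := inv_eq_of_mul_eq_one_left hs
    rw [SemiconjBy, mul_inv_rev, inv_eq_of_mul_eq_one_left ht, h1, mul_assoc]
  have h2 := (h.zpow_right n).eq
  rw [inv_zpow'] at h2
  have h3 := congrArg (fun p : Equiv.Perm N => p x) h2
  simpa [hx] using h3

theorem s_zpow (s t : Equiv.Perm N) (hs : s * s = 1) (ht : t * t = 1)
    (n : ℤ) (x : N) (hx : t x = x) : s (((s * t) ^ n) x) = ((s * t) ^ (1 - n)) x := by
  have h : s = (s * t) * t := by rw [mul_assoc, ht, mul_one]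
  have h1 : s (((s * t) ^ n) x) = (s * t) (t (((s * t) ^ n) x)) := by
    conv_lhs => rw [h]
    rw [Equiv.Perm.mul_apply, mul_assoc, ht, mul_one]
  rw [h1, t_zpow s t hs ht n x hx, ← Equiv.Perm.mul_apply, ← zpow_one_add]
  congr 2

theorem orbit (s t : Equiv.Perm N) (hs : s * s = 1) (ht : t * t = 1)
    {E : N → N → Prop} (hE : ∀ u v, E u v → v = u ∨ v = s u ∨ v = t u) {x y : N}
    (hx : t x = x) (h : Relation.TransGen E x y) : ∃ n : ℤ, y = ((s * t) ^ n) x := by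
  have step : ∀ (n : ℤ) v, E (((s * t) ^ n) x) v → ∃ n : ℤ, v = ((s * t) ^ n) x := by
    intro n v hv
    rcases hE _ _ hv with h | h | h
    · exact ⟨n, h⟩
    · exact ⟨1 - n, h.trans (s_zpow s t hs ht n x hx)⟩
    · exact ⟨-n, h.trans (t_zpow s t hs ht n x hx)⟩
  induction h with
  | single h => exact step 0 _ (by simpa using h)
  | tail _ h ih =>
    obtain ⟨n, rfl⟩ := ih
    exact step n _ h

theorem three' (s t : Equiv.Perm N) (hs : s * s = 1) (ht : t * t = 1)
    {E : N → N → Prop} (hE : ∀ u v, E u v → v = u ∨ v = s u ∨ v = t u) {x y z : N}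
    (hx : t x = x) (hy : s y = y ∨ t y = y) (hz : s z = z ∨ t z = z)
    (h1 : Relation.TransGen E x y) (h2 : Relation.TransGen E x z) : x = y ∨ x = z ∨ y = z := by
  obtain ⟨a, rfl⟩ := orbit s t hs ht hE hx h1
  obtain ⟨b, rfl⟩ := orbit s t hs ht hE hx h2
  have key : ∀ n : ℤ, ((s * t) ^ n) x = x ↔
      (Function.minimalPeriod (fun y => (s * t) • y) x : ℤ) ∣ n := fun n => by
    rw [← MulAction.zpow_smul_eq_iff_minimalPeriod_dvd]; rfl
  have two : ∀ m n : ℤ, ((s * t) ^ m) x = ((s * t) ^ n) x ↔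
      (Function.minimalPeriod (fun y => (s * t) • y) x : ℤ) ∣ m - n := by
    intro m n
    rw [← key, sub_eq_neg_add, zpow_add, Equiv.Perm.mul_apply, zpow_neg, Equiv.Perm.inv_eq_iff_eq]
  have cond : ∀ n : ℤ, (s (((s * t) ^ n) x) = ((s * t) ^ n) x ∨ t (((s * t) ^ n) x) = ((s * t) ^ n) x) →
      (Function.minimalPeriod (fun y => (s * t) • y) x : ℤ) ∣ 2 * n ∨
      (Function.minimalPeriod (fun y => (s * t) • y) x : ℤ) ∣ 2 * n - 1 := by
    intro n hn
    rcases hn with hn | hn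
    · rw [s_zpow s t hs ht n x hx, eq_comm, two] at hn
      exact .inr (by rwa [show 2 * n - 1 = n - (1 - n) by ring])
    · rw [t_zpow s t hs ht n x hx, eq_comm, two] at hn
      exact .inl (by rwa [show 2 * n = n - -n by ring])
  rcases int_three (cond a hy) (cond b hz) with h | h | h
  · exact .inl ((key a).2 h).symm
  · exact .inr (.inl ((key b).2 h).symm)
  · exact .inr (.inr ((two a b).2 h))
end

theorem three {N : Type} (s t : Equiv.Perm N) (hs : s * s = 1) (ht : t * t = 1)
    {E : N → N → Prop} (hE : ∀ u v, E u v → v = u ∨ v = s u ∨ v = t u) {x y z : N}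
    (hx : s x = x ∨ t x = x) (hy : s y = y ∨ t y = y) (hz : s z = z ∨ t z = z)
    (h1 : Relation.TransGen E x y) (h2 : Relation.TransGen E x z) : x = y ∨ x = z ∨ y = z := by
  rcases hx with hx | hx
  · exact three' t s ht hs (fun u v h => (hE u v h).imp id Or.symm) hx hy.symm hz.symm h1 h2
  · exact three' s t hs ht hE hx hy hz h1 h2

def Uniq {α : Type} (R : α → α → Prop) : Prop := ∀ ⦃x y z⦄, R x y → R x z → x = y ∨ x = z ∨ y = z

theorem exists_inv {α : Type} {R : α → α → Prop} (hR : SymR R) (hu : Uniq R) :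
    ∃ σ : α → α, (∀ x, σ (σ x) = x) ∧ ∀ x y, R x y → y = x ∨ y = σ x := by
  classical
  let σ : α → α := fun x => if h : ∃ y, y ≠ x ∧ R x y then h.choose else x
  have h1 : ∀ x y, y ≠ x → R x y → σ x = y := by
    intro x y hxy hr
    have h : ∃ y, y ≠ x ∧ R x y := ⟨y, hxy, hr⟩
    simp only [σ, dif_pos h]
    have := h.choose_spec
    rcases hu this.2 hr with h | h | h
    · exact (this.1 h.symm).elim
    · exact (hxy h.symm).elim
    · exact h
  refine ⟨σ, fun x => ?_, fun x y hr => ?_⟩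
  · by_cases h : ∃ y, y ≠ x ∧ R x y
    · obtain ⟨y, h2, h3⟩ := h
      rw [h1 x y h2 h3, h1 y x h2.symm (hR h3)]
    · have : σ x = x := by simp only [σ, dif_neg h]
      rw [this, this]
  · by_cases h : y = x
    · exact .inl h
    · exact .inr (h1 x y h hr).symm

theorem uniq_comp {R S : GRel} (hR : SymR R) (hS : SymR S) (uR : Uniq R) (uS : Uniq S) :
    Uniq (gComp S R) := by
  obtain ⟨σ, s1, s2⟩ := exists_inv hR uR
  obtain ⟨τ, t1, t2⟩ := exists_inv hS uS
  let s0 : ℕ ⊕ ℕ ⊕ ℕ → ℕ ⊕ ℕ ⊕ ℕ := fun x => match x with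
    | .inl i => Sum.map id Sum.inl (σ (.inl i))
    | .inr (.inl i) => Sum.map id Sum.inl (σ (.inr i))
    | .inr (.inr i) => .inr (.inr i)
  let t0 : ℕ ⊕ ℕ ⊕ ℕ → ℕ ⊕ ℕ ⊕ ℕ := fun x => match x with
    | .inl i => .inl i
    | .inr x => .inr (τ x)
  have s0m : ∀ x, s0 (Sum.map id Sum.inl x) = Sum.map id Sum.inl (σ x) := by
    rintro (x | x) <;> rfl
  have s0i : ∀ x, s0 (s0 x) = x := by
    rintro (x | x | x)
    · exact (s0m _).trans (by rw [s1]; rfl)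
    · exact (s0m _).trans (by rw [s1]; rfl)
    · rfl
  have t0i : ∀ x, t0 (t0 x) = x := by
    rintro (x | x)
    · rfl
    · simp only [t0, t1]
  let s : Equiv.Perm (ℕ ⊕ ℕ ⊕ ℕ) := ⟨s0, s0, s0i, s0i⟩
  let t : Equiv.Perm (ℕ ⊕ ℕ ⊕ ℕ) := ⟨t0, t0, t0i, t0i⟩
  have out : ∀ x : ℕ ⊕ ℕ, s (Sum.map id Sum.inr x) = Sum.map id Sum.inr x ∨
      t (Sum.map id Sum.inr x) = Sum.map id Sum.inr x := by
    rintro (x | x)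
    · exact .inr rfl
    · exact .inl rfl
  have inj : ∀ x y : ℕ ⊕ ℕ, (Sum.map id Sum.inr x : ℕ ⊕ ℕ ⊕ ℕ) = Sum.map id Sum.inr y → x = y := by
    intro x y h
    exact Sum.map_injective.2 ⟨Function.injective_id, Sum.inr_injective⟩ h
  intro x y z h1 h2
  refine (three s t (Equiv.ext s0i) (Equiv.ext t0i) ?_ (out x) (out y) (out z) h1 h2).imp (inj _ _)
    (Or.imp (inj _ _) (inj _ _))
  rintro _ _ (⟨x', y', rfl, rfl, h3⟩ | ⟨x', y', rfl, rfl, h3⟩)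
  · rcases s2 _ _ h3 with rfl | rfl
    · exact .inl rfl
    · exact .inr (.inl (s0m _).symm)
  · rcases t2 _ _ h3 with rfl | rfl
    · exact .inl rfl
    · exact .inr (.inr rfl)

def Bnd (m n : ℕ) (R : GRel) : Prop := ∀ ⦃x y⦄, R x y → Sum.elim (fun i => i < m) (fun i => i < n) x

theorem par_inv {m n m' n' : ℕ} {R S : GRel} (hR : SymR R) (hS : SymR S) (bR : Bnd m n R) (bS : Bnd m' n' S)
    (uR : Uniq R) (uS : Uniq S) : Bnd (m + m') (n + n') (gPar m n R S) ∧ Uniq (gPar m n R S) := by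
  have inj : Function.Injective (Sum.map (· + m) (· + n) : ℕ ⊕ ℕ → ℕ ⊕ ℕ) :=
    Sum.map_injective.2 ⟨add_left_injective m, add_left_injective n⟩
  constructor
  · rintro x y (h | ⟨u, v, h, rfl, rfl⟩)
    · have := bR h
      rcases x with x | x
      · exact lt_of_lt_of_le this (Nat.le_add_right _ _)
      · exact lt_of_lt_of_le this (Nat.le_add_right _ _)
    · have := bS h
      rcases u with u | u
      · simp only [Sum.elim_inl, Sum.map_inl] at this ⊢; omega
      · simp only [Sum.elim_inr, Sum.map_inr] at this ⊢; omega
  · have no : ∀ u v w, R (Sum.map (· + m) (· + n) u) w → S u v → False := by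
      intro u v w h1 h2
      have := bR h1
      rcases u with u | u <;> simp only [Sum.elim_inl, Sum.map_inl, Sum.elim_inr, Sum.map_inr] at this <;> omega
    rintro x y z (h | ⟨u, v, h, rfl, rfl⟩) (k | ⟨u', v', k, hu, rfl⟩)
    · exact uR h k
    · subst hu; exact (no _ _ _ h k).elim
    · exact (no _ _ _ k h).elim
    · obtain rfl := inj hu
      rcases uS h k with h | h | h
      · exact .inl (by rw [h])
      · exact .inr (.inl (by rw [h]))
      · exact .inr (.inr (by rw [h]))

theorem id_inv (n : ℕ) : Bnd n n (gId n) ∧ Uniq (gId n) := by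
  constructor
  · rintro x y ⟨i, h, rfl | rfl, _⟩ <;> exact h
  · rintro x y z ⟨i, h, h1, h2⟩ ⟨j, h', h3, h4⟩
    rcases h1 with rfl | rfl <;> rcases h2 with rfl | rfl <;> rcases h3 with h3 | h3 <;>
      rcases h4 with rfl | rfl <;> simp_all

theorem swap_inv (a b : ℕ) : Bnd (a + b) (b + a) (gSwap a b) ∧ Uniq (gSwap a b) := by
  constructor
  · rintro x y ⟨i, h, rfl | rfl, _⟩
    · exact h
    · simp only [Sum.elim_inr]; split_ifs <;> omega
  · rintro x y z ⟨i, h, h1, h2⟩ ⟨j, h', h3, h4⟩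
    have inj : (if i < a then i + b else i - a) = (if j < a then j + b else j - a) → i = j := by
      split_ifs <;> omega
    have hij : i = j := by
      rcases h1 with rfl | rfl <;> rcases h3 with h3 | h3
      · simpa using h3
      · simp at h3
      · simp at h3
      · exact inj (by simpa using h3)
    subst hij
    rcases h1 with rfl | rfl <;> rcases h2 with rfl | rfl <;> rcases h4 with rfl | rfl <;> simp

theorem delta_inv (a b : ℕ) : Bnd a (a + (b + b)) (gDelta a b) ∧ Uniq (gDelta a b) := by
  constructor
  · rintro x y (⟨i, h, rfl | rfl, _⟩ | ⟨i, h, rfl | rfl, _⟩) <;> simp <;> omega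
  · rintro x y z (⟨i, h, h1, h2⟩ | ⟨i, h, h1, h2⟩) (⟨j, h', h3, h4⟩ | ⟨j, h', h3, h4⟩) <;>
    rcases h1 with rfl | rfl <;> rcases h2 with rfl | rfl <;> rcases h3 with h3 | h3 <;>
      rcases h4 with rfl | rfl <;> simp at h3 ⊢ <;> omega

theorem sigma_inv (a b : ℕ) : Bnd ((b + b) + a) a (gSigma a b) ∧ Uniq (gSigma a b) := by
  constructor
  · rintro x y (⟨i, h, rfl | rfl, _⟩ | ⟨i, h, rfl | rfl, _⟩) <;> simp <;> omega
  · rintro x y z (⟨i, h, h1, h2⟩ | ⟨i, h, h1, h2⟩) (⟨j, h', h3, h4⟩ | ⟨j, h', h3, h4⟩) <;>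
    rcases h1 with rfl | rfl <;> rcases h2 with rfl | rfl <;> rcases h3 with h3 | h3 <;>
      rcases h4 with rfl | rfl <;> simp at h3 ⊢ <;> omega

theorem comp_bnd {m n p : ℕ} {R S : GRel} (hR : Bnd m n R) (hS : Bnd n p S) : Bnd m p (gComp S R) := by
  intro x y h
  obtain ⟨w, h, _⟩ := Relation.TransGen.head'_iff.1 h
  rcases h with ⟨x', y', h1, h2, h3⟩ | ⟨x', y', h1, h2, h3⟩
  · have := hR h3
    rcases x with x | x <;> rcases x' with x' | x' <;> simp at h1
    subst h1; exact this
  · have := hS h3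
    rcases x with x | x <;> rcases x' with x' | x' <;> simp at h1
    subst h1; exact this

theorem G_inv {A B : Form P} (f : Term P A B) :
    Bnd A.size B.size (Term.G f) ∧ Uniq (Term.G f) := by
  induction f with
  | id A => exact id_inv _
  | comp g f hg hf => exact ⟨comp_bnd hf.1 hg.1, uniq_comp (G_symm f) (G_symm g) hf.2 hg.2⟩
  | conj f g hf hg => exact par_inv (G_symm f) (G_symm g) hf.1 hg.1 hf.2 hg.2
  | disj f g hf hg => exact par_inv (G_symm f) (G_symm g) hf.1 hg.1 hf.2 hg.2
  | cConj A B => exact swap_inv _ _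
  | cDisj A B => exact swap_inv _ _
  | delta B A => exact delta_inv _ _
  | sigma B A => exact sigma_inv _ _
  | bConjFrom A B C =>
    have := id_inv (A.size + B.size + C.size)
    simpa only [Form.size, Term.G, Nat.add_assoc] using this
  | bDisjFrom A B C =>
    have := id_inv (A.size + B.size + C.size)
    simpa only [Form.size, Term.G, Nat.add_assoc] using this
  | bConjTo A B C =>
    have := id_inv (A.size + B.size + C.size)
    simpa only [Form.size, Term.G, Nat.add_assoc] using this
  | bDisjTo A B C =>
    have := id_inv (A.size + B.size + C.size)
    simpa only [Form.size, Term.G, Nat.add_assoc] using this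
  | d A B C =>
    have := id_inv (A.size + B.size + C.size)
    simpa only [Form.size, Term.G, Nat.add_assoc] using this

/-! ## The end of the proof -/

open Classical in
theorem occ_lab (l : ℕ → K) (A : Form P) (p : P) (c : K) :
    occ (lab l A) (p, c) ≤ ((Finset.range A.size).filter (fun i => l i = c)).card := by
  rw [← Nat.count_eq_card_filter_range]
  induction A generalizing l with
  | letter q =>
    simp only [lab, occ, Form.size]
    split_ifs with h
    · have : l 0 = c := by simpa using congrArg Prod.snd h
      simp [this, Nat.count_succ]
    · exact Nat.zero_le _
  | neg A ih => exact ih l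
  | conj A B iA iB =>
    simp only [lab, occ, Form.size]
    rw [Nat.count_add]
    exact Nat.add_le_add (iA l) (iB _)
  | disj A B iA iB =>
    simp only [lab, occ, Form.size]
    rw [Nat.count_add]
    exact Nat.add_le_add (iA l) (iB _)

theorem class_card {R : GRel} (hR : SymR R) (hu : Uniq R) (S : Finset (ℕ ⊕ ℕ))
    (c : Quot R) (hS : ∀ x ∈ S, Quot.mk R x = c) : S.card ≤ 2 := by
  obtain ⟨σ, s1, s2⟩ := exists_inv hR hu
  have key : ∀ x y, Quot.mk R x = Quot.mk R y → y = x ∨ y = σ x := by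
    intro x y h
    replace h := Quot.eqvGen_exact h
    induction h with
    | rel x y h => exact s2 x y h
    | refl x => exact .inl rfl
    | symm x y _ ih =>
      rcases ih with rfl | rfl
      · exact .inl rfl
      · exact .inr (s1 _).symm
    | trans x y z _ _ ih ih' =>
      rcases ih with rfl | rfl <;> rcases ih' with rfl | rfl
      · exact .inl rfl
      · exact .inr rfl
      · exact .inr rfl
      · exact .inl (s1 _)
  by_contra hc
  obtain ⟨x, hx, y, hy, z, hz, h1, h2, h3⟩ := Finset.two_lt_card.1 (not_le.1 hc)
  rcases key x y ((hS x hx).trans (hS y hy).symm) with h | h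
  · exact h1 h.symm
  · rcases key x z ((hS x hx).trans (hS z hz).symm) with h' | h'
    · exact h2 h'.symm
    · exact h3 (h.trans h'.symm)

theorem coherence {A B : Form P} (f g : Term P A B) (h : Term.G f = Term.G g) : Eqv f g := by
  classical
  let R := Term.G f
  let l : ℕ → Quot R := fun i => Quot.mk R (Sum.inl i)
  let k : ℕ → Quot R := fun i => Quot.mk R (Sum.inr i)
  have : Nonempty (Quot R) := ⟨l 0⟩
  have hlk : ∀ x, Sum.elim l k x = Quot.mk R x := by rintro (x | x) <;> rfl
  have hc : Compat R l k := by
    intro x y hxy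
    rw [hlk, hlk]
    exact Quot.sound hxy
  obtain ⟨f', hf⟩ := lift_exists f l k hc
  obtain ⟨g', hg⟩ := lift_exists g l k (h ▸ hc)
  refine hf.eqv hg (mk_eq.1 (balanced_eq _ _ ?_))
  rintro ⟨p, c⟩
  refine (Nat.add_le_add (occ_lab l A p c) (occ_lab k B p c)).trans ?_
  rw [← Finset.card_disjSum]
  refine class_card (G_symm f) (G_inv f).2 _ c ?_
  intro x hx
  rcases x with x | x <;> simp at hx <;> exact hx.2
end PNC

/-- **PN¬ Coherence**: the functor `G` from PN¬ to Br is faithful; that is, for all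
arrow terms `f, g : A ⊢ B` of PN¬, if `Gf = Gg` in Br then `f = g` in PN¬. -/
theorem PNneg_coherence {P : Type} {A B : Form P} (f g : Term P A B) :
    Term.G f = Term.G g → Eqv f g := by
  intro h
  exact PNC.coherence f g h
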